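/- Let (X₁,μ₁), (X₂,μ₂), (Y₁,ν₁), (Y₂,ν₂) be standard measure spaces, let κ ⊆ X₁×X₂ and λ ⊆ Y₁×Y₂ be operator synthetic ω-closed sets, and let κ′ ⊆ X₁×X₂ be an ω-closed set of finite width. If ρ(κ×λ) is operator synthetic, then ρ((κ ∪ κ′)×λ) is operator synthetic. -/

import Mathlib

open scoped ComplexInnerProductSpace Pointwise
open Set MeasureTheory

noncomputable section

namespace OpSynth

/-! ### The σ-weak (weak*) topology on `B(H,K)` -/

/-- The σ-weak (weak*) topology on the space of bounded operators between Hilbert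
spaces: the initial topology with respect to the functionals
`T ↦ ∑' n, ⟪η n, T (ξ n)⟫` associated to square-summable sequences `ξ`, `η`.
This is the weak* topology arising from the identification of `B(H,K)` with the
dual of the trace class operators. -/
def sigmaWeak (H K : Type*) [NormedAddCommGroup H] [InnerProductSpace ℂ H]
    [NormedAddCommGroup K] [InnerProductSpace ℂ K] :
    TopologicalSpace (H →L[ℂ] K) :=
  ⨅ (ξ : ℕ → H) (η : ℕ → K) (_ : Summable fun n => ‖ξ n‖ ^ 2)
    (_ : Summable fun n => ‖η n‖ ^ 2),
    TopologicalSpace.induced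
      (fun T : H →L[ℂ] K => ∑' n, ⟪η n, T (ξ n)⟫) inferInstance

section Basic

variable {H K H₁ H₂ H₃ K₁ K₂ T₁ T₂ : Type*}
  [NormedAddCommGroup H] [InnerProductSpace ℂ H]
  [NormedAddCommGroup K] [InnerProductSpace ℂ K]
  [NormedAddCommGroup H₁] [InnerProductSpace ℂ H₁]
  [NormedAddCommGroup H₂] [InnerProductSpace ℂ H₂]
  [NormedAddCommGroup H₃] [InnerProductSpace ℂ H₃]
  [NormedAddCommGroup K₁] [InnerProductSpace ℂ K₁]
  [NormedAddCommGroup K₂] [InnerProductSpace ℂ K₂]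
  [NormedAddCommGroup T₁] [InnerProductSpace ℂ T₁]
  [NormedAddCommGroup T₂] [InnerProductSpace ℂ T₂]

/-- A set of operators is weak* closed if it is closed in the σ-weak topology. -/
def WkClosed (S : Set (H →L[ℂ] K)) : Prop :=
  @IsClosed _ (sigmaWeak H K) S

/-- The weak* closure of a set of operators. -/
def wkClosure (S : Set (H →L[ℂ] K)) : Set (H →L[ℂ] K) :=
  @closure _ (sigmaWeak H K) S

/-- A weak* closed (linear) subspace of `B(H,K)`. -/
def IsWkClosedSubspace (S : Set (H →L[ℂ] K)) : Prop :=
  (∃ M : Submodule ℂ (H →L[ℂ] K), (M : Set (H →L[ℂ] K)) = S) ∧ WkClosed S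

/-- A map between operator spaces is weak* continuous if it is continuous with
respect to the σ-weak topologies. -/
def WkContinuous (φ : (H₁ →L[ℂ] H₂) → (K₁ →L[ℂ] K₂)) : Prop :=
  @Continuous _ _ (sigmaWeak H₁ H₂) (sigmaWeak K₁ K₂) φ

/-- The norm of an `n × n` matrix of operators, viewed as an operator on the
column Hilbert space `ℓ²(Fin n, H)`: the supremum over the unit ball of the
ℓ²-norm of the image. -/
def blockNorm {n : ℕ} (M : Matrix (Fin n) (Fin n) (H →L[ℂ] K)) : ℝ :=
  sSup { r | ∃ v : Fin n → H, (∑ j, ‖v j‖ ^ 2) ≤ 1 ∧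
    r = Real.sqrt (∑ i, ‖∑ j, M i j (v j)‖ ^ 2) }

/-- A map `φ : B(H₁,H₂) → B(K₁,K₂)` is completely bounded if its matrix
amplifications are uniformly bounded. -/
def CompletelyBounded (φ : (H₁ →L[ℂ] H₂) → (K₁ →L[ℂ] K₂)) : Prop :=
  ∃ C : ℝ, 0 ≤ C ∧ ∀ (n : ℕ) (M : Matrix (Fin n) (Fin n) (H₁ →L[ℂ] H₂)),
    blockNorm (M.map φ) ≤ C * blockNorm M

/-- `t : H → K → T₁` realizes `T₁` as the Hilbertian tensor product `H ⊗ K`: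
`t` is bilinear, multiplicative for inner products, and has total range. -/
def IsTensorEmbedding (t : H → K → T₁) : Prop :=
  (∀ x x' y, t (x + x') y = t x y + t x' y) ∧
  (∀ x y y', t x (y + y') = t x y + t x y') ∧
  (∀ (c : ℂ) x y, t (c • x) y = c • t x y) ∧
  (∀ (c : ℂ) x y, t x (c • y) = c • t x y) ∧
  (∀ x x' y y', ⟪t x y, t x' y'⟫ = ⟪x, x'⟫ * ⟪y, y'⟫) ∧
  (Submodule.span ℂ { z | ∃ x y, z = t x y }).topologicalClosure = ⊤

/-- `W` is the elementary tensor `S ⊗ R` of the operators `S` and `R`, relative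
to the tensor product realizations `t₁`, `t₂`. -/
def IsElemTensor (t₁ : H₁ → K₁ → T₁) (t₂ : H₂ → K₂ → T₂)
    (W : T₁ →L[ℂ] T₂) (S : H₁ →L[ℂ] H₂) (R : K₁ →L[ℂ] K₂) : Prop :=
  ∀ x y, W (t₁ x y) = t₂ (S x) (R y)

/-- The weak* closed tensor product `V ⊗̄ U`: the weak* closed subspace generated
by the elementary tensors `S ⊗ R` with `S ∈ V`, `R ∈ U`. -/
def wTensor (t₁ : H₁ → K₁ → T₁) (t₂ : H₂ → K₂ → T₂)
    (V : Set (H₁ →L[ℂ] H₂)) (U : Set (K₁ →L[ℂ] K₂)) : Set (T₁ →L[ℂ] T₂) :=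
  wkClosure ↑(Submodule.span ℂ
    { W : T₁ →L[ℂ] T₂ | ∃ S ∈ V, ∃ R ∈ U, IsElemTensor t₁ t₂ W S R })

/-- The Fubini product `F(V,U) = (V ⊗̄ B(K₁,K₂)) ∩ (B(H₁,H₂) ⊗̄ U)`. -/
def Fubini (t₁ : H₁ → K₁ → T₁) (t₂ : H₂ → K₂ → T₂)
    (V : Set (H₁ →L[ℂ] H₂)) (U : Set (K₁ →L[ℂ] K₂)) : Set (T₁ →L[ℂ] T₂) :=
  wTensor t₁ t₂ V univ ∩ wTensor t₁ t₂ univ U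

/-- Sum of finitely many subsets of an additive monoid. -/
def setSum {α : Type*} [AddCommMonoid α] {n : ℕ} (S : Fin n → Set α) : Set α :=
  { x | ∃ f : Fin n → α, (∀ i, f i ∈ S i) ∧ x = ∑ i, f i }

/-- The reflexive hull `Ref W = {T : Tx ∈ closure (W x) for all x}`. -/
def RefHull (W : Set (H →L[ℂ] K)) : Set (H →L[ℂ] K) :=
  { T | ∀ x : H, T x ∈ closure ((fun S : H →L[ℂ] K => S x) '' W) }

end Basic

/-- Property `S_σ`: `F(V,U) = V ⊗̄ U` for every weak* closed subspace `U` of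
`B(K₁,K₂)`, all Hilbert spaces `K₁`, `K₂`, and all realizations of the
corresponding Hilbertian tensor products. -/
def HasSsigma {H₁ H₂ : Type*}
    [NormedAddCommGroup H₁] [InnerProductSpace ℂ H₁]
    [NormedAddCommGroup H₂] [InnerProductSpace ℂ H₂]
    (V : Set (H₁ →L[ℂ] H₂)) : Prop :=
  ∀ (K₁ K₂ T₁ T₂ : Type)
    [NormedAddCommGroup K₁] [InnerProductSpace ℂ K₁] [CompleteSpace K₁]
    [NormedAddCommGroup K₂] [InnerProductSpace ℂ K₂] [CompleteSpace K₂]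
    [NormedAddCommGroup T₁] [InnerProductSpace ℂ T₁] [CompleteSpace T₁]
    [NormedAddCommGroup T₂] [InnerProductSpace ℂ T₂] [CompleteSpace T₂]
    (t₁ : H₁ → K₁ → T₁) (t₂ : H₂ → K₂ → T₂),
    IsTensorEmbedding t₁ → IsTensorEmbedding t₂ →
    ∀ U : Set (K₁ →L[ℂ] K₂), IsWkClosedSubspace U →
      Fubini t₁ t₂ V U = wTensor t₁ t₂ V U

section Masa

variable {H H₁ H₂ H₃ : Type*}
  [NormedAddCommGroup H] [InnerProductSpace ℂ H] [CompleteSpace H]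
  [NormedAddCommGroup H₁] [InnerProductSpace ℂ H₁] [CompleteSpace H₁]
  [NormedAddCommGroup H₂] [InnerProductSpace ℂ H₂] [CompleteSpace H₂]
  [NormedAddCommGroup H₃] [InnerProductSpace ℂ H₃] [CompleteSpace H₃]

/-- A masa: a maximal abelian selfadjoint subalgebra of `B(H)`. -/
def IsMasa (D : StarSubalgebra ℂ (H →L[ℂ] H)) : Prop :=
  (∀ a ∈ D, ∀ b ∈ D, a * b = b * a) ∧
  ∀ E : StarSubalgebra ℂ (H →L[ℂ] H),
    (∀ a ∈ E, ∀ b ∈ E, a * b = b * a) → D ≤ E → E = D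

/-- A (weak* closed) `D₂,D₁`-masa-bimodule. -/
def IsMasaBimodule (D₁ : StarSubalgebra ℂ (H₁ →L[ℂ] H₁))
    (D₂ : StarSubalgebra ℂ (H₂ →L[ℂ] H₂)) (V : Set (H₁ →L[ℂ] H₂)) : Prop :=
  IsWkClosedSubspace V ∧
  ∀ X ∈ V, ∀ A ∈ D₁, ∀ B ∈ D₂, B ∘L X ∘L A ∈ V

/-- A ternary set of operators: closed under the triple product `T S* R`. -/
def IsTernary (M : Set (H₁ →L[ℂ] H₂)) : Prop :=
  ∀ T ∈ M, ∀ S ∈ M, ∀ R ∈ M, T ∘L (ContinuousLinearMap.adjoint S) ∘L R ∈ M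

/-- An orthogonal projection. -/
def IsProj (p : H →L[ℂ] H) : Prop := p ∘L p = p ∧ IsSelfAdjoint p

/-- A minimal non-zero projection of a masa. -/
def IsMinimalProjOf (D : StarSubalgebra ℂ (H →L[ℂ] H)) (p : H →L[ℂ] H) : Prop :=
  p ∈ D ∧ IsProj p ∧ p ≠ 0 ∧
    ∀ q ∈ D, IsProj q → p ∘L q = q → q = 0 ∨ q = p

/-- A projection in a masa is non-atomic if it dominates no minimal non-zero
projection of the masa. -/
def IsNonAtomicProj (D : StarSubalgebra ℂ (H →L[ℂ] H)) (E : H →L[ℂ] H) : Prop :=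
  ∀ p, IsMinimalProjOf D p → ¬ (E ∘L p = p)

/-- A `D₂,D₁`-masa-bimodule map. -/
def IsMasaBimoduleMap (D₁ : StarSubalgebra ℂ (H₁ →L[ℂ] H₁))
    (D₂ : StarSubalgebra ℂ (H₂ →L[ℂ] H₂))
    (φ : (H₁ →L[ℂ] H₂) → (H₁ →L[ℂ] H₂)) : Prop :=
  ∀ (X : H₁ →L[ℂ] H₂), ∀ A ∈ D₁, ∀ B ∈ D₂,
    φ (B ∘L X ∘L A) = B ∘L (φ X) ∘L A

/-- A Schur idempotent: a weak* continuous completely bounded idempotent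
masa-bimodule map. -/
def IsSchurIdempotent (D₁ : StarSubalgebra ℂ (H₁ →L[ℂ] H₁))
    (D₂ : StarSubalgebra ℂ (H₂ →L[ℂ] H₂))
    (φ : (H₁ →L[ℂ] H₂) → (H₁ →L[ℂ] H₂)) : Prop :=
  IsLinearMap ℂ φ ∧ WkContinuous φ ∧ CompletelyBounded φ ∧ φ ∘ φ = φ ∧
    IsMasaBimoduleMap D₁ D₂ φ

/-- A nest: a totally ordered family of closed subspaces containing the
intersection and the closed linear span of any of its subsets. -/
def IsNest (N : Set (Submodule ℂ H)) : Prop :=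
  (∀ p ∈ N, IsClosed (p : Set H)) ∧ IsChain (· ≤ ·) N ∧
  ∀ S : Set (Submodule ℂ H), S ⊆ N →
    sInf S ∈ N ∧ (sSup S).topologicalClosure ∈ N

/-- The nest algebra of a nest: all operators leaving each subspace invariant. -/
def nestAlg (N : Set (Submodule ℂ H)) : Set (H →L[ℂ] H) :=
  { T | ∀ p ∈ N, ∀ x ∈ p, T x ∈ p }

/-- A (weak* closed) nest algebra bimodule. -/
def IsNestBimodule (V : Set (H₁ →L[ℂ] H₂)) : Prop :=
  IsWkClosedSubspace V ∧
  ∃ (N₁ : Set (Submodule ℂ H₁)) (N₂ : Set (Submodule ℂ H₂)),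
    IsNest N₁ ∧ IsNest N₂ ∧
    ∀ X ∈ V, ∀ A ∈ nestAlg N₁, ∀ B ∈ nestAlg N₂, B ∘L X ∘L A ∈ V

/-- A masa-bimodule of finite width: a finite intersection of masa-bimodules
each of which is a nest algebra bimodule. -/
def HasFiniteWidth (D₁ : StarSubalgebra ℂ (H₁ →L[ℂ] H₁))
    (D₂ : StarSubalgebra ℂ (H₂ →L[ℂ] H₂)) (V : Set (H₁ →L[ℂ] H₂)) : Prop :=
  ∃ (k : ℕ) (Vs : Fin k → Set (H₁ →L[ℂ] H₂)),
    (∀ j, IsMasaBimodule D₁ D₂ (Vs j) ∧ IsNestBimodule (Vs j)) ∧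
    V = ⋂ j, Vs j

end Masa

section Algebras

variable {H H₁ H₂ H₃ K : Type*}
  [NormedAddCommGroup H] [InnerProductSpace ℂ H] [CompleteSpace H]
  [NormedAddCommGroup H₁] [InnerProductSpace ℂ H₁] [CompleteSpace H₁]
  [NormedAddCommGroup H₂] [InnerProductSpace ℂ H₂] [CompleteSpace H₂]
  [NormedAddCommGroup H₃] [InnerProductSpace ℂ H₃] [CompleteSpace H₃]

/-- A weak* closed unital operator algebra in `B(H)`. -/
def IsWkClosedUnitalAlg (A : Set (H →L[ℂ] H)) : Prop :=
  IsWkClosedSubspace A ∧ (1 : H →L[ℂ] H) ∈ A ∧ ∀ a ∈ A, ∀ b ∈ A, a ∘L b ∈ A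

/-- `[X Y]`: the weak* closed linear span of the products `x ∘ y`. -/
def mulSpan (X : Set (H₂ →L[ℂ] H₃)) (Y : Set (H₁ →L[ℂ] H₂)) :
    Set (H₁ →L[ℂ] H₃) :=
  wkClosure ↑(Submodule.span ℂ { T : H₁ →L[ℂ] H₃ | ∃ x ∈ X, ∃ y ∈ Y, T = x ∘L y })

/-- The data witnessing a spatial embedding of `A` into `B`. -/
def SpatialPair (A : Set (H₁ →L[ℂ] H₁)) (B : Set (H₂ →L[ℂ] H₂))
    (X : Set (H₁ →L[ℂ] H₂)) (Y : Set (H₂ →L[ℂ] H₁)) : Prop :=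
  IsWkClosedSubspace X ∧ IsWkClosedSubspace Y ∧
  (∀ x ∈ X, ∀ b ∈ B, ∀ a ∈ A, b ∘L x ∘L a ∈ X) ∧
  (∀ y ∈ Y, ∀ a ∈ A, ∀ b ∈ B, a ∘L y ∘L b ∈ Y) ∧
  mulSpan X Y ⊆ B ∧ mulSpan Y X = A

/-- `A` is spatially embedded in `B`. -/
def SpatiallyEmbedded (A : Set (H₁ →L[ℂ] H₁)) (B : Set (H₂ →L[ℂ] H₂)) : Prop :=
  ∃ X Y, SpatialPair A B X Y

/-- `A` and `B` are spatially Morita equivalent. -/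
def SpatiallyMorita (A : Set (H₁ →L[ℂ] H₁)) (B : Set (H₂ →L[ℂ] H₂)) : Prop :=
  ∃ X Y, SpatialPair A B X Y ∧ mulSpan X Y = B

/-- The strong operator topology on `B(H,K)`. -/
def sot (H K : Type*) [NormedAddCommGroup H] [InnerProductSpace ℂ H]
    [NormedAddCommGroup K] [InnerProductSpace ℂ K] :
    TopologicalSpace (H →L[ℂ] K) :=
  TopologicalSpace.induced (fun T : H →L[ℂ] K => (T : H → K)) Pi.topologicalSpace

/-- A commutative subspace lattice (CSL): a strongly closed lattice of mutually
commuting orthogonal projections containing `0` and `1`. -/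
def IsCSL (L : Set (H →L[ℂ] H)) : Prop :=
  (∀ P ∈ L, IsProj P) ∧
  (∀ P ∈ L, ∀ Q ∈ L, P ∘L Q = Q ∘L P) ∧
  (0 : H →L[ℂ] H) ∈ L ∧ (1 : H →L[ℂ] H) ∈ L ∧
  (∀ P ∈ L, ∀ Q ∈ L, P ∘L Q ∈ L ∧ P + Q - P ∘L Q ∈ L) ∧
  @IsClosed _ (sot H H) L

/-- The CSL algebra `Alg L = {T : (1 - P) T P = 0 for all P ∈ L}`. -/
def cslAlg (L : Set (H →L[ℂ] H)) : Set (H →L[ℂ] H) :=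
  { T | ∀ P ∈ L, (1 - P) ∘L T ∘L P = 0 }

/-- A lattice homomorphism between CSLs (preserving meets and joins). -/
def IsLatticeHom (L₁ : Set (H₁ →L[ℂ] H₁)) (L₂ : Set (H₂ →L[ℂ] H₂))
    (φ : (H₁ →L[ℂ] H₁) → (H₂ →L[ℂ] H₂)) : Prop :=
  MapsTo φ L₁ L₂ ∧
  (∀ P ∈ L₁, ∀ Q ∈ L₁, φ (P ∘L Q) = φ P ∘L φ Q) ∧
  (∀ P ∈ L₁, ∀ Q ∈ L₁, φ (P + Q - P ∘L Q) = φ P + φ Q - φ P ∘L φ Q)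

end Algebras

section MeasurePart

variable {X X₁ X₂ : Type*} [MeasurableSpace X] [MeasurableSpace X₁] [MeasurableSpace X₂]

/-- A subset of a product of measure spaces is marginally null if it is
contained in `(M₁ × X₂) ∪ (X₁ × M₂)` with `μ₁ M₁ = μ₂ M₂ = 0`. -/
def MargNull (μ₁ : Measure X₁) (μ₂ : Measure X₂) (E : Set (X₁ × X₂)) : Prop :=
  ∃ (M₁ : Set X₁) (M₂ : Set X₂), MeasurableSet M₁ ∧ MeasurableSet M₂ ∧
    μ₁ M₁ = 0 ∧ μ₂ M₂ = 0 ∧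
    E ⊆ (M₁ ×ˢ (univ : Set X₂)) ∪ ((univ : Set X₁) ×ˢ M₂)

/-- Marginal equivalence: the symmetric difference is marginally null. -/
def MargEquiv (μ₁ : Measure X₁) (μ₂ : Measure X₂) (E F : Set (X₁ × X₂)) : Prop :=
  MargNull μ₁ μ₂ ((E \ F) ∪ (F \ E))

/-- ω-open sets: marginally equivalent to a countable union of measurable
rectangles. -/
def OmegaOpen (μ₁ : Measure X₁) (μ₂ : Measure X₂) (E : Set (X₁ × X₂)) : Prop :=
  ∃ (α : ℕ → Set X₁) (β : ℕ → Set X₂),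
    (∀ n, MeasurableSet (α n)) ∧ (∀ n, MeasurableSet (β n)) ∧
    MargEquiv μ₁ μ₂ E (⋃ n, (α n) ×ˢ (β n))

/-- ω-closed sets: complements of ω-open sets. -/
def OmegaClosed (μ₁ : Measure X₁) (μ₂ : Measure X₂) (E : Set (X₁ × X₂)) : Prop :=
  OmegaOpen μ₁ μ₂ Eᶜ

/-- `A` is a multiplication operator on `L²(X,μ)`: `A f = φ · f` for some
essentially bounded function `φ`.  The collection `{A | IsMultOp μ A}` is the
multiplication masa of `L^∞(X,μ)`. -/
def IsMultOp (μ : Measure X) (A : Lp ℂ 2 μ →L[ℂ] Lp ℂ 2 μ) : Prop :=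
  ∃ φ : X → ℂ, AEStronglyMeasurable φ μ ∧ (∃ C, ∀ᵐ x ∂μ, ‖φ x‖ ≤ C) ∧
    ∀ f : Lp ℂ 2 μ, ⇑(A f) =ᵐ[μ] fun x => φ x * f x

/-- A (weak* closed) masa-bimodule over the multiplication masas. -/
def IsMultBimodule (μ₁ : Measure X₁) (μ₂ : Measure X₂)
    (V : Set (Lp ℂ 2 μ₁ →L[ℂ] Lp ℂ 2 μ₂)) : Prop :=
  IsWkClosedSubspace V ∧
  ∀ X ∈ V, ∀ (A : Lp ℂ 2 μ₁ →L[ℂ] Lp ℂ 2 μ₁) (B : Lp ℂ 2 μ₂ →L[ℂ] Lp ℂ 2 μ₂),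
    IsMultOp μ₁ A → IsMultOp μ₂ B → B ∘L X ∘L A ∈ V

/-- `T` is supported on `κ`: `M_{χ_β} T M_{χ_α} = 0` (equivalently,
`⟪T f, g⟫ = 0` whenever `f` vanishes off `α` and `g` vanishes off `β`)
whenever the rectangle `α × β` intersects `κ` marginally nullly. -/
def SupportedOn (μ₁ : Measure X₁) (μ₂ : Measure X₂) (κ : Set (X₁ × X₂))
    (T : Lp ℂ 2 μ₁ →L[ℂ] Lp ℂ 2 μ₂) : Prop :=
  ∀ (α : Set X₁) (β : Set X₂), MeasurableSet α → MeasurableSet β →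
    MargNull μ₁ μ₂ ((α ×ˢ β) ∩ κ) →
    ∀ (f : Lp ℂ 2 μ₁) (g : Lp ℂ 2 μ₂),
      (∀ᵐ x ∂μ₁, x ∉ α → f x = 0) → (∀ᵐ y ∂μ₂, y ∉ β → g y = 0) →
      ⟪T f, g⟫ = (0 : ℂ)

/-- `M_max κ`: the space of all operators supported on `κ` — the largest
masa-bimodule with support `κ`. -/
def Mmax (μ₁ : Measure X₁) (μ₂ : Measure X₂) (κ : Set (X₁ × X₂)) :
    Set (Lp ℂ 2 μ₁ →L[ℂ] Lp ℂ 2 μ₂) :=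
  { T | SupportedOn μ₁ μ₂ κ T }

/-- `U` has support `κ`: `κ` is ω-closed and `Ref U = M_max κ`. -/
def HasSupport (μ₁ : Measure X₁) (μ₂ : Measure X₂)
    (U : Set (Lp ℂ 2 μ₁ →L[ℂ] Lp ℂ 2 μ₂)) (κ : Set (X₁ × X₂)) : Prop :=
  OmegaClosed μ₁ μ₂ κ ∧ RefHull U = Mmax μ₁ μ₂ κ

/-- `M_min κ`: the smallest weak* closed masa-bimodule with support `κ`,
realized as the intersection of all weak* closed masa-bimodules with support `κ`. -/
def Mmin (μ₁ : Measure X₁) (μ₂ : Measure X₂) (κ : Set (X₁ × X₂)) :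
    Set (Lp ℂ 2 μ₁ →L[ℂ] Lp ℂ 2 μ₂) :=
  ⋂₀ { U | IsMultBimodule μ₁ μ₂ U ∧ HasSupport μ₁ μ₂ U κ }

/-- `κ` is operator synthetic if it is ω-closed and `M_min κ = M_max κ`. -/
def OperatorSynthetic (μ₁ : Measure X₁) (μ₂ : Measure X₂)
    (κ : Set (X₁ × X₂)) : Prop :=
  OmegaClosed μ₁ μ₂ κ ∧ Mmin μ₁ μ₂ κ = Mmax μ₁ μ₂ κ

/-- A masa-bimodule of finite width over the multiplication masas. -/
def MultFiniteWidth (μ₁ : Measure X₁) (μ₂ : Measure X₂)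
    (V : Set (Lp ℂ 2 μ₁ →L[ℂ] Lp ℂ 2 μ₂)) : Prop :=
  ∃ (k : ℕ) (Vs : Fin k → Set (Lp ℂ 2 μ₁ →L[ℂ] Lp ℂ 2 μ₂)),
    (∀ j, IsMultBimodule μ₁ μ₂ (Vs j) ∧ IsNestBimodule (Vs j)) ∧
    V = ⋂ j, Vs j

/-- A set of finite width: the support of a masa-bimodule of finite width. -/
def FiniteWidthSet (μ₁ : Measure X₁) (μ₂ : Measure X₂)
    (κ : Set (X₁ × X₂)) : Prop :=
  ∃ V, MultFiniteWidth μ₁ μ₂ V ∧ HasSupport μ₁ μ₂ V κ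

end MeasurePart

/-- The flip `ρ : (X₁ × X₂) × (Y₁ × Y₂) → (X₁ × Y₁) × (X₂ × Y₂)`. -/
def flipProd {X₁ X₂ Y₁ Y₂ : Type*} :
    (X₁ × X₂) × (Y₁ × Y₂) → (X₁ × Y₁) × (X₂ × Y₂) :=
  fun q => ((q.1.1, q.2.1), (q.1.2, q.2.2))

end OpSynth



open scoped ComplexInnerProductSpace Pointwise
open Set MeasureTheory OpSynth

set_option linter.all false
set_option linter.deprecated false

namespace OpSynthAux
open Filter Topology

section Hilb
variable {H K L : Type} [NormedAddCommGroup H] [InnerProductSpace ℂ H]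
  [NormedAddCommGroup K] [InnerProductSpace ℂ K]
  [NormedAddCommGroup L] [InnerProductSpace ℂ L]

def SqS {ι H : Type} [NormedAddCommGroup H] (ξ : ι → H) : Prop := Summable fun i => ‖ξ i‖ ^ 2

lemma SqS.of_le {ι : Type} {ξ : ι → H} {η : ι → K} (h : SqS ξ) (C : ℝ)
    (hc : ∀ i, ‖η i‖ ≤ C * ‖ξ i‖) : SqS η := by
  refine Summable.of_nonneg_of_le (fun i => by positivity) (fun i => ?_) (h.mul_left (C ^ 2))
  have := hc i
  calc ‖η i‖ ^ 2 ≤ (C * ‖ξ i‖) ^ 2 := by gcongr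
    _ = _ := by ring

lemma SqS.map {ι : Type} {ξ : ι → H} (h : SqS ξ) (T : H →L[ℂ] K) : SqS fun i => T (ξ i) :=
  h.of_le ‖T‖ fun i => T.le_opNorm _

lemma SqS.summable_mul {ι : Type} {ξ : ι → H} {η : ι → K} (h : SqS ξ) (h' : SqS η) :
    Summable fun i => ‖η i‖ * ‖ξ i‖ := by
  refine Summable.of_nonneg_of_le (fun i => by positivity) (fun i => ?_) (h.add h')
  nlinarith [sq_nonneg (‖η i‖ - ‖ξ i‖), sq_nonneg (‖η i‖), sq_nonneg (‖ξ i‖)]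

lemma norm_inner_op (T : H →L[ℂ] K) (f : H) (g : K) : ‖⟪g, T f⟫‖ ≤ ‖T‖ * (‖g‖ * ‖f‖) := by
  calc ‖⟪g, T f⟫‖ ≤ ‖g‖ * ‖T f‖ := norm_inner_le_norm _ _
    _ ≤ ‖g‖ * (‖T‖ * ‖f‖) := by gcongr; exact T.le_opNorm f
    _ = _ := by ring

lemma SqS.summable_inner {ι : Type} {ξ : ι → H} {η : ι → K} (h : SqS ξ) (h' : SqS η)
    (T : H →L[ℂ] K) : Summable fun i => ⟪η i, T (ξ i)⟫ :=
  Summable.of_norm_bounded ((h.summable_mul h').mul_left ‖T‖) fun _ => norm_inner_op T _ _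

lemma exists_op [CompleteSpace K] (b : K → H → ℂ) (C : ℝ) (hC : 0 ≤ C)
    (h1 : ∀ g f f', b g (f + f') = b g f + b g f') (h2 : ∀ g (c : ℂ) f, b g (c • f) = c * b g f)
    (h3 : ∀ g g' f, b (g + g') f = b g f + b g' f)
    (h4 : ∀ (c : ℂ) g f, b (c • g) f = (starRingEnd ℂ) c * b g f)
    (h5 : ∀ g f, ‖b g f‖ ≤ C * (‖g‖ * ‖f‖)) :
    ∃ T : H →L[ℂ] K, ‖T‖ ≤ C ∧ ∀ g f, ⟪g, T f⟫ = b g f := by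
  let ℓ : H → (K →L[ℂ] ℂ) := fun f => LinearMap.mkContinuous
    { toFun := fun g => (starRingEnd ℂ) (b g f)
      map_add' := fun g g' => by simp [h3]
      map_smul' := fun c g => by simp [h4] } (C * ‖f‖) (fun g => by
        have := h5 g f
        simp only [LinearMap.coe_mk, AddHom.coe_mk, RCLike.norm_conj]
        linarith)
  have hℓ : ∀ f g, ⟪g, (InnerProductSpace.toDual ℂ K).symm (ℓ f)⟫ = b g f := fun f g => by
    rw [← inner_conj_symm, InnerProductSpace.toDual_symm_apply]
    simp [ℓ]
  let T : H →L[ℂ] K := LinearMap.mkContinuous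
    { toFun := fun f => (InnerProductSpace.toDual ℂ K).symm (ℓ f)
      map_add' := fun f f' => ext_inner_left ℂ fun g => by rw [inner_add_right]; simp only [hℓ, h1]
      map_smul' := fun c f => ext_inner_left ℂ fun g => by
        rw [RingHom.id_apply, inner_smul_right]; simp only [hℓ, h2] } C (fun f => by
        simp only [LinearMap.coe_mk, AddHom.coe_mk, LinearIsometryEquiv.norm_map]
        exact LinearMap.mkContinuous_norm_le _ (by positivity) _)
  exact ⟨T, LinearMap.mkContinuous_norm_le _ hC _, fun g f => hℓ f g⟩

lemma ultralim [CompleteSpace K] (T : ℕ → H →L[ℂ] K) (C : ℝ) (hT : ∀ n, ‖T n‖ ≤ C) :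
    ∃ S : H →L[ℂ] K, ∀ g f,
      Tendsto (fun n => ⟪g, T n f⟫) (hyperfilter ℕ : Filter ℕ) (𝓝 ⟪g, S f⟫) := by
  have hC : 0 ≤ C := (norm_nonneg _).trans (hT 0)
  have hb : ∀ g f n, ‖⟪g, T n f⟫‖ ≤ C * (‖g‖ * ‖f‖) := fun g f n =>
    (norm_inner_op _ _ _).trans (by gcongr; exact hT n)
  have key : ∀ g f, ∃ z : ℂ, Tendsto (fun n => ⟪g, T n f⟫) (hyperfilter ℕ : Filter ℕ) (𝓝 z) := by
    intro g f
    have hc := isCompact_closedBall (0 : ℂ) (C * (‖g‖ * ‖f‖))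
    obtain ⟨z, -, hz⟩ := hc.ultrafilter_le_nhds ((hyperfilter ℕ).map fun n => ⟪g, T n f⟫) (by
      rw [le_principal_iff]
      refine Filter.mem_map.2 (Filter.univ_mem' fun n => ?_)
      simpa using hb g f n)
    exact ⟨z, hz⟩
  choose b hbl using key
  obtain ⟨S, -, hS⟩ := exists_op b C hC
    (fun g f f' => tendsto_nhds_unique (hbl _ _) (by simpa [inner_add_right] using (hbl g f).add (hbl g f')))
    (fun g c f => tendsto_nhds_unique (hbl _ _) (by simpa [inner_smul_right] using (hbl g f).const_mul c))
    (fun g g' f => tendsto_nhds_unique (hbl _ _) (by simpa [inner_add_left] using (hbl g f).add (hbl g' f)))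
    (fun c g f => tendsto_nhds_unique (hbl _ _)
      (by simpa [inner_smul_left, mul_comm] using (hbl g f).const_mul ((starRingEnd ℂ) c)))
    (fun g f => le_of_tendsto (hbl g f).norm (Eventually.of_forall fun n => hb g f n))
  exact ⟨S, fun g f => by rw [hS]; exact hbl g f⟩

lemma tendsto_omega {ι : Type} {l : Filter ℕ} (T : ℕ → H →L[ℂ] K) (S : H →L[ℂ] K) (C : ℝ)
    (hT : ∀ n, ‖T n‖ ≤ C) (hS : ∀ g f, Tendsto (fun n => ⟪g, T n f⟫) l (𝓝 ⟪g, S f⟫))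
    {ξ : ι → H} {η : ι → K} (h : SqS ξ) (h' : SqS η) :
    Tendsto (fun n => ∑' i, ⟪η i, T n (ξ i)⟫) l (𝓝 (∑' i, ⟪η i, S (ξ i)⟫)) :=
  tendsto_tsum_of_dominated_convergence ((h.summable_mul h').mul_left C) (fun i => hS _ _)
    (Eventually.of_forall fun n i => (norm_inner_op _ _ _).trans (by gcongr; exact hT n))

lemma tendsto_of_total (T : ℕ → H →L[ℂ] K) (S : H →L[ℂ] K) (C : ℝ)
    (hT : ∀ n, ‖T n‖ ≤ C) (A : Set H) (B : Set K)
    (hA : (Submodule.span ℂ A).topologicalClosure = ⊤) (hB : (Submodule.span ℂ B).topologicalClosure = ⊤)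
    (hS : ∀ f ∈ A, ∀ g ∈ B, Tendsto (fun n => ⟪g, T n f⟫) atTop (𝓝 ⟪g, S f⟫)) (f : H) (g : K) :
    Tendsto (fun n => ⟪g, T n f⟫) atTop (𝓝 ⟪g, S f⟫) := by
  have hC : 0 ≤ C := (norm_nonneg _).trans (hT 0)
  have h1 : ∀ f ∈ A, ∀ g ∈ Submodule.span ℂ B,
      Tendsto (fun n => ⟪g, T n f⟫) atTop (𝓝 ⟪g, S f⟫) := by
    intro f hf g hg
    induction hg using Submodule.span_induction with
    | mem g hg => exact hS f hf g hg
    | zero => simp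
    | add x y _ _ hx hy => simpa [inner_add_left] using hx.add hy
    | smul c x _ hx => simpa [inner_smul_left, mul_comm] using hx.const_mul ((starRingEnd ℂ) c)
  have h2 : ∀ f ∈ Submodule.span ℂ A, ∀ g ∈ Submodule.span ℂ B,
      Tendsto (fun n => ⟪g, T n f⟫) atTop (𝓝 ⟪g, S f⟫) := by
    intro f hf g hg
    induction hf using Submodule.span_induction with
    | mem f hf => exact h1 f hf g hg
    | zero => simp
    | add x y _ _ hx hy => simpa [inner_add_right] using hx.add hy
    | smul c x _ hx => simpa [inner_smul_right] using hx.const_mul _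
  have hA' : f ∈ closure (Submodule.span ℂ A : Set H) := by
    rw [← Submodule.topologicalClosure_coe, hA]; trivial
  have hB' : g ∈ closure (Submodule.span ℂ B : Set K) := by
    rw [← Submodule.topologicalClosure_coe, hB]; trivial
  rw [Metric.tendsto_atTop]
  intro ε hε
  set M := (C + ‖S‖) with hM
  obtain ⟨f', hf', hff⟩ := Metric.mem_closure_iff.1 hA' (ε / (4 * (M + 1) * (‖g‖ + 1))) (by positivity)
  obtain ⟨g', hg', hgg⟩ := Metric.mem_closure_iff.1 hB' (ε / (4 * (M + 1) * (‖f'‖ + 1))) (by positivity)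
  obtain ⟨N, hN⟩ := (Metric.tendsto_atTop.1 (h2 f' hf' g' hg')) (ε / 2) (by positivity)
  refine ⟨N, fun n hn => ?_⟩
  have h3 := hN n hn
  rw [dist_eq_norm] at *
  have e : ⟪g, T n f⟫ - ⟪g, S f⟫ = ⟪g, (T n - S) (f - f')⟫ + ⟪g - g', (T n - S) f'⟫
      + (⟪g', T n f'⟫ - ⟪g', S f'⟫) := by
    simp only [ContinuousLinearMap.sub_apply, map_sub, inner_sub_left, inner_sub_right]; ring
  have hTS : ‖T n - S‖ ≤ M := (norm_sub_le _ _).trans (by linarith [hT n])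
  have hM0 : 0 ≤ M := by positivity
  have a1 : ‖⟪g, (T n - S) (f - f')⟫‖ ≤ ε / 4 := by
    calc _ ≤ ‖T n - S‖ * (‖g‖ * ‖f - f'‖) := norm_inner_op _ _ _
      _ ≤ (M + 1) * ((‖g‖ + 1) * (ε / (4 * (M + 1) * (‖g‖ + 1)))) := by
        gcongr <;> linarith
      _ = ε / 4 := by field_simp
  have a2 : ‖⟪g - g', (T n - S) f'⟫‖ ≤ ε / 4 := by
    calc _ ≤ ‖T n - S‖ * (‖g - g'‖ * ‖f'‖) := norm_inner_op _ _ _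
      _ ≤ (M + 1) * ((ε / (4 * (M + 1) * (‖f'‖ + 1))) * (‖f'‖ + 1)) := by
        gcongr <;> linarith
      _ = ε / 4 := by field_simp
  rw [e]
  calc _ ≤ _ := norm_add₃_le
    _ < ε := by linarith

lemma toNat {ι : Type} [Countable ι] {ξ : ι → H} {η : ι → K} (h : SqS ξ) (h' : SqS η) :
    ∃ (ξ' : ℕ → H) (η' : ℕ → K) (e : ι → ℕ), SqS ξ' ∧ SqS η' ∧ Function.Injective e ∧
      (∀ i, ξ' (e i) = ξ i) ∧ (∀ i, η' (e i) = η i) ∧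
      (∀ n, n ∉ range e → ξ' n = 0) ∧ (∀ n, n ∉ range e → η' n = 0) := by
  obtain ⟨e, he⟩ := exists_injective_nat ι
  have aux : ∀ {E : Type} [NormedAddCommGroup E] (ζ : ι → E), SqS ζ → SqS (Function.extend e ζ 0) := by
    intro E _ ζ hζ
    have : (fun n => ‖Function.extend e ζ 0 n‖ ^ 2) = Function.extend e (fun i => ‖ζ i‖ ^ 2) 0 := by
      funext n
      by_cases hn : ∃ i, e i = n
      · obtain ⟨i, rfl⟩ := hn
        simp [he.extend_apply]
      · simp [Function.extend_apply' _ _ _ hn]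
    unfold SqS
    rw [this]
    exact (summable_extend_zero he).2 hζ
  refine ⟨Function.extend e ξ 0, Function.extend e η 0, e, aux ξ h, aux η h', he,
    fun i => he.extend_apply _ _ _, fun i => he.extend_apply _ _ _, fun n hn => ?_, fun n hn => ?_⟩
  · exact Function.extend_apply' _ _ _ hn
  · exact Function.extend_apply' _ _ _ hn

lemma tsum_toNat {ι : Type} {f : ℕ → ℂ} {g : ι → ℂ} {e : ι → ℕ} (he : Function.Injective e)
    (h1 : ∀ i, f (e i) = g i) (h2 : ∀ n, n ∉ range e → f n = 0) : ∑' n, f n = ∑' i, g i := by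
  rw [← he.tsum_eq (f := f)]
  · simp [h1]
  · intro n hn
    by_contra hc
    exact hn (h2 n hc)

lemma wk_closed_zero (P : (ℕ → H) → (ℕ → K) → Prop) :
    WkClosed {T : H →L[ℂ] K | ∀ ξ η, SqS ξ → SqS η → P ξ η → ∑' n, ⟪η n, T (ξ n)⟫ = 0} := by
  unfold WkClosed
  let _ := sigmaWeak H K
  have : {T : H →L[ℂ] K | ∀ ξ η, SqS ξ → SqS η → P ξ η → ∑' n, ⟪η n, T (ξ n)⟫ = 0} =
      ⋂ (ξ) (η) (_ : SqS ξ) (_ : SqS η) (_ : P ξ η), {T | ∑' n, ⟪η n, T (ξ n)⟫ = 0} := by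
    ext T; simp
  rw [this]
  refine isClosed_iInter fun ξ => isClosed_iInter fun η => isClosed_iInter fun h1 =>
    isClosed_iInter fun h2 => isClosed_iInter fun _ => ?_
  have hc : Continuous fun T : H →L[ℂ] K => ∑' n, ⟪η n, T (ξ n)⟫ := by
    rw [continuous_iff_le_induced]
    exact iInf_le_of_le ξ (iInf_le_of_le η (iInf_le_of_le h1 (iInf_le_of_le h2 le_rfl)))
  exact isClosed_singleton.preimage hc

lemma sep {U : Set (H →L[ℂ] K)} (hU : IsWkClosedSubspace U) {T : H →L[ℂ] K} (hT : T ∉ U) :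
    ∃ (ξ : ℕ → H) (η : ℕ → K), SqS ξ ∧ SqS η ∧ (∀ X ∈ U, ∑' n, ⟪η n, X (ξ n)⟫ = 0) ∧
      ∑' n, ⟪η n, T (ξ n)⟫ ≠ 0 := by
  classical
  obtain ⟨⟨M, rfl⟩, hc⟩ := hU
  let I := {p : (ℕ → H) × (ℕ → K) // SqS p.1 ∧ SqS p.2}
  let Φ : (H →L[ℂ] K) →ₗ[ℂ] (I → ℂ) :=
    { toFun := fun T p => ∑' n, ⟪p.1.2 n, T (p.1.1 n)⟫
      map_add' := fun S T => by
        funext p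
        simp only [ContinuousLinearMap.add_apply, inner_add_right, Pi.add_apply]
        exact (p.2.1.summable_inner p.2.2 S).tsum_add (p.2.1.summable_inner p.2.2 T)
      map_smul' := fun c T => by
        funext p
        simp only [ContinuousLinearMap.smul_apply, inner_smul_right, Pi.smul_apply, RingHom.id_apply,
          smul_eq_mul]
        exact tsum_mul_left }
  have h1 : IsClosed[TopologicalSpace.induced Φ inferInstance] (M : Set (H →L[ℂ] K)) := by
    refine IsClosed.mono hc ?_
    refine le_iInf fun ξ => le_iInf fun η => le_iInf fun h1 => le_iInf fun h2 => ?_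
    have h3 := (continuous_apply (A := fun _ : I => ℂ) (⟨(ξ, η), h1, h2⟩ : I))
    rw [continuous_iff_le_induced] at h3
    have h4 := induced_mono (g := Φ) h3
    rw [induced_compose] at h4
    exact h4
  obtain ⟨C, hC, hCM⟩ := isClosed_induced_iff.1 h1
  have hTC : Φ T ∈ Cᶜ := fun h => hT (by rw [← hCM]; exact h)
  obtain ⟨J, u, hu, huC⟩ := isOpen_pi_iff.1 hC.isOpen_compl _ hTC
  let Ψ : (H →L[ℂ] K) →ₗ[ℂ] (J → ℂ) := LinearMap.pi fun j => LinearMap.proj j.1 ∘ₗ Φ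
  have hΨ : Ψ T ∉ M.map Ψ := by
    rintro ⟨X, hX, hXT⟩
    have : Φ X ∈ Cᶜ := huC (by
      intro j hj
      have := congrFun hXT ⟨j, hj⟩
      simp only [Ψ, LinearMap.pi_apply, LinearMap.comp_apply, LinearMap.proj_apply] at this
      rw [this]
      exact (hu j hj).2)
    exact this (by change X ∈ Φ ⁻¹' C; rw [hCM]; exact hX)
  obtain ⟨f, hf1, hf2⟩ := Submodule.exists_le_ker_of_notMem hΨ
  have hf : ∀ X : H →L[ℂ] K, f (Ψ X) = ∑ j : J, Φ X j.1 * f (Pi.single j 1) := fun X => by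
    conv_lhs => rw [← Finset.univ_sum_single (Ψ X)]
    rw [map_sum]
    refine Finset.sum_congr rfl fun j _ => ?_
    have : (Pi.single j (Ψ X j) : J → ℂ) = (Ψ X j) • Pi.single j 1 := by
      rw [← Pi.single_smul]; simp
    rw [this, map_smul, smul_eq_mul]
    rfl
  -- merged family
  let ξ : J × ℕ → H := fun q => (f (Pi.single q.1 1)) • q.1.1.1.1 q.2
  let η : J × ℕ → K := fun q => q.1.1.1.2 q.2
  have hη : SqS η := by
    unfold SqS
    refine (summable_prod_of_nonneg (fun _ => by positivity)).2 ⟨fun j => j.1.2.2, ?_⟩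
    exact Summable.of_finite
  have hξ : SqS ξ := by
    unfold SqS
    refine (summable_prod_of_nonneg (fun _ => by positivity)).2 ⟨fun j => ?_, ?_⟩
    · simp only [ξ, norm_smul, mul_pow]
      exact Summable.mul_left _ j.1.2.1
    · exact Summable.of_finite
  have hω : ∀ X : H →L[ℂ] K, ∑' q, ⟪η q, X (ξ q)⟫ = f (Ψ X) := fun X => by
    rw [(hξ.summable_inner hη X).tsum_prod, tsum_fintype, hf]
    refine Finset.sum_congr rfl fun j _ => ?_
    simp only [ξ, η, map_smul, inner_smul_right]
    rw [tsum_mul_left, mul_comm]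
    rfl
  obtain ⟨ξ', η', e, a1, a2, he, a3, a4, a5, a6⟩ := toNat hξ hη
  have hω' : ∀ X : H →L[ℂ] K, ∑' n, ⟪η' n, X (ξ' n)⟫ = f (Ψ X) := fun X => by
    rw [← hω]
    exact tsum_toNat he (fun i => by simp only [a3, a4]) (fun n hn => by simp [a5 n hn])
  refine ⟨ξ', η', a1, a2, fun X hX => ?_, ?_⟩
  · rw [hω']
    exact hf2 ⟨X, hX, rfl⟩
  · rwa [hω']

end Hilb
end OpSynthAux

namespace OpSynthAux
open Filter Topology ENNReal

section L2
variable {Ω X X₁ X₂ : Type} [MeasurableSpace Ω] [MeasurableSpace X] [MeasurableSpace X₁]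
  [MeasurableSpace X₂]

lemma enorm_sq {μ : Measure X} (f : Lp ℂ 2 μ) : ‖f‖ₑ ^ 2 = ∫⁻ x, ‖f x‖ₑ ^ 2 ∂μ := by
  rw [Lp.enorm_def, eLpNorm_eq_lintegral_rpow_enorm_toReal (by norm_num) (by norm_num)]
  rw [← ENNReal.rpow_natCast, ← ENNReal.rpow_mul]
  simp

lemma memLp_iff {μ : Measure X} {f : X → ℂ} (hf : Measurable f) :
    MemLp f 2 μ ↔ ∫⁻ x, ‖f x‖ₑ ^ 2 ∂μ < ∞ := by
  unfold MemLp
  rw [eLpNorm_lt_top_iff_lintegral_rpow_enorm_lt_top (by norm_num) (by norm_num)]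
  simp [hf.aestronglyMeasurable]

lemma inner_eq {μ : Measure X} (f g : Lp ℂ 2 μ) :
    ⟪f, g⟫ = ∫ x, g x * (starRingEnd ℂ) (f x) ∂μ := by
  rw [L2.inner_def]; rfl

lemma integrable_inner {μ : Measure X} (f g : Lp ℂ 2 μ) :
    Integrable (fun x => g x * (starRingEnd ℂ) (f x)) μ :=
  L2.integrable_inner (𝕜 := ℂ) f g

lemma lp_meas {μ : Measure X} (f : Lp ℂ 2 μ) : Measurable (f : X → ℂ) :=
  (Lp.stronglyMeasurable f).measurable

/-- Domination condition for weighted composition operators. -/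
def Dom (P : Measure Ω) (μ : Measure X) (φ : Ω → X) (w : Ω → ℂ) (C : ℝ) : Prop :=
  Measurable φ ∧ Measurable w ∧ 0 ≤ C ∧ ∀ f : X → ℝ≥0∞, Measurable f →
    ∫⁻ ω, ‖w ω‖ₑ ^ 2 * f (φ ω) ∂P ≤ ENNReal.ofReal (C ^ 2) * ∫⁻ x, f x ∂μ

lemma Dom.ae {P : Measure Ω} {μ : Measure X} {φ : Ω → X} {w : Ω → ℂ} {C : ℝ}
    (h : Dom P μ φ w C) {p : X → Prop} (hp : ∀ᵐ x ∂μ, p x) : ∀ᵐ ω ∂P, w ω = 0 ∨ p (φ ω) := by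
  obtain ⟨N, hN, hNm, hN0⟩ := exists_measurable_superset_of_null (ae_iff.1 hp)
  have h1 := h.2.2.2 (N.indicator 1) (measurable_one.indicator hNm)
  rw [lintegral_indicator_one hNm, hN0, mul_zero, nonpos_iff_eq_zero, lintegral_eq_zero_iff] at h1
  · filter_upwards [h1] with ω hω
    by_contra hc
    push Not at hc
    have : φ ω ∈ N := hN hc.2
    simp [this, hc.1] at hω
  · exact (h.2.1.enorm.pow_const 2).mul ((measurable_one.indicator hNm).comp h.1)

lemma Dom.lint {P : Measure Ω} {μ : Measure X} {φ : Ω → X} {w : Ω → ℂ} {C : ℝ}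
    (h : Dom P μ φ w C) (a : Lp ℂ 2 μ) :
    ∫⁻ ω, ‖w ω * a (φ ω)‖ₑ ^ 2 ∂P ≤ ENNReal.ofReal (C ^ 2) * ‖a‖ₑ ^ 2 := by
  rw [enorm_sq]
  refine le_trans (le_of_eq ?_) (h.2.2.2 (fun x => ‖a x‖ₑ ^ 2) ((lp_meas a).enorm.pow_const 2))
  simp [enorm_mul, mul_pow]

lemma exists_wcomp {P : Measure Ω} {μ : Measure X} {φ : Ω → X} {w : Ω → ℂ} {C : ℝ}
    (h : Dom P μ φ w C) : ∃ T : Lp ℂ 2 μ →L[ℂ] Lp ℂ 2 P, ‖T‖ ≤ C ∧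
      ∀ a, T a =ᵐ[P] fun ω => w ω * a (φ ω) := by
  have hm : ∀ a : Lp ℂ 2 μ, MemLp (fun ω => w ω * a (φ ω)) 2 P := fun a =>
    (memLp_iff (h.2.1.mul ((lp_meas a).comp h.1))).2 ((h.lint a).trans_lt
      (ENNReal.mul_lt_top ENNReal.ofReal_lt_top (by simp [enorm_lt_top])))
  let T : Lp ℂ 2 μ →L[ℂ] Lp ℂ 2 P := LinearMap.mkContinuous
    { toFun := fun a => (hm a).toLp
      map_add' := fun a b => by
        refine Lp.ext ?_
        filter_upwards [(hm (a + b)).coeFn_toLp, Lp.coeFn_add (hm a).toLp (hm b).toLp,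
          (hm a).coeFn_toLp, (hm b).coeFn_toLp, h.ae (Lp.coeFn_add a b)] with ω h1 h2 h3 h4 h5
        rw [h1, h2, Pi.add_apply, h3, h4]
        rcases h5 with h5 | h5
        · simp [h5]
        · rw [h5, Pi.add_apply]; ring
      map_smul' := fun c a => by
        refine Lp.ext ?_
        filter_upwards [(hm (c • a)).coeFn_toLp, Lp.coeFn_smul c (hm a).toLp,
          (hm a).coeFn_toLp, h.ae (Lp.coeFn_smul c a)] with ω h1 h2 h3 h5
        rw [h1, RingHom.id_apply, h2, Pi.smul_apply, h3]
        rcases h5 with h5 | h5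
        · simp [h5]
        · rw [h5, Pi.smul_apply, smul_eq_mul, smul_eq_mul]; ring } C (fun a => by
      have h1 : ‖(hm a).toLp‖ₑ ^ 2 ≤ (ENNReal.ofReal C * ‖a‖ₑ) ^ 2 := by
        rw [enorm_sq, mul_pow, ← ENNReal.ofReal_pow h.2.2.1]
        refine le_trans (le_of_eq (lintegral_congr_ae ?_)) (h.lint a)
        filter_upwards [(hm a).coeFn_toLp] with ω h1
        rw [h1]
      have h2 := (ENNReal.pow_le_pow_left_iff (two_ne_zero)).1 h1
      rw [← ofReal_norm, ← ofReal_norm, ← ENNReal.ofReal_mul h.2.2.1] at h2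
      exact (ENNReal.ofReal_le_ofReal_iff (by have := h.2.2.1; positivity)).1 h2)
  exact ⟨T, LinearMap.mkContinuous_norm_le _ h.2.2.1 _, fun a => (hm a).coeFn_toLp⟩

/-- weighted composition operator -/
def wcomp {P : Measure Ω} {μ : Measure X} {φ : Ω → X} {w : Ω → ℂ} {C : ℝ}
    (h : Dom P μ φ w C) : Lp ℂ 2 μ →L[ℂ] Lp ℂ 2 P := (exists_wcomp h).choose
lemma wcomp_norm {P : Measure Ω} {μ : Measure X} {φ : Ω → X} {w : Ω → ℂ} {C : ℝ}
    (h : Dom P μ φ w C) : ‖wcomp h‖ ≤ C := (exists_wcomp h).choose_spec.1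
lemma wcomp_coe {P : Measure Ω} {μ : Measure X} {φ : Ω → X} {w : Ω → ℂ} {C : ℝ}
    (h : Dom P μ φ w C) (a : Lp ℂ 2 μ) : wcomp h a =ᵐ[P] fun ω => w ω * a (φ ω) :=
  (exists_wcomp h).choose_spec.2 a

/-- bounded measurable functions -/
def BM (u : X → ℂ) : Prop := Measurable u ∧ ∃ C, ∀ x, ‖u x‖ ≤ C

lemma BM.dom {u : X → ℂ} (h : BM u) (μ : Measure X) : ∃ C, Dom μ μ id u C := by
  obtain ⟨hm, C, hC⟩ := h
  refine ⟨|C|, measurable_id, hm, abs_nonneg _, fun f hf => ?_⟩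
  rw [← lintegral_const_mul _ hf]
  refine lintegral_mono fun x => ?_
  have : ‖u x‖ₑ ^ 2 ≤ ENNReal.ofReal (|C| ^ 2) := by
    rw [← ofReal_norm, ← ENNReal.ofReal_pow (norm_nonneg _)]
    exact ENNReal.ofReal_le_ofReal (by gcongr; exact (hC x).trans (le_abs_self C))
  simpa using mul_le_mul_left this (f x)

open Classical in
/-- multiplication operator -/
def mulOp (μ : Measure X) (u : X → ℂ) : Lp ℂ 2 μ →L[ℂ] Lp ℂ 2 μ :=
  if h : BM u then wcomp (h.dom μ).choose_spec else 0

lemma mulOp_coe {μ : Measure X} {u : X → ℂ} (h : BM u) (f : Lp ℂ 2 μ) :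
    mulOp μ u f =ᵐ[μ] fun x => u x * f x := by
  rw [mulOp, dif_pos h]; exact wcomp_coe _ f

lemma mulOp_isMult (μ : Measure X) {u : X → ℂ} (h : BM u) : IsMultOp μ (mulOp μ u) :=
  ⟨u, h.1.aestronglyMeasurable, h.2.imp fun C hC => Eventually.of_forall hC, mulOp_coe h⟩

lemma BM.conj {u : X → ℂ} (h : BM u) : BM fun x => (starRingEnd ℂ) (u x) :=
  ⟨Complex.continuous_conj.measurable.comp h.1, h.2.imp fun C hC x => by simpa using hC x⟩

lemma BM.ind {α : Set X} (h : MeasurableSet α) : BM (α.indicator (1 : X → ℂ)) :=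
  ⟨measurable_one.indicator h, 1, fun x => by
    by_cases hx : x ∈ α <;> simp [hx]⟩

lemma BM.mul {u v : X → ℂ} (h : BM u) (h' : BM v) : BM fun x => u x * v x := by
  obtain ⟨h1, C, hC⟩ := h
  obtain ⟨h2, D, hD⟩ := h'
  refine ⟨h1.mul h2, C * D, fun x => ?_⟩
  rw [norm_mul]
  exact mul_le_mul (hC x) (hD x) (norm_nonneg _) ((norm_nonneg _).trans (hC x))

lemma inner_mulOp {μ : Measure X} {u : X → ℂ} (h : BM u) (g f : Lp ℂ 2 μ) :
    ⟪g, mulOp μ u f⟫ = ⟪mulOp μ (fun x => (starRingEnd ℂ) (u x)) g, f⟫ := by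
  rw [inner_eq, inner_eq]
  refine integral_congr_ae ?_
  filter_upwards [mulOp_coe h f, mulOp_coe h.conj g] with x h1 h2
  rw [h1, h2]; simp; ring

/-- indicator multiplication -/
def chi (μ : Measure X) (α : Set X) : Lp ℂ 2 μ →L[ℂ] Lp ℂ 2 μ := mulOp μ (α.indicator 1)

lemma chi_coe {μ : Measure X} {α : Set X} (h : MeasurableSet α) (f : Lp ℂ 2 μ) :
    chi μ α f =ᵐ[μ] α.indicator f := by
  filter_upwards [mulOp_coe (BM.ind h) f] with x hx
  rw [chi, hx]
  by_cases hx : x ∈ α <;> simp [hx]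

lemma chi_inner {μ : Measure X} {α : Set X} (h : MeasurableSet α) (g f : Lp ℂ 2 μ) :
    ⟪g, chi μ α f⟫ = ⟪chi μ α g, f⟫ := by
  rw [chi, inner_mulOp (BM.ind h)]
  congr 3
  funext x
  by_cases hx : x ∈ α <;> simp [hx]

lemma chi_idem {μ : Measure X} {α : Set X} (h : MeasurableSet α) (f : Lp ℂ 2 μ) :
    chi μ α (chi μ α f) = chi μ α f := by
  refine Lp.ext ?_
  filter_upwards [chi_coe h f, chi_coe h (chi μ α f)] with x h1 h2
  rw [h2]
  by_cases hx : x ∈ α <;> simp [hx, h1]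

def Off (μ : Measure X) (α : Set X) (f : Lp ℂ 2 μ) : Prop := ∀ᵐ x ∂μ, x ∉ α → f x = 0

lemma off_chi {μ : Measure X} {α : Set X} (h : MeasurableSet α) (f : Lp ℂ 2 μ) :
    Off μ α (chi μ α f) := by
  filter_upwards [chi_coe h f] with x hx hxa
  rw [hx]; simp [hxa]

lemma Off.chi {μ : Measure X} {α : Set X} (h : MeasurableSet α) {f : Lp ℂ 2 μ}
    (hf : Off μ α f) : chi μ α f = f := by
  refine Lp.ext ?_
  filter_upwards [chi_coe h f, hf] with x hx hxa
  rw [hx]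
  by_cases hx : x ∈ α
  · simp [hx]
  · simp [hx, hxa hx]

lemma Off.mono {μ : Measure X} {α β : Set X} {f : Lp ℂ 2 μ} (h : Off μ α f) (hs : α ⊆ β) :
    Off μ β f := by
  filter_upwards [h] with x hx hxb using hx fun h => hxb (hs h)

lemma Off.mul {μ : Measure X} {α : Set X} {f : Lp ℂ 2 μ} (h : Off μ α f) {u : X → ℂ} (hu : BM u) :
    Off μ α (mulOp μ u f) := by
  filter_upwards [h, mulOp_coe hu f] with x hx h2 hxb
  rw [h2, hx hxb, mul_zero]

lemma Off.mul_of {μ : Measure X} {α : Set X} (f : Lp ℂ 2 μ) {u : X → ℂ} (hu : BM u)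
    (h : ∀ x, x ∉ α → u x = 0) : Off μ α (mulOp μ u f) := by
  filter_upwards [mulOp_coe hu f] with x h2 hxb
  rw [h2, h x hxb, zero_mul]

lemma sqs_pt {ι : Type} [Countable ι] {μ : Measure X} {a : ι → Lp ℂ 2 μ} (h : SqS a) :
    ∀ᵐ x ∂μ, SqS fun i => a i x := by
  have h1 : ∫⁻ x, ∑' i, ‖a i x‖ₑ ^ 2 ∂μ < ∞ := by
    rw [lintegral_tsum fun i => ((lp_meas (a i)).enorm.pow_const 2).aemeasurable]
    simp_rw [← enorm_sq]
    have := h.tsum_ofReal_lt_top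
    simpa [ENNReal.ofReal_pow, ofReal_norm] using this
  filter_upwards [ae_lt_top (Measurable.tsum fun i => (lp_meas (a i)).enorm.pow_const 2) h1.ne] with x hx
  have h2 := ENNReal.summable_toReal hx.ne
  simpa [SqS] using h2

lemma tsum_inner_eq {ι : Type} [Countable ι] {μ : Measure X} {a b : ι → Lp ℂ 2 μ} (h : SqS a)
    (h' : SqS b) : ∑' i, ⟪b i, a i⟫ = ∫ x, ∑' i, a i x * (starRingEnd ℂ) (b i x) ∂μ := by
  simp_rw [inner_eq]
  refine (hasSum_integral_of_summable_integral_norm (fun i => integrable_inner _ _) ?_).tsum_eq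
  have hh := (h.add h').div_const 2
  have hn : ∀ f : Lp ℂ 2 μ, ‖f‖ ^ 2 = ∫ x, ‖f x‖ ^ 2 ∂μ := fun f => by
    rw [← inner_self_eq_norm_sq (𝕜 := ℂ), inner_eq, ← integral_re (integrable_inner _ _)]
    congr 1; funext x; simp [Complex.mul_conj, Complex.normSq_eq_norm_sq, ← Complex.ofReal_pow]
  have hi : ∀ f : Lp ℂ 2 μ, Integrable (fun x => ‖f x‖ ^ 2) μ := fun f =>
    (Lp.memLp f).integrable_norm_pow (p := 2) (by norm_num)
  refine Summable.of_nonneg_of_le (fun i => integral_nonneg fun x => norm_nonneg _) (fun i => ?_) hh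
  rw [hn, hn, ← integral_add (hi _) (hi _), ← integral_div]
  refine integral_mono (integrable_inner _ _).norm (((hi _).add (hi _)).div_const 2) fun x => ?_
  simp only [norm_mul, RCLike.norm_conj]
  nlinarith [sq_nonneg (‖a i x‖ - ‖b i x‖)]

end L2
end OpSynthAux

namespace OpSynthAux
open Filter Topology ENNReal

section NNsec
variable {Ω X X₁ X₂ : Type} [MeasurableSpace Ω] [MeasurableSpace X] [MeasurableSpace X₁]
  [MeasurableSpace X₂] {μ₁ : Measure X₁} {μ₂ : Measure X₂}

lemma margNull_iff {E : Set (X₁ × X₂)} : MargNull μ₁ μ₂ E ↔ ∃ (p : X₁ → Prop) (q : X₂ → Prop),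
    (∀ᵐ x ∂μ₁, p x) ∧ (∀ᵐ y ∂μ₂, q y) ∧ ∀ x y, p x → q y → (x, y) ∉ E := by
  constructor
  · rintro ⟨M₁, M₂, h1, h2, h3, h4, h5⟩
    refine ⟨fun x => x ∉ M₁, fun y => y ∉ M₂, measure_eq_zero_iff_ae_notMem.1 h3,
      measure_eq_zero_iff_ae_notMem.1 h4, fun x y hx hy hE => ?_⟩
    rcases h5 hE with h | h
    · exact hx h.1
    · exact hy h.2
  · rintro ⟨p, q, hp, hq, h⟩
    obtain ⟨M₁, a1, a2, a3⟩ := exists_measurable_superset_of_null (ae_iff.1 hp)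
    obtain ⟨M₂, b1, b2, b3⟩ := exists_measurable_superset_of_null (ae_iff.1 hq)
    refine ⟨M₁, M₂, a2, b2, a3, b3, ?_⟩
    rintro ⟨x, y⟩ hE
    by_cases hx : p x
    · by_cases hy : q y
      · exact absurd hE (h x y hx hy)
      · exact Or.inr ⟨trivial, b1 hy⟩
    · exact Or.inl ⟨a1 hx, trivial⟩

lemma _root_.OpSynth.MargNull.mono {E F : Set (X₁ × X₂)} (h : MargNull μ₁ μ₂ F) (hs : E ⊆ F) : MargNull μ₁ μ₂ E := by
  obtain ⟨M₁, M₂, h1, h2, h3, h4, h5⟩ := h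
  exact ⟨M₁, M₂, h1, h2, h3, h4, hs.trans h5⟩

lemma _root_.OpSynth.MargNull.iUnion {ι : Type} [Countable ι] {E : ι → Set (X₁ × X₂)}
    (h : ∀ i, MargNull μ₁ μ₂ (E i)) : MargNull μ₁ μ₂ (⋃ i, E i) := by
  simp_rw [margNull_iff] at h ⊢
  choose p q hp hq hpq using h
  refine ⟨fun x => ∀ i, p i x, fun y => ∀ i, q i y, ae_all_iff.2 hp, ae_all_iff.2 hq,
    fun x y hx hy hE => ?_⟩
  obtain ⟨i, hi⟩ := mem_iUnion.1 hE
  exact hpq i x y (hx i) (hy i) hi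

lemma _root_.OpSynth.MargNull.union {E F : Set (X₁ × X₂)} (h : MargNull μ₁ μ₂ E) (h' : MargNull μ₁ μ₂ F) :
    MargNull μ₁ μ₂ (E ∪ F) := by
  rw [union_eq_iUnion]
  exact MargNull.iUnion fun b => by cases b <;> assumption

def ker {ι : Type} (ξ : ι → Lp ℂ 2 μ₁) (η : ι → Lp ℂ 2 μ₂) (p : X₁ × X₂) : ℂ :=
  ∑' i, ξ i p.1 * (starRingEnd ℂ) (η i p.2)

def Van {ι : Type} (κ : Set (X₁ × X₂)) (ξ : ι → Lp ℂ 2 μ₁) (η : ι → Lp ℂ 2 μ₂) : Prop :=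
  MargNull μ₁ μ₂ {p | p ∈ κ ∧ ker ξ η p ≠ 0}

lemma van_iff {ι : Type} {κ : Set (X₁ × X₂)} {ξ : ι → Lp ℂ 2 μ₁} {η : ι → Lp ℂ 2 μ₂} :
    Van κ ξ η ↔ ∃ (p : X₁ → Prop) (q : X₂ → Prop),
    (∀ᵐ x ∂μ₁, p x) ∧ (∀ᵐ y ∂μ₂, q y) ∧ ∀ x y, p x → q y → (x, y) ∈ κ → ker ξ η (x, y) = 0 := by
  rw [Van, margNull_iff]
  simp only [mem_setOf_eq, not_and, not_not]

def NN (μ₁ : Measure X₁) (μ₂ : Measure X₂) (κ : Set (X₁ × X₂)) :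
    Set (Lp ℂ 2 μ₁ →L[ℂ] Lp ℂ 2 μ₂) :=
  {T | ∀ ξ η, SqS ξ → SqS η → Van κ ξ η → ∑' n : ℕ, ⟪η n, T (ξ n)⟫ = 0}

lemma NN_gen {ι : Type} [Countable ι] {κ : Set (X₁ × X₂)} {ξ : ι → Lp ℂ 2 μ₁} {η : ι → Lp ℂ 2 μ₂}
    (h : SqS ξ) (h' : SqS η) (hv : Van κ ξ η) {T : Lp ℂ 2 μ₁ →L[ℂ] Lp ℂ 2 μ₂}
    (hT : T ∈ NN μ₁ μ₂ κ) : ∑' i, ⟪η i, T (ξ i)⟫ = 0 := by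
  obtain ⟨ξ', η', e, a1, a2, he, a3, a4, a5, a6⟩ := toNat h h'
  rw [← hT ξ' η' a1 a2 ?_]
  · exact (tsum_toNat he (fun i => by simp only [a3, a4]) (fun n hn => by simp [a5 n hn])).symm
  obtain ⟨p, q, hp, hq, hpq⟩ := van_iff.1 hv
  refine van_iff.2 ⟨fun x => p x ∧ ∀ n, n ∉ range e → ξ' n x = 0, q, ?_, hq,
    fun x y hx hy hk => ?_⟩
  · refine hp.and (ae_all_iff.2 fun n => ?_)
    by_cases hn : n ∈ range e
    · exact Eventually.of_forall fun _ h => absurd hn h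
    · rw [a5 n hn]
      filter_upwards [Lp.coeFn_zero ℂ 2 μ₁] with x hx _ using hx
  · rw [← hpq x y hx.1 hy hk]
    exact tsum_toNat he (fun i => by simp only [a3, a4]) (fun n hn => by simp [hx.2 n hn])

lemma Van.mono {ι : Type} {κ κ' : Set (X₁ × X₂)} {ξ : ι → Lp ℂ 2 μ₁} {η : ι → Lp ℂ 2 μ₂}
    (h : Van κ' ξ η) (hs : MargNull μ₁ μ₂ (κ \ κ')) : Van κ ξ η := by
  refine (MargNull.union h hs).mono ?_
  rintro p ⟨h1, h2⟩
  by_cases hp : p ∈ κ'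
  · exact Or.inl ⟨hp, h2⟩
  · exact Or.inr ⟨h1, hp⟩

lemma Van.subset {ι : Type} {κ κ' : Set (X₁ × X₂)} {ξ : ι → Lp ℂ 2 μ₁} {η : ι → Lp ℂ 2 μ₂}
    (h : Van κ' ξ η) (hs : κ ⊆ κ') : Van κ ξ η :=
  MargNull.mono h fun _ hp => ⟨hs hp.1, hp.2⟩

lemma NN_mono {κ κ' : Set (X₁ × X₂)} (hs : MargNull μ₁ μ₂ (κ \ κ')) : NN μ₁ μ₂ κ ⊆ NN μ₁ μ₂ κ' :=
  fun T hT ξ η h1 h2 h3 => hT ξ η h1 h2 (h3.mono hs)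

lemma Mmax_mono {κ κ' : Set (X₁ × X₂)} (hs : MargNull μ₁ μ₂ (κ \ κ')) :
    Mmax μ₁ μ₂ κ ⊆ Mmax μ₁ μ₂ κ' := by
  intro T hT α β hα hβ hm
  refine hT α β hα hβ ((hm.union hs).mono ?_)
  rintro p ⟨h1, h2⟩
  by_cases hp : p ∈ κ'
  · exact Or.inl ⟨h1, hp⟩
  · exact Or.inr ⟨h2, hp⟩

lemma van_mulOp {ι : Type} {κ : Set (X₁ × X₂)} [Countable ι] {ξ : ι → Lp ℂ 2 μ₁} {η : ι → Lp ℂ 2 μ₂}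
    {u : X₁ → ℂ} {v : X₂ → ℂ} (hu : BM u) (hv : BM v)
    (h : Van {p | p ∈ κ ∧ u p.1 ≠ 0 ∧ v p.2 ≠ 0} ξ η) :
    Van κ (fun i => mulOp μ₁ u (ξ i)) (fun i => mulOp μ₂ v (η i)) := by
  obtain ⟨p, q, hp, hq, hpq⟩ := van_iff.1 h
  refine van_iff.2 ⟨_, _, hp.and (ae_all_iff.2 fun i => mulOp_coe hu (ξ i)),
    hq.and (ae_all_iff.2 fun i => mulOp_coe hv (η i)), fun x y hx hy hk => ?_⟩
  have e : ker (fun i => mulOp μ₁ u (ξ i)) (fun i => mulOp μ₂ v (η i)) (x, y) =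
      (u x * (starRingEnd ℂ) (v y)) * ker ξ η (x, y) := by
    simp only [ker, ← tsum_mul_left]
    refine tsum_congr fun i => ?_
    rw [hx.2 i, hy.2 i, map_mul]; ring
  rw [e]
  by_cases h1 : u x = 0
  · simp [h1]
  by_cases h2 : v y = 0
  · simp [h2]
  rw [hpq x y hx.1 hy.1 ⟨hk, h1, h2⟩, mul_zero]

lemma isMult_eq {μ : Measure X} {A : Lp ℂ 2 μ →L[ℂ] Lp ℂ 2 μ} (h : IsMultOp μ A) :
    ∃ u, BM u ∧ A = mulOp μ u := by
  obtain ⟨φ, hφ, ⟨C, hC⟩, hA⟩ := h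
  let ψ := hφ.mk φ
  have hψ : Measurable ψ := hφ.stronglyMeasurable_mk.measurable
  have hs : MeasurableSet {x | ‖ψ x‖ ≤ C} := measurableSet_le hψ.norm measurable_const
  have hb : BM ({x | ‖ψ x‖ ≤ C}.indicator ψ) := by
    refine ⟨hψ.indicator hs, |C|, fun x => ?_⟩
    by_cases hx : ‖ψ x‖ ≤ C
    · rw [indicator_of_mem (by exact hx)]; exact hx.trans (le_abs_self C)
    · rw [indicator_of_notMem (by exact hx)]; simp
  refine ⟨_, hb, ContinuousLinearMap.ext fun f => Lp.ext ?_⟩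
  filter_upwards [hA f, mulOp_coe hb f, hC, hφ.ae_eq_mk] with x h1 h2 h3 h4
  rw [h1, h2, indicator_of_mem]
  · rw [h4]
  · change ‖ψ x‖ ≤ C
    rw [show ψ x = φ x from h4.symm]; exact h3

def Kills (T : Lp ℂ 2 μ₁ →L[ℂ] Lp ℂ 2 μ₂) (α : Set X₁) (β : Set X₂) : Prop :=
  ∀ f g, Off μ₁ α f → Off μ₂ β g → ⟪T f, g⟫ = 0

lemma kills_inner {T : Lp ℂ 2 μ₁ →L[ℂ] Lp ℂ 2 μ₂} {α : Set X₁} {β : Set X₂} (h : Kills T α β)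
    {f : Lp ℂ 2 μ₁} {g : Lp ℂ 2 μ₂} (hf : Off μ₁ α f) (hg : Off μ₂ β g) : ⟪g, T f⟫ = 0 := by
  rw [← inner_conj_symm, h f g hf hg, map_zero]

lemma kills_of_inner {T : Lp ℂ 2 μ₁ →L[ℂ] Lp ℂ 2 μ₂} {α : Set X₁} {β : Set X₂}
    (h : ∀ f g, Off μ₁ α f → Off μ₂ β g → ⟪g, T f⟫ = 0) : Kills T α β := fun f g hf hg => by
  rw [← inner_conj_symm, h f g hf hg, map_zero]

lemma Kills.mulOp {T : Lp ℂ 2 μ₁ →L[ℂ] Lp ℂ 2 μ₂} {α : Set X₁} {β : Set X₂} (h : Kills T α β)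
    {u : X₁ → ℂ} {v : X₂ → ℂ} (hu : BM u) (hv : BM v) :
    Kills (mulOp μ₂ v ∘L T ∘L mulOp μ₁ u) α β := kills_of_inner fun f g hf hg => by
  simp only [ContinuousLinearMap.comp_apply]
  rw [inner_mulOp hv]
  exact kills_inner h (hf.mul hu) (hg.mul hv.conj)

lemma Mmax_mulOp {κ : Set (X₁ × X₂)} {T : Lp ℂ 2 μ₁ →L[ℂ] Lp ℂ 2 μ₂} (h : T ∈ Mmax μ₁ μ₂ κ)
    {u : X₁ → ℂ} {v : X₂ → ℂ} (hu : BM u) (hv : BM v) :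
    mulOp μ₂ v ∘L T ∘L mulOp μ₁ u ∈ Mmax μ₁ μ₂ κ :=
  fun α β hα hβ hm => Kills.mulOp (h α β hα hβ hm) hu hv

/-- restriction of an operator in `Mmax` to a rectangle -/
lemma Mmax_rect {κ κ' : Set (X₁ × X₂)} {T : Lp ℂ 2 μ₁ →L[ℂ] Lp ℂ 2 μ₂} (h : T ∈ Mmax μ₁ μ₂ κ)
    {α : Set X₁} {β : Set X₂} (hα : MeasurableSet α) (hβ : MeasurableSet β)
    (hs : κ ∩ α ×ˢ β ⊆ κ') : chi μ₂ β ∘L T ∘L chi μ₁ α ∈ Mmax μ₁ μ₂ κ' := by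
  intro α' β' hα' hβ' hm
  refine kills_of_inner fun f g hf hg => ?_
  simp only [ContinuousLinearMap.comp_apply]
  rw [chi_inner hβ]
  refine kills_inner (h (α ∩ α') (β ∩ β') (hα.inter hα') (hβ.inter hβ') (hm.mono ?_)) ?_ ?_
  · rintro p ⟨⟨⟨h1, h2⟩, h3, h4⟩, h5⟩
    exact ⟨⟨h2, h4⟩, hs ⟨h5, h1, h3⟩⟩
  · filter_upwards [hf.mul (BM.ind hα), off_chi hα f] with x h1 h2 h3
    by_cases hx : x ∈ α
    · exact h1 fun hx' => h3 ⟨hx, hx'⟩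
    · exact h2 hx
  · filter_upwards [hg.mul (BM.ind hβ), off_chi hβ g] with x h1 h2 h3
    by_cases hx : x ∈ β
    · exact h1 fun hx' => h3 ⟨hx, hx'⟩
    · exact h2 hx

lemma NN_bimod (κ : Set (X₁ × X₂)) : IsMultBimodule μ₁ μ₂ (NN μ₁ μ₂ κ) := by
  refine ⟨⟨⟨{ carrier := NN μ₁ μ₂ κ, add_mem' := ?_, zero_mem' := ?_, smul_mem' := ?_ }, rfl⟩,
    wk_closed_zero _⟩, ?_⟩
  · intro S T hS hT ξ η h1 h2 h3
    simp only [ContinuousLinearMap.add_apply, inner_add_right]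
    rw [(h1.summable_inner h2 S).tsum_add (h1.summable_inner h2 T), hS _ _ h1 h2 h3,
      hT _ _ h1 h2 h3, add_zero]
  · intro ξ η _ _ _; simp
  · intro c T hT ξ η h1 h2 h3
    simp only [ContinuousLinearMap.smul_apply, inner_smul_right]
    rw [tsum_mul_left, hT _ _ h1 h2 h3, mul_zero]
  · intro T hT A B hA hB ξ η h1 h2 h3
    obtain ⟨u, hu, rfl⟩ := isMult_eq hA
    obtain ⟨v, hv, rfl⟩ := isMult_eq hB
    simp only [ContinuousLinearMap.comp_apply, inner_mulOp hv]
    exact hT _ _ (h1.map _) (h2.map _) (van_mulOp hu hv.conj (h3.subset fun p hp => hp.1))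

lemma NN_sub_Mmax (κ : Set (X₁ × X₂)) : NN μ₁ μ₂ κ ⊆ Mmax μ₁ μ₂ κ := by
  intro T hT α β hα hβ hm
  refine kills_of_inner fun f g hf hg => ?_
  have := NN_gen (ι := Unit) (ξ := fun _ => f) (η := fun _ => g) (κ := κ) Summable.of_finite
    Summable.of_finite ?_ hT
  · simpa using this
  obtain ⟨p, q, hp, hq, hpq⟩ := margNull_iff.1 hm
  refine van_iff.2 ⟨_, _, hp.and hf, hq.and hg, fun x y hx hy hk => ?_⟩
  simp only [ker, tsum_fintype, Finset.univ_unique, Finset.sum_singleton]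
  by_cases h1 : x ∈ α
  · by_cases h2 : y ∈ β
    · exact absurd ⟨⟨h1, h2⟩, hk⟩ (hpq x y hx.1 hy.1)
    · simp [hy.2 h2]
  · simp [hx.2 h1]

lemma tpi_mem {P : Measure Ω} {φ₁ : Ω → X₁} {φ₂ : Ω → X₂} {w₁ w₂ : Ω → ℂ} {C₁ C₂ : ℝ}
    (h1 : Dom P μ₁ φ₁ w₁ C₁) (h2 : Dom P μ₂ φ₂ w₂ C₂) {κ : Set (X₁ × X₂)}
    (hae : ∀ᵐ ω ∂P, w₁ ω = 0 ∨ w₂ ω = 0 ∨ (φ₁ ω, φ₂ ω) ∈ κ) :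
    ContinuousLinearMap.adjoint (wcomp h2) ∘L wcomp h1 ∈ NN μ₁ μ₂ κ := by
  intro ξ η hξ hη hv
  simp only [ContinuousLinearMap.comp_apply, ContinuousLinearMap.adjoint_inner_right]
  rw [tsum_inner_eq (hξ.map _) (hη.map _)]
  obtain ⟨p, q, hp, hq, hpq⟩ := van_iff.1 hv
  refine integral_eq_zero_of_ae ?_
  filter_upwards [hae, h1.ae hp, h2.ae hq, ae_all_iff.2 fun n => wcomp_coe h1 (ξ n),
    ae_all_iff.2 fun n => wcomp_coe h2 (η n)] with ω a1 a2 a3 a4 a5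
  have e : ∑' n, wcomp h1 (ξ n) ω * (starRingEnd ℂ) (wcomp h2 (η n) ω) =
      (w₁ ω * (starRingEnd ℂ) (w₂ ω)) * ker ξ η (φ₁ ω, φ₂ ω) := by
    simp only [ker, ← tsum_mul_left]
    refine tsum_congr fun i => ?_
    rw [a4 i, a5 i, map_mul]; ring
  rw [e, Pi.zero_apply]
  by_cases z1 : w₁ ω = 0
  · simp [z1]
  by_cases z2 : w₂ ω = 0
  · simp [z2]
  rw [hpq _ _ (a2.resolve_left z1) (a3.resolve_left z2) ((a1.resolve_left z1).resolve_left z2), mul_zero]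

lemma supp_of_mulOp {μ : Measure X} {f h : Lp ℂ 2 μ} (hh : ∀ u, BM u → ⟪h, mulOp μ u f⟫ = 0) :
    ∀ᵐ x ∂μ, f x = 0 ∨ h x = 0 := by
  let k : X → ℂ := fun x => f x * (starRingEnd ℂ) (h x)
  have hk : Measurable k := (lp_meas f).mul (Complex.continuous_conj.measurable.comp (lp_meas h))
  let u : X → ℂ := fun x => (starRingEnd ℂ) (k x) / ((1 + ‖k x‖ : ℝ) : ℂ)
  have hu : BM u := by
    refine ⟨(Complex.continuous_conj.measurable.comp hk).div
      (Complex.measurable_ofReal.comp (measurable_const.add hk.norm)), 1, fun x => ?_⟩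
    simp only [u, norm_div, RCLike.norm_conj, Complex.norm_real, Real.norm_eq_abs]
    rw [abs_of_pos (by positivity), div_le_one (by positivity)]
    linarith
  have h1 := hh u hu
  rw [inner_eq] at h1
  have h2 : ∀ᵐ x ∂μ, mulOp μ u f x * (starRingEnd ℂ) (h x) = ((‖k x‖ ^ 2 / (1 + ‖k x‖) : ℝ) : ℂ) := by
    filter_upwards [mulOp_coe hu f] with x hx
    rw [hx]
    have : u x * f x * (starRingEnd ℂ) (h x) = (starRingEnd ℂ) (k x) * k x / ((1 + ‖k x‖ : ℝ) : ℂ) := by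
      simp only [u, k]; ring
    rw [this, Complex.conj_mul']; push_cast; rfl
  have h3 := (integrable_inner h (mulOp μ u f)).congr h2
  have h3' : Integrable (fun x => ‖k x‖ ^ 2 / (1 + ‖k x‖)) μ := h3.re
  rw [integral_congr_ae h2, integral_complex_ofReal, Complex.ofReal_eq_zero,
    integral_eq_zero_iff_of_nonneg (fun x => by positivity) h3'] at h1
  filter_upwards [h1] with x hx
  have : (1 + ‖k x‖) ≠ 0 := by positivity
  simp only [Pi.zero_apply, _root_.div_eq_zero_iff, this, or_false] at hx
  simpa [k] using hx

lemma kills_supp {V : Set (Lp ℂ 2 μ₁ →L[ℂ] Lp ℂ 2 μ₂)} {f : Lp ℂ 2 μ₁} {g : Lp ℂ 2 μ₂}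
    (hV : ∀ X ∈ V, ∀ u v, BM u → BM v → mulOp μ₂ v ∘L X ∘L mulOp μ₁ u ∈ V)
    (h : ∀ X ∈ V, ⟪g, X f⟫ = 0) {T : Lp ℂ 2 μ₁ →L[ℂ] Lp ℂ 2 μ₂} (hT : T ∈ V) :
    Kills T {x | f x ≠ 0} {y | g y ≠ 0} := by
  have orth : ∀ {Y : Type} [MeasurableSpace Y] {μ : Measure Y} (a b c : Lp ℂ 2 μ),
      (∀ᵐ x ∂μ, a x = 0 ∨ b x = 0) → Off μ {x | a x ≠ 0} c → ⟪b, c⟫ = 0 := by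
    intro Y _ μ a b c h1 h2
    rw [inner_eq]
    refine integral_eq_zero_of_ae ?_
    filter_upwards [h1, h2] with x h1 h2
    rcases h1 with h1 | h1
    · simp [h2 (by simp [h1])]
    · simp [h1]
  refine kills_of_inner fun f' g' hf hg => ?_
  have h1 : ∀ v, BM v → ⟪T f', mulOp μ₂ v g⟫ = 0 := fun v hv => by
    have e : ∀ a : Lp ℂ 2 μ₁, ⟪ContinuousLinearMap.adjoint T (mulOp μ₂ v g), a⟫ =
        ⟪mulOp μ₂ v g, T a⟫ := fun a => ContinuousLinearMap.adjoint_inner_left _ _ _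
    rw [← inner_conj_symm, ← e, orth f _ f' (supp_of_mulOp fun u hu => ?_) hf, map_zero]
    rw [e]
    have := h _ (hV T hT u _ hu hv.conj)
    simp only [ContinuousLinearMap.comp_apply, inner_mulOp hv.conj] at this
    simpa using this
  rw [← inner_conj_symm, orth g _ g' (supp_of_mulOp h1) hg, map_zero]

end NNsec
end OpSynthAux

namespace OpSynthAux
open Filter Topology ENNReal

section L4sec

abbrev l2 := lp (fun _ : ℕ => ℂ) 2

lemma l2_dense : ∃ s : ℕ → l2, DenseRange s := by
  let b : HilbertBasis ℕ ℂ l2 := HilbertBasis.ofRepr (LinearIsometryEquiv.refl ℂ l2)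
  have h1 := ((countable_range (b : ℕ → l2)).isSeparable.span (R := ℂ)).closure
  have h2 := b.dense_span
  have h3 : closure ((Submodule.span ℂ (range b) : Submodule ℂ l2) : Set l2) = univ := by
    rw [← Submodule.topologicalClosure_coe, h2]; rfl
  rw [h3, TopologicalSpace.isSeparable_univ_iff] at h1
  exact ⟨_, TopologicalSpace.denseRange_denseSeq l2⟩

lemma l2_sum (q : l2) : ∑' i, ‖q i‖ₑ ^ 2 = ENNReal.ofReal (‖q‖ ^ 2) := by
  have h := lp.norm_rpow_eq_tsum (p := 2) (by norm_num) q
  have h' := (lp.memℓp q).summable (by norm_num)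
  simp only [ENNReal.toReal_ofNat, Real.rpow_two] at h h'
  rw [h, ENNReal.ofReal_tsum_of_nonneg (fun i => by positivity) h']
  simp [ENNReal.ofReal_pow, ofReal_norm]

def SqB {ι H : Type} [NormedAddCommGroup H] (a : ι → H) (A : ℝ) : Prop :=
  0 ≤ A ∧ ∑' i, ‖a i‖ₑ ^ 2 ≤ ENNReal.ofReal (A ^ 2)

variable {H K : Type} [NormedAddCommGroup H] [InnerProductSpace ℂ H] [NormedAddCommGroup K]
  [InnerProductSpace ℂ K] {ι : Type}

lemma SqB.sqs {a : ι → H} {A : ℝ} (h : SqB a A) : SqS a := by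
  have h2 := ENNReal.summable_toReal (h.2.trans_lt ENNReal.ofReal_lt_top).ne
  simpa [SqS] using h2

lemma SqB.le {a : ι → H} {A : ℝ} (h : SqB a A) : ∑' i, ‖a i‖ ^ 2 ≤ A ^ 2 := by
  rw [← ENNReal.ofReal_le_ofReal_iff (by positivity),
    ENNReal.ofReal_tsum_of_nonneg (fun i => by positivity) h.sqs]
  simpa [ENNReal.ofReal_pow, ofReal_norm] using h.2

lemma SqS.sqb {a : ι → H} (h : SqS a) : SqB a (√(∑' i, ‖a i‖ ^ 2)) := by
  refine ⟨Real.sqrt_nonneg _, ?_⟩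
  rw [Real.sq_sqrt (tsum_nonneg fun i => by positivity),
    ENNReal.ofReal_tsum_of_nonneg (fun i => by positivity) h]
  simp [ENNReal.ofReal_pow, ofReal_norm]

lemma SqB.cs {a : ι → H} {b : ι → K} {A B : ℝ} (h : SqB a A) (h' : SqB b B) (T : H →L[ℂ] K) :
    ‖∑' i, ⟪b i, T (a i)⟫‖ ≤ ‖T‖ * (B * A) := by
  have h1 : Summable fun i => ‖b i‖ * ‖a i‖ := h.sqs.summable_mul h'.sqs
  have h2 : ∀ i, ‖⟪b i, T (a i)⟫‖ ≤ ‖T‖ * (‖b i‖ * ‖a i‖) := fun i => norm_inner_op T _ _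
  refine (tsum_of_norm_bounded (h1.mul_left ‖T‖).hasSum h2).trans ?_
  rw [tsum_mul_left]
  refine mul_le_mul_of_nonneg_left ?_ (norm_nonneg _)
  have h3 := Real.inner_le_Lp_mul_Lq_tsum_of_nonneg (p := 2) (q := 2) (f := fun i => ‖b i‖)
    (g := fun i => ‖a i‖) Real.HolderConjugate.two_two (fun _ => norm_nonneg _)
    (fun _ => norm_nonneg _) (by simpa [SqS] using h'.sqs) (by simpa [SqS] using h.sqs)
  refine h3.trans ?_
  simp only [Real.rpow_two, ← Real.sqrt_eq_rpow]
  exact mul_le_mul (Real.sqrt_le_iff.2 ⟨h'.1, h'.le⟩) (Real.sqrt_le_iff.2 ⟨h.1, h.le⟩)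
    (Real.sqrt_nonneg _) h'.1

variable {X X₁ X₂ : Type} [MeasurableSpace X] [MeasurableSpace X₁]
  [MeasurableSpace X₂] {μ : Measure X} {μ₁ : Measure X₁} {μ₂ : Measure X₂}

lemma mulOp_mulOp {u v : X → ℂ} (hu : BM u) (hv : BM v) (f : Lp ℂ 2 μ) :
    mulOp μ u (mulOp μ v f) = mulOp μ (fun x => u x * v x) f := by
  refine Lp.ext ?_
  filter_upwards [mulOp_coe hu (mulOp μ v f), mulOp_coe hv f, mulOp_coe (hu.mul hv) f] with x a b c
  rw [a, b, c, mul_assoc]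

lemma norm_chi_le {α : Set X} (h : MeasurableSet α) (f : Lp ℂ 2 μ) : ‖chi μ α f‖ ≤ ‖f‖ := by
  refine Lp.norm_le_norm_of_ae_le ?_
  filter_upwards [chi_coe h f] with x hx
  rw [hx]
  by_cases hx : x ∈ α <;> simp [hx]

/-- approximate rectangle -/
def nbr (ξ : ℕ → Lp ℂ 2 μ) (q : l2) (ε : ℝ) : Set X :=
  {x | ∑' k, ‖ξ k x - q k‖ₑ ^ 2 ≤ ENNReal.ofReal (ε ^ 2)}

lemma nbr_meas (ξ : ℕ → Lp ℂ 2 μ) (q : l2) (ε : ℝ) : MeasurableSet (nbr ξ q ε) :=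
  measurableSet_le (Measurable.tsum fun k => ((lp_meas (ξ k)).sub_const _).enorm.pow_const 2)
    measurable_const

lemma sqb_err {ξ : ℕ → Lp ℂ 2 μ} {q : l2} {ε : ℝ} (hε : 0 ≤ ε) {f : Lp ℂ 2 μ} {u : X → ℂ} (hu : BM u)
    (hf : f =ᵐ[μ] u) (h0 : ∀ x, x ∉ nbr ξ q ε → u x = 0) :
    SqB (fun i => mulOp μ u (ξ i) - q i • f) (ε * ‖f‖) := by
  refine ⟨by positivity, ?_⟩
  simp only [enorm_sq]
  rw [← lintegral_tsum fun i => ((lp_meas _).enorm.pow_const 2).aemeasurable]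
  have : ENNReal.ofReal ((ε * ‖f‖) ^ 2) = ∫⁻ x, ENNReal.ofReal (ε ^ 2) * ‖f x‖ₑ ^ 2 ∂μ := by
    rw [lintegral_const_mul _ ((lp_meas _).enorm.pow_const 2), ← enorm_sq, mul_pow,
      ENNReal.ofReal_mul (by positivity), ENNReal.ofReal_pow (norm_nonneg _), ofReal_norm]
  rw [this]
  refine lintegral_mono_ae ?_
  filter_upwards [hf, ae_all_iff.2 fun i => mulOp_coe hu (ξ i),
    ae_all_iff.2 fun i => Lp.coeFn_sub (mulOp μ u (ξ i)) (q i • f),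
    ae_all_iff.2 fun i => Lp.coeFn_smul (q i) f] with x h1 h2 h3 h4
  have e : ∀ i, ‖(mulOp μ u (ξ i) - q i • f : Lp ℂ 2 μ) x‖ₑ ^ 2 = ‖ξ i x - q i‖ₑ ^ 2 * ‖f x‖ₑ ^ 2 := by
    intro i
    rw [h3, Pi.sub_apply, h2, h4, Pi.smul_apply, h1, ← mul_pow, ← enorm_mul]
    congr 2
    simp; ring
  simp only [e]
  rw [ENNReal.tsum_mul_right]
  by_cases hx : x ∈ nbr ξ q ε
  · gcongr; exact hx
  · simp [h1, h0 x hx]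

lemma sqb_smul (q : l2) (f : H) : SqB (fun i => q i • f) (‖q‖ * ‖f‖) := by
  refine ⟨by positivity, ?_⟩
  simp only [enorm_smul, mul_pow]
  rw [ENNReal.tsum_mul_right, l2_sum, ENNReal.ofReal_mul (by positivity), ENNReal.ofReal_pow (norm_nonneg _) 2,
    ENNReal.ofReal_pow (norm_nonneg _) 2, ofReal_norm, ofReal_norm]

def Ann (ξ : ℕ → Lp ℂ 2 μ₁) (η : ℕ → Lp ℂ 2 μ₂) (T : Lp ℂ 2 μ₁ →L[ℂ] Lp ℂ 2 μ₂) : Prop :=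
  ∀ u v, BM u → BM v → ∑' i, ⟪η i, mulOp μ₂ v (T (mulOp μ₁ u (ξ i)))⟫ = 0

lemma kill_aux {ξ : ℕ → Lp ℂ 2 μ₁} {η : ℕ → Lp ℂ 2 μ₂} {T : Lp ℂ 2 μ₁ →L[ℂ] Lp ℂ 2 μ₂}
    (hT : Ann ξ η T) {p q : l2} {ε : ℝ} (hε : 0 ≤ ε) {f : Lp ℂ 2 μ₁} {u : X₁ → ℂ} (hu : BM u)
    (hf : f =ᵐ[μ₁] u) (h0 : ∀ x, x ∉ nbr ξ q ε → u x = 0) {g : Lp ℂ 2 μ₂} {v : X₂ → ℂ} (hv : BM v)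
    (hg : g =ᵐ[μ₂] v) (h0' : ∀ x, x ∉ nbr η p ε → v x = 0) :
    ‖⟪p, q⟫‖ * ‖⟪g, T f⟫‖ ≤ (‖T‖ * (ε * (‖p‖ + ‖q‖ + ε))) * (‖g‖ * ‖f‖) := by
  have h1 := hT u _ hu hv.conj
  simp only [inner_mulOp hv.conj, Complex.conj_conj] at h1
  have a1 := sqb_err hε hu hf h0
  have a2 := sqb_smul q f
  have b1 := sqb_err hε hv hg h0'
  have b2 := sqb_smul p g
  have e : ∀ i, ⟪mulOp μ₂ v (η i), T (mulOp μ₁ u (ξ i))⟫ = ⟪p i • g, T (q i • f)⟫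
      + (⟪mulOp μ₂ v (η i) - p i • g, T (q i • f)⟫ + (⟪p i • g, T (mulOp μ₁ u (ξ i) - q i • f)⟫
      + ⟪mulOp μ₂ v (η i) - p i • g, T (mulOp μ₁ u (ξ i) - q i • f)⟫)) := by
    intro i
    simp only [map_sub, inner_sub_left, inner_sub_right]; ring
  simp only [e] at h1
  have s1 := a2.sqs.summable_inner b2.sqs T
  have s2 := a2.sqs.summable_inner b1.sqs T
  have s3 := a1.sqs.summable_inner b2.sqs T
  have s4 := a1.sqs.summable_inner b1.sqs T
  rw [s1.tsum_add (s2.add (s3.add s4)), s2.tsum_add (s3.add s4), s3.tsum_add s4] at h1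
  have e2 : ∑' i, ⟪p i • g, T (q i • f)⟫ = ⟪p, q⟫ * ⟪g, T f⟫ := by
    rw [← (lp.hasSum_inner p q).tsum_eq, ← tsum_mul_right]
    refine tsum_congr fun i => ?_
    simp [inner_smul_left, inner_smul_right]; ring
  rw [e2] at h1
  rw [← norm_mul, eq_neg_of_add_eq_zero_left h1, norm_neg]
  refine (norm_add_le _ _).trans ((add_le_add (a2.cs b1 T) ((norm_add_le _ _).trans
    (add_le_add (a1.cs b2 T) (a1.cs b1 T)))).trans (le_of_eq ?_))
  ring

lemma kill_nbr {ξ : ℕ → Lp ℂ 2 μ₁} {η : ℕ → Lp ℂ 2 μ₂} {T : Lp ℂ 2 μ₁ →L[ℂ] Lp ℂ 2 μ₂}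
    (hT : Ann ξ η T) {p q : l2} {ε : ℝ} (hε : 0 ≤ ε)
    (hpq : ε * (‖p‖ + ‖q‖ + ε) < ‖⟪p, q⟫‖) : Kills T (nbr ξ q ε) (nbr η p ε) := by
  set α := nbr ξ q ε with hαd
  set β := nbr η p ε with hβd
  have hα : MeasurableSet α := nbr_meas _ _ _
  have hβ : MeasurableSet β := nbr_meas _ _ _
  set T' := chi μ₂ β ∘L T ∘L chi μ₁ α with hT'd
  have hT' : Ann ξ η T' := by
    intro u v hu hv
    have := hT _ _ ((BM.ind hα).mul hu) (hv.mul (BM.ind hβ))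
    rw [← this]
    refine tsum_congr fun i => ?_
    rw [← mulOp_mulOp hv (BM.ind hβ), ← mulOp_mulOp (BM.ind hα) hu]; rfl
  have hT2 : ∀ f g, ⟪g, T' f⟫ = ⟪chi μ₂ β g, T' (chi μ₁ α f)⟫ := by
    intro f g
    simp only [hT'd, ContinuousLinearMap.comp_apply]
    rw [chi_idem hα, ← chi_inner hβ, chi_idem hβ]
  have key : ∀ f g, ‖⟪p, q⟫‖ * ‖⟪g, T' f⟫‖ ≤ (‖T'‖ * (ε * (‖p‖ + ‖q‖ + ε))) * (‖g‖ * ‖f‖) := by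
    have simp_dense : ∀ {Y : Type} [MeasurableSpace Y] (ν : Measure Y), Dense (range
      (Subtype.val : Lp.simpleFunc ℂ 2 ν → Lp ℂ 2 ν)) := fun ν => Lp.simpleFunc.denseRange (by norm_num)
    have hs : ∀ {Y : Type} [MeasurableSpace Y] (ν : Measure Y) (s : Set Y) (hs : MeasurableSet s)
        (f : Lp.simpleFunc ℂ 2 ν), ∃ u, BM u ∧ chi ν s f =ᵐ[ν] u ∧ ∀ x, x ∉ s → u x = 0 := by
      intro Y _ ν s hs f
      refine ⟨s.indicator (Lp.simpleFunc.toSimpleFunc f), ⟨(SimpleFunc.measurable _).indicator hs, ?_⟩, ?_, ?_⟩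
      · obtain ⟨C, hC⟩ := (Lp.simpleFunc.toSimpleFunc f).exists_forall_norm_le
        exact ⟨C, fun x => (norm_indicator_le_norm_self _ _).trans (hC x)⟩
      · filter_upwards [chi_coe hs (f : Lp ℂ 2 ν), Lp.simpleFunc.toSimpleFunc_eq_toFun f] with x h1 h2
        rw [h1]; simp only [indicator]; rw [h2]
      · intro x hx; simp [hx]
    intro f g
    revert f
    refine fun f => (simp_dense μ₁).induction (P := fun f => ‖⟪p, q⟫‖ * ‖⟪g, T' f⟫‖ ≤ (‖T'‖ * (ε * (‖p‖ + ‖q‖ + ε))) * (‖g‖ * ‖f‖)) ?_ (isClosed_le (by fun_prop) (by fun_prop)) f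
    rintro _ ⟨f, rfl⟩
    refine (simp_dense μ₂).induction (P := fun g => ‖⟪p, q⟫‖ * ‖⟪g, T' (f : Lp ℂ 2 μ₁)⟫‖ ≤ (‖T'‖ * (ε * (‖p‖ + ‖q‖ + ε))) * (‖g‖ * ‖(f : Lp ℂ 2 μ₁)‖)) ?_ (isClosed_le (by fun_prop) (by fun_prop)) g
    rintro _ ⟨g, rfl⟩
    rw [hT2]
    obtain ⟨u, hu, h1, h2⟩ := hs μ₁ α hα f
    obtain ⟨v, hv, h3, h4⟩ := hs μ₂ β hβ g
    refine (kill_aux hT' hε hu h1 h2 hv h3 h4).trans ?_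
    have := norm_chi_le hα (f : Lp ℂ 2 μ₁)
    have := norm_chi_le hβ (g : Lp ℂ 2 μ₂)
    gcongr
  have h0 : T' = 0 := by
    by_contra hne
    have hpos : 0 < ‖T'‖ := norm_pos_iff.2 hne
    have hp : 0 < ‖⟪p, q⟫‖ := lt_of_le_of_lt (by positivity) hpq
    have : ‖T'‖ ≤ ‖T'‖ * (ε * (‖p‖ + ‖q‖ + ε)) / ‖⟪p, q⟫‖ := by
      refine T'.opNorm_le_bound (by positivity) fun f => ?_
      have := key f (T' f)
      rw [inner_self_eq_norm_sq_to_K] at this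
      simp only [norm_pow, Complex.norm_real, RCLike.norm_ofReal, abs_norm] at this
      rcases (norm_nonneg (T' f)).eq_or_lt with h | h
      · rw [← h]; positivity
      · rw [div_mul_eq_mul_div, le_div_iff₀ hp]
        refine le_of_mul_le_mul_right ?_ h
        nlinarith
    rw [le_div_iff₀ hp] at this
    exact absurd (lt_of_le_of_lt this (mul_lt_mul_of_pos_left hpq hpos)) (lt_irrefl _)
  refine kills_of_inner fun f g hf hg => ?_
  have : ⟪g, T' f⟫ = 0 := by rw [h0]; simp
  simp only [hT'd, ContinuousLinearMap.comp_apply] at this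
  rwa [chi_inner hβ, hf.chi hα, hg.chi hβ] at this

lemma l4 {ξ : ℕ → Lp ℂ 2 μ₁} {η : ℕ → Lp ℂ 2 μ₂} (hξ : SqS ξ) (hη : SqS η) :
    ∃ (α : ℕ × ℕ × ℕ → Set X₁) (β : ℕ × ℕ × ℕ → Set X₂), (∀ n, MeasurableSet (α n)) ∧
      (∀ n, MeasurableSet (β n)) ∧ (∃ (p : X₁ → Prop) (q : X₂ → Prop),
    (∀ᵐ x ∂μ₁, p x) ∧ (∀ᵐ y ∂μ₂, q y) ∧ ∀ x y, p x → q y → ker ξ η (x, y) ≠ 0 → 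
      ∃ n, x ∈ α n ∧ y ∈ β n) ∧
    ∀ T, Ann ξ η T → ∀ n, Kills T (α n) (β n) := by
  obtain ⟨s, hs⟩ := l2_dense
  let ε : ℕ → ℝ := fun r => 1 / ((r : ℝ) + 1)
  have hε : ∀ r, 0 < ε r := fun r => by positivity
  classical
  let G : ℕ × ℕ × ℕ → Prop := fun n =>
    ε n.2.2 * (‖s n.1‖ + ‖s n.2.1‖ + ε n.2.2) < ‖⟪s n.1, s n.2.1⟫‖
  refine ⟨fun n => if G n then nbr ξ (s n.2.1) (ε n.2.2) else ∅, fun n => nbr η (s n.1) (ε n.2.2),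
    fun n => ?_, fun n => nbr_meas _ _ _, ⟨_, _, sqs_pt hξ, sqs_pt hη, fun x y hx hy hk => ?_⟩,
    fun T hT n => ?_⟩
  · dsimp only; split_ifs
    · exact nbr_meas _ _ _
    · exact MeasurableSet.empty
  · let q0 : l2 := ⟨fun i => ξ i x, (memℓp_gen_iff (by norm_num)).2 (by simpa [SqS] using hx)⟩
    let p0 : l2 := ⟨fun i => η i y, (memℓp_gen_iff (by norm_num)).2 (by simpa [SqS] using hy)⟩
    have hin : ⟪p0, q0⟫ ≠ 0 := by
      rw [← (lp.hasSum_inner p0 q0).tsum_eq]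
      exact hk
    have hop : IsOpen {z : l2 × l2 × ℝ | z.2.2 * (‖z.1‖ + ‖z.2.1‖ + z.2.2) < ‖⟪z.1, z.2.1⟫‖} :=
      isOpen_lt (by fun_prop) (by fun_prop)
    obtain ⟨δ, hδ, hball⟩ := Metric.isOpen_iff.1 hop (p0, q0, 0) (by simpa using hin)
    obtain ⟨r, hr⟩ := exists_nat_one_div_lt hδ
    obtain ⟨i, hi⟩ := hs.exists_dist_lt p0 (hε r)
    obtain ⟨j, hj⟩ := hs.exists_dist_lt q0 (hε r)
    have hG : G (i, j, r) := by
      apply hball (show (s i, s j, ε r) ∈ _ from ?_)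
      rw [Metric.mem_ball, Prod.dist_eq, Prod.dist_eq]
      refine max_lt ?_ (max_lt ?_ ?_)
      · rw [dist_comm]; exact hi.trans hr
      · rw [dist_comm]; exact hj.trans hr
      · rw [Real.dist_eq, sub_zero, abs_of_pos (hε r)]; exact hr
    have hmem : ∀ (a : l2) (b : l2), dist a b < ε r → ∑' k, ‖a k - b k‖ₑ ^ 2 ≤ ENNReal.ofReal (ε r ^ 2) := by
      intro a b hab
      have := l2_sum (a - b)
      simp only [lp.coeFn_sub, Pi.sub_apply] at this
      rw [this]
      rw [dist_eq_norm] at hab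
      gcongr
    refine ⟨(i, j, r), ?_, hmem p0 (s i) hi⟩
    simp only [if_pos hG]
    exact hmem q0 (s j) hj
  · by_cases h : G n
    · simp only [if_pos h]
      exact kill_nbr hT (hε _).le h
    · simp only [if_neg h]
      refine kills_of_inner fun f g hf hg => ?_
      have : f = 0 := Lp.ext (by filter_upwards [hf, Lp.coeFn_zero ℂ 2 μ₁] with x h1 h2; rw [h1 (by simp), h2]; rfl)
      rw [this]; simp

end L4sec
end OpSynthAux

namespace OpSynthAux
open Filter Topology ENNReal

section Nullsec

lemma riesz_compact {Z : Type} [TopologicalSpace Z] [CompactSpace Z] [T2Space Z] [MeasurableSpace Z]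
    [BorelSpace Z] (Λ : C(Z, ℝ) →ₗ[ℝ] ℝ) (hΛ : ∀ h, (∀ z, 0 ≤ h z) → 0 ≤ Λ h) :
    ∃ π : Measure Z, IsFiniteMeasure π ∧ ∀ h : C(Z, ℝ), ∫ z, h z ∂π = Λ h := by
  let L0 : CompactlySupportedContinuousMap Z ℝ →ₗ[ℝ] ℝ :=
    { toFun := fun f => Λ f.toContinuousMap
      map_add' := fun f g => by rw [← map_add]; rfl
      map_smul' := fun c f => by rw [← map_smul]; rfl }
  let L : CompactlySupportedContinuousMap Z ℝ →ₚ[ℝ] ℝ := ⟨L0, by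
    intro f g hfg
    have : 0 ≤ Λ (g.toContinuousMap - f.toContinuousMap) := hΛ _ fun z => by
      have := hfg z
      simpa using this
    rw [map_sub] at this
    simpa [L0] using this⟩
  refine ⟨RealRMK.rieszMeasure L, ⟨isCompact_univ.measure_lt_top⟩, fun h => ?_⟩
  exact RealRMK.integral_rieszMeasure L (CompactlySupportedContinuousMap.continuousMapEquiv h)

variable {A B : Type} [TopologicalSpace A] [CompactSpace A] [TopologicalSpace.MetrizableSpace A]
  [SecondCountableTopology A] [MeasurableSpace A] [BorelSpace A]
  [TopologicalSpace B] [CompactSpace B] [TopologicalSpace.MetrizableSpace B]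
  [SecondCountableTopology B] [MeasurableSpace B] [BorelSpace B]
  {μ₁ : Measure A} {μ₂ : Measure B} [IsFiniteMeasure μ₁] [IsFiniteMeasure μ₂]

lemma cont_int (a : C(A, ℝ)) (μ : Measure A) [IsFiniteMeasure μ] : Integrable a μ :=
  (map_continuous a).integrable_of_hasCompactSupport (HasCompactSupport.of_compactSpace _)

lemma core_delta {E : Set (A × B)} (hE : ¬ MargNull μ₁ μ₂ E) : ∃ δ : ℝ, 0 < δ ∧
    ∀ (a : C(A, ℝ)) (b : C(B, ℝ)), (∀ x, 0 ≤ a x) → (∀ y, 0 ≤ b y) →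
      (∀ p ∈ E, 1 ≤ a p.1 + b p.2) → δ ≤ ∫ x, a x ∂μ₁ + ∫ y, b y ∂μ₂ := by
  by_contra hc
  push Not at hc
  have h1 : ∀ n : ℕ, (0 : ℝ) < (1 / 2) ^ n := fun n => by positivity
  choose a b ha hb hab hlt using fun n => hc _ (h1 n)
  apply hE
  have bc : ∀ {Y : Type} [MeasurableSpace Y] (μ : Measure Y) [IsFiniteMeasure μ] (c : ℕ → Y → ℝ)
      (hi : ∀ n, Integrable (c n) μ) (hc : ∀ n y, 0 ≤ c n y) (hl : ∀ n, ∫ y, c n y ∂μ ≤ (1 / 2) ^ n),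
      ∀ᵐ y ∂μ, ∀ᶠ n in atTop, y ∉ {y | (1 / 2 : ℝ) ≤ c n y} := by
    intro Y _ μ _ c hi hc hl
    refine ae_eventually_notMem ?_
    have : ∀ n, μ {y | (1 / 2 : ℝ) ≤ c n y} ≤ ENNReal.ofReal (2 * (1 / 2) ^ n) := fun n => by
      have := mul_meas_ge_le_integral_of_nonneg (Eventually.of_forall (hc n)) (hi n) (1 / 2)
      rw [← ENNReal.ofReal_toReal (measure_ne_top μ {y | (1 / 2 : ℝ) ≤ c n y})]
      refine ENNReal.ofReal_le_ofReal ?_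
      have h2 := hl n
      simp only [Measure.real] at this
      linarith
    refine ((ENNReal.tsum_le_tsum this).trans_lt ?_).ne
    exact Summable.tsum_ofReal_lt_top (summable_geometric_two.mul_left 2)
  refine margNull_iff.2 ⟨_, _, bc μ₁ (fun n => a n) (fun n => cont_int _ _) ha fun n => ?_,
    bc μ₂ (fun n => b n) (fun n => cont_int _ _) hb fun n => ?_, fun x y hx hy hxy => ?_⟩
  · have := hlt n
    have : 0 ≤ ∫ y, b n y ∂μ₂ := integral_nonneg (hb n)
    linarith
  · have := hlt n
    have : 0 ≤ ∫ y, a n y ∂μ₁ := integral_nonneg (ha n)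
    linarith
  · obtain ⟨n, h1, h2⟩ := (hx.and hy).exists
    simp only [mem_setOf_eq, not_le] at h1 h2
    have := hab n _ hxy
    simp only at this
    linarith

lemma le_of_cont {μ ν : Measure A} [IsFiniteMeasure μ] [IsFiniteMeasure ν]
    (h : ∀ a : C(A, ℝ), (∀ x, 0 ≤ a x) → ∫ x, a x ∂μ ≤ ∫ x, a x ∂ν) : μ ≤ ν := by
  have hcl : ∀ F : Set A, IsClosed F → μ F ≤ ν F := by
    intro F hF
    refine le_of_tendsto_of_tendsto' (HasOuterApproxClosed.tendsto_lintegral_apprSeq hF μ)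
      (HasOuterApproxClosed.tendsto_lintegral_apprSeq hF ν) fun n => ?_
    let a : C(A, ℝ) := ⟨fun x => (hF.apprSeq n x : ℝ), by fun_prop⟩
    rw [lintegral_coe_eq_integral _ (cont_int a μ), lintegral_coe_eq_integral _ (cont_int a ν)]
    exact ENNReal.ofReal_le_ofReal (h a fun x => NNReal.coe_nonneg _)
  refine Measure.le_iff.2 fun s hs => ?_
  rw [hs.measure_eq_iSup_isClosed_of_ne_top (measure_ne_top μ s)]
  exact iSup_le fun K => iSup_le fun hK => iSup_le fun hc => (hcl K hc).trans (measure_mono hK)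

lemma core {E : Set (A × B)} (hcl : IsClosed E) (hE : ¬ MargNull μ₁ μ₂ E) :
    ∃ π : Measure (A × B), IsFiniteMeasure π ∧ π ≠ 0 ∧ π Eᶜ = 0 ∧ π.map Prod.fst ≤ μ₁ ∧
      π.map Prod.snd ≤ μ₂ := by
  obtain ⟨δ, hδ, hd⟩ := core_delta hE
  have hne : E.Nonempty := by
    by_contra h
    rw [not_nonempty_iff_eq_empty] at h
    exact hE (margNull_iff.2 ⟨fun _ => True, fun _ => True, by simp, by simp, by simp [h]⟩)
  obtain ⟨z0, hz0⟩ := hne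
  let s : PointedCone ℝ (C(A × B, ℝ) × C(A, ℝ) × C(B, ℝ)) :=
    { carrier := {v | (∀ x, 0 ≤ v.2.1 x) ∧ (∀ y, 0 ≤ v.2.2 y) ∧ ∀ p ∈ E, v.1 p ≤ v.2.1 p.1 + v.2.2 p.2}
      add_mem' := by
        rintro v w ⟨h1, h2, h3⟩ ⟨k1, k2, k3⟩
        refine ⟨fun x => add_nonneg (h1 x) (k1 x), fun x => add_nonneg (h2 x) (k2 x), fun p hp => ?_⟩
        have := h3 p hp
        have := k3 p hp
        simp
        linarith
      zero_mem' := by simp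
      smul_mem' := by
        rintro ⟨c, hc⟩ v ⟨h1, h2, h3⟩
        refine ⟨fun x => mul_nonneg hc (h1 x), fun x => mul_nonneg hc (h2 x), fun p hp => ?_⟩
        have := mul_le_mul_of_nonneg_left (h3 p hp) hc
        simpa [mul_add, Subtype.coe_mk, NNReal.smul_def] using this }
  have mems : ∀ v, v ∈ s ↔ ((∀ x, 0 ≤ v.2.1 x) ∧ (∀ y, 0 ≤ v.2.2 y) ∧
    ∀ p ∈ E, v.1 p ≤ v.2.1 p.1 + v.2.2 p.2) := fun v => Iff.rfl
  let f0 : (C(A × B, ℝ) × C(A, ℝ) × C(B, ℝ)) →ₗ[ℝ] ℝ :=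
    { toFun := fun v => ∫ x, v.2.1 x ∂μ₁ + ∫ y, v.2.2 y ∂μ₂ - δ * v.1 z0
      map_add' := fun v w => by
        simp only [Prod.snd_add, Prod.fst_add, ContinuousMap.add_apply]
        rw [integral_add (cont_int _ _) (cont_int _ _), integral_add (cont_int _ _) (cont_int _ _)]
        ring
      map_smul' := fun c v => by
        simp only [Prod.smul_snd, Prod.smul_fst, ContinuousMap.smul_apply, smul_eq_mul, integral_const_mul]
        simp; ring }
  let D : Submodule ℝ (C(A × B, ℝ) × C(A, ℝ) × C(B, ℝ)) :=
    { carrier := {v | ∃ c : ℝ, ∀ z, v.1 z = c}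
      add_mem' := by
        rintro v w ⟨c, hc⟩ ⟨d, hd⟩; exact ⟨c + d, fun z => by simp [hc, hd]⟩
      zero_mem' := ⟨0, fun z => rfl⟩
      smul_mem' := by
        rintro r v ⟨c, hc⟩; exact ⟨r * c, fun z => by simp [hc]⟩ }
  obtain ⟨g, hg1, hg2⟩ := riesz_extension s ⟨D, f0.comp D.subtype⟩ (by
    rintro ⟨⟨h, a, b⟩, c, hc⟩ ⟨k1, k2, k3⟩
    simp only at hc k1 k2 k3
    change 0 ≤ ∫ x, a x ∂μ₁ + ∫ y, b y ∂μ₂ - δ * h z0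
    rw [hc]
    have i1 : 0 ≤ ∫ x, a x ∂μ₁ := integral_nonneg k1
    have i2 : 0 ≤ ∫ y, b y ∂μ₂ := integral_nonneg k2
    rcases le_or_gt c 0 with h0 | h0
    · nlinarith
    · have := hd (c⁻¹ • a) (c⁻¹ • b) (fun x => mul_nonneg (by positivity) (k1 x))
        (fun x => mul_nonneg (by positivity) (k2 x)) (fun p hp => by
          have := k3 p hp
          rw [hc] at this
          simp only [ContinuousMap.smul_apply, smul_eq_mul]
          rw [← mul_add, ← div_eq_inv_mul, le_div_iff₀ h0]; linarith)
      simp only [ContinuousMap.smul_apply, smul_eq_mul, integral_const_mul] at this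
      rw [← mul_add, ← div_eq_inv_mul, le_div_iff₀ h0] at this
      linarith) (by
    rintro ⟨h, a, b⟩
    refine ⟨⟨(ContinuousMap.const _ (-‖h‖), ContinuousMap.const _ ‖a‖, ContinuousMap.const _ ‖b‖),
      -‖h‖, fun z => rfl⟩, ?_, ?_, ?_⟩
    · intro x
      have := a.norm_coe_le_norm x
      rw [Real.norm_eq_abs] at this
      have := neg_abs_le (a x)
      simp; linarith
    · intro x
      have := b.norm_coe_le_norm x
      rw [Real.norm_eq_abs] at this
      have := neg_abs_le (b x)
      simp; linarith
    · intro p _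
      have i1 := a.norm_coe_le_norm p.1
      rw [Real.norm_eq_abs] at i1
      have := neg_abs_le (a p.1)
      have i2 := b.norm_coe_le_norm p.2
      rw [Real.norm_eq_abs] at i2
      have := neg_abs_le (b p.2)
      have i3 := h.norm_coe_le_norm p
      rw [Real.norm_eq_abs] at i3
      have := le_abs_self (h p)
      simp; linarith)
  let Λ : C(A × B, ℝ) →ₗ[ℝ] ℝ := -(g.comp (LinearMap.inl ℝ _ _))
  have hΛE : ∀ h : C(A × B, ℝ), (∀ p ∈ E, 0 ≤ h p) → 0 ≤ Λ h := by
    intro h hh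
    have := hg2 (-h, 0, 0) ((mems _).2 ⟨fun _ => le_rfl, fun _ => le_rfl, fun p hp => by
      simpa using hh p hp⟩)
    have e : g (-h, 0, 0) = Λ h := by
      simp only [Λ, LinearMap.neg_apply, LinearMap.comp_apply, LinearMap.inl_apply, ← map_neg]
      congr 1
      ext <;> simp
    rwa [e] at this
  have hΛ1 : Λ 1 = δ := by
    have := hg1 ⟨((1 : C(A × B, ℝ)), (0 : C(A, ℝ)), (0 : C(B, ℝ))), 1, fun z => rfl⟩
    have e : g (1, 0, 0) = -δ := by
      rw [this]
      change ∫ x, (0 : C(A, ℝ)) x ∂μ₁ + ∫ y, (0 : C(B, ℝ)) y ∂μ₂ - δ * (1 : C(A × B, ℝ)) z0 = _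
      simp
    simp only [Λ, LinearMap.neg_apply, LinearMap.comp_apply, LinearMap.inl_apply]
    rw [← neg_neg δ, ← e]; rfl
  have hΛf : ∀ (a : C(A, ℝ)), (∀ x, 0 ≤ a x) → Λ (a.comp ContinuousMap.fst) ≤ ∫ x, a x ∂μ₁ := by
    intro a ha
    have h1 := hg2 (a.comp ContinuousMap.fst, a, 0) ((mems _).2 ⟨ha, fun _ => le_rfl, fun p hp => by simp⟩)
    have h2 := hg1 ⟨((0 : C(A × B, ℝ)), a, (0 : C(B, ℝ))), 0, fun z => rfl⟩
    have h3 : g (0, a, 0) = ∫ x, a x ∂μ₁ := by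
      rw [h2]
      change ∫ x, a x ∂μ₁ + ∫ y, (0 : C(B, ℝ)) y ∂μ₂ - δ * (0 : C(A × B, ℝ)) z0 = _
      simp
    have h4 : g (a.comp ContinuousMap.fst, a, 0) = g (a.comp ContinuousMap.fst, 0) + g (0, a, 0) := by
      rw [← map_add]; simp
    have h5 : Λ (a.comp ContinuousMap.fst) = - g (a.comp ContinuousMap.fst, 0) := rfl
    linarith
  have hΛs : ∀ (b : C(B, ℝ)), (∀ x, 0 ≤ b x) → Λ (b.comp ContinuousMap.snd) ≤ ∫ x, b x ∂μ₂ := by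
    intro a ha
    have h1 := hg2 (a.comp ContinuousMap.snd, 0, a) ((mems _).2 ⟨fun _ => le_rfl, ha, fun p hp => by simp⟩)
    have h2 := hg1 ⟨((0 : C(A × B, ℝ)), (0 : C(A, ℝ)), a), 0, fun z => rfl⟩
    have h3 : g (0, 0, a) = ∫ x, a x ∂μ₂ := by
      rw [h2]
      change ∫ x, (0 : C(A, ℝ)) x ∂μ₁ + ∫ y, a y ∂μ₂ - δ * (0 : C(A × B, ℝ)) z0 = _
      simp
    have h4 : g (a.comp ContinuousMap.snd, 0, a) = g (a.comp ContinuousMap.snd, 0) + g (0, 0, a) := by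
      rw [← map_add]; simp
    have h5 : Λ (a.comp ContinuousMap.snd) = - g (a.comp ContinuousMap.snd, 0) := rfl
    linarith
  obtain ⟨π, hfin, hπ⟩ := riesz_compact Λ fun h hh => hΛE h fun p _ => hh p
  refine ⟨π, hfin, ?_, ?_, ?_, ?_⟩
  · rintro rfl
    have := hπ 1
    rw [hΛ1] at this
    simp at this
    exact hδ.ne this
  · letI := TopologicalSpace.metrizableSpaceMetric (A × B)
    let h : C(A × B, ℝ) := ⟨fun z => Metric.infDist z E, Metric.continuous_infDist_pt E⟩
    have h0 : ∫ z, h z ∂π = 0 := by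
      rw [hπ]
      refine le_antisymm ?_ (hΛE h fun p _ => Metric.infDist_nonneg)
      have := hΛE (-h) fun p hp => by simp [h, Metric.infDist_zero_of_mem hp]
      rw [map_neg] at this
      linarith
    have hn : 0 ≤ (h : A × B → ℝ) := fun z => Metric.infDist_nonneg
    rw [integral_eq_zero_iff_of_nonneg hn (cont_int h π)] at h0
    refine measure_mono_null ?_ h0
    intro z hz h1
    exact hz ((hcl.mem_iff_infDist_zero ⟨z0, hz0⟩).2 h1)
  · refine le_of_cont fun a ha => ?_
    rw [integral_map measurable_fst.aemeasurable (map_continuous a).aestronglyMeasurable]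
    exact (hπ (a.comp ContinuousMap.fst)).le.trans (hΛf a ha)
  · refine le_of_cont fun a ha => ?_
    rw [integral_map measurable_snd.aemeasurable (map_continuous a).aestronglyMeasurable]
    exact (hπ (a.comp ContinuousMap.snd)).le.trans (hΛs a ha)

end Nullsec
end OpSynthAux

namespace OpSynthAux
open Filter Topology ENNReal

section NTsec
variable {X X₁ X₂ : Type} [MeasurableSpace X]
  [MeasurableSpace X₁] [MeasurableSpace X₂]

lemma exists_wt (μ : Measure X) [SigmaFinite μ] : ∃ s : X → ℝ, Measurable s ∧ (∀ x, 0 < s x) ∧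
    ∫⁻ x, ‖(s x : ℂ)‖ₑ ^ 2 ∂μ ≤ 1 := by
  obtain ⟨g, h1, h2, h3⟩ := exists_pos_lintegral_lt_of_sigmaFinite μ (ε := 1) one_ne_zero
  refine ⟨fun x => √(g x : ℝ), (measurable_coe_nnreal_real.comp h2).sqrt,
    fun x => Real.sqrt_pos.2 (h1 x), le_trans (le_of_eq ?_) h3.le⟩
  refine lintegral_congr fun x => ?_
  rw [← ofReal_norm, ← ENNReal.ofReal_pow (norm_nonneg _), Complex.norm_real, Real.norm_eq_abs,
    sq_abs, Real.sq_sqrt (NNReal.coe_nonneg _), ENNReal.ofReal_coe_nnreal]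

abbrev CC := ℕ → Bool × Bool

lemma emb [StandardBorelSpace X] (α : ℕ → Set X) (hα : ∀ n, MeasurableSet (α n)) :
    ∃ Φ : X → CC, MeasurableEmbedding Φ ∧ ∀ x n, (Φ x n).2 = true ↔ x ∈ α n := by
  classical
  refine ⟨fun x n => (MeasurableSpace.mapNatBool X x n, decide (x ∈ α n)), ?_, by simp⟩
  refine Measurable.measurableEmbedding ?_ ?_
  · refine measurable_pi_iff.2 fun n => Measurable.prodMk
      (measurable_pi_iff.1 (MeasurableSpace.measurable_mapNatBool X) n) ?_
    refine measurable_to_bool ?_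
    simp only [preimage, mem_singleton_iff, decide_eq_true_eq]
    exact hα n
  · intro x y hxy
    apply MeasurableSpace.injective_mapNatBool X
    funext n
    exact (Prod.ext_iff.1 (congrFun hxy n)).1

lemma nullpi_fin [StandardBorelSpace X₁] [StandardBorelSpace X₂] {μ₁ : Measure X₁} {μ₂ : Measure X₂}
    [IsFiniteMeasure μ₁] [IsFiniteMeasure μ₂] {α : ℕ → Set X₁} {β : ℕ → Set X₂}
    (hα : ∀ n, MeasurableSet (α n)) (hβ : ∀ n, MeasurableSet (β n))
    (h : ¬ MargNull μ₁ μ₂ (⋃ n, α n ×ˢ β n)ᶜ) :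
    ∃ (P : Measure (CC × CC)) (φ₁ : CC × CC → X₁) (φ₂ : CC × CC → X₂), P ≠ 0 ∧ Measurable φ₁ ∧
      Measurable φ₂ ∧ P.map φ₁ ≤ μ₁ ∧ P.map φ₂ ≤ μ₂ ∧
      ∀ᵐ ω ∂P, (φ₁ ω, φ₂ ω) ∈ (⋃ n, α n ×ˢ β n)ᶜ := by
  obtain ⟨Φ₁, e1, h1⟩ := emb α hα
  obtain ⟨Φ₂, e2, h2⟩ := emb β hβ
  let E : Set (CC × CC) := {p | ∀ n, ¬ ((p.1 n).2 = true ∧ (p.2 n).2 = true)}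
  have hE : ∀ x y, (Φ₁ x, Φ₂ y) ∈ E ↔ (x, y) ∈ (⋃ n, α n ×ˢ β n)ᶜ := by
    intro x y
    simp only [E, mem_setOf_eq, h1, h2, mem_compl_iff, mem_iUnion, mem_prod, not_exists]
  have hEc : IsClosed E := by
    have : E = ⋂ n, {p : CC × CC | ((p.1 n).2, (p.2 n).2) ∈ ({(true, true)}ᶜ : Set (Bool × Bool))} := by
      ext p; simp [E]
    rw [this]
    exact isClosed_iInter fun n => (isClosed_discrete _).preimage (by fun_prop)
  have hne : (⋃ n, α n ×ˢ β n)ᶜ.Nonempty := by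
    by_contra hh
    rw [not_nonempty_iff_eq_empty] at hh
    exact h (margNull_iff.2 ⟨fun _ => True, fun _ => True, by simp, by simp, by simp [hh]⟩)
  obtain ⟨⟨x0, y0⟩, -⟩ := hne
  haveI : Nonempty X₁ := ⟨x0⟩
  haveI : Nonempty X₂ := ⟨y0⟩
  have hn : ¬ MargNull (μ₁.map Φ₁) (μ₂.map Φ₂) E := by
    intro hm
    obtain ⟨p, q, hp, hq, hpq⟩ := margNull_iff.1 hm
    exact h (margNull_iff.2 ⟨_, _, ae_of_ae_map e1.measurable.aemeasurable hp,
      ae_of_ae_map e2.measurable.aemeasurable hq, fun x y hx hy hxy => hpq _ _ hx hy ((hE x y).2 hxy)⟩)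
  obtain ⟨P, hPf, hP0, hPE, hP1, hP2⟩ := core hEc hn
  refine ⟨P, e1.invFun ∘ Prod.fst, e2.invFun ∘ Prod.snd, hP0, e1.measurable_invFun.comp measurable_fst,
    e2.measurable_invFun.comp measurable_snd, ?_, ?_, ?_⟩
  · rw [← Measure.map_map e1.measurable_invFun measurable_fst]
    refine (Measure.map_mono hP1 e1.measurable_invFun).trans (le_of_eq ?_)
    rw [Measure.map_map e1.measurable_invFun e1.measurable, e1.leftInverse_invFun.comp_eq_id, Measure.map_id]
  · rw [← Measure.map_map e2.measurable_invFun measurable_snd]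
    refine (Measure.map_mono hP2 e2.measurable_invFun).trans (le_of_eq ?_)
    rw [Measure.map_map e2.measurable_invFun e2.measurable, e2.leftInverse_invFun.comp_eq_id, Measure.map_id]
  · have r1 : ∀ᵐ ω ∂P, ω.1 ∈ range Φ₁ := ae_of_ae_map measurable_fst.aemeasurable
      ((Measure.absolutelyContinuous_of_le hP1).ae_le (ae_map_mem_range Φ₁ e1.measurableSet_range μ₁))
    have r2 : ∀ᵐ ω ∂P, ω.2 ∈ range Φ₂ := ae_of_ae_map measurable_snd.aemeasurable
      ((Measure.absolutelyContinuous_of_le hP2).ae_le (ae_map_mem_range Φ₂ e2.measurableSet_range μ₂))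
    have r3 : ∀ᵐ ω ∂P, ω ∈ E := by rw [ae_iff]; exact hPE
    filter_upwards [r1, r2, r3] with ω w1 w2 w3
    obtain ⟨a, b⟩ := ω
    obtain ⟨x, rfl⟩ := w1
    obtain ⟨y, rfl⟩ := w2
    simp only [Function.comp_apply, e1.leftInverse_invFun x, e2.leftInverse_invFun y]
    exact (hE x y).1 w3

variable {μ₁ : Measure X₁} {μ₂ : Measure X₂} [SigmaFinite μ₁] [SigmaFinite μ₂]

lemma nullpi [StandardBorelSpace X₁] [StandardBorelSpace X₂] {α : ℕ → Set X₁} {β : ℕ → Set X₂}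
    (hα : ∀ n, MeasurableSet (α n)) (hβ : ∀ n, MeasurableSet (β n))
    (h : ¬ MargNull μ₁ μ₂ (⋃ n, α n ×ˢ β n)ᶜ) :
    ∃ (P : Measure (CC × CC)) (φ₁ : CC × CC → X₁) (φ₂ : CC × CC → X₂), P ≠ 0 ∧ Measurable φ₁ ∧
      Measurable φ₂ ∧ P.map φ₁ ≤ μ₁ ∧ P.map φ₂ ≤ μ₂ ∧
      ∀ᵐ ω ∂P, (φ₁ ω, φ₂ ω) ∈ (⋃ n, α n ×ˢ β n)ᶜ := by
  have : ∃ n m, ¬ MargNull (μ₁.restrict (spanningSets μ₁ n)) (μ₂.restrict (spanningSets μ₂ m))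
      (⋃ n, α n ×ˢ β n)ᶜ := by
    by_contra hc
    push Not at hc
    apply h
    simp_rw [margNull_iff] at hc ⊢
    choose p q hp hq hpq using hc
    simp_rw [ae_restrict_iff' (measurableSet_spanningSets _ _)] at hp hq
    refine ⟨_, _, ae_all_iff.2 fun n => ae_all_iff.2 fun m => hp n m,
      ae_all_iff.2 fun n => ae_all_iff.2 fun m => hq n m, fun x y hx hy => ?_⟩
    exact hpq _ _ x y (hx _ _ (mem_spanningSetsIndex μ₁ x)) (hy _ _ (mem_spanningSetsIndex μ₂ y))
  obtain ⟨n, m, hnm⟩ := this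
  haveI : IsFiniteMeasure (μ₁.restrict (spanningSets μ₁ n)) :=
    ⟨by simpa using measure_spanningSets_lt_top μ₁ n⟩
  haveI : IsFiniteMeasure (μ₂.restrict (spanningSets μ₂ m)) :=
    ⟨by simpa using measure_spanningSets_lt_top μ₂ m⟩
  obtain ⟨P, φ₁, φ₂, a1, a2, a3, a4, a5, a6⟩ := nullpi_fin hα hβ hnm
  exact ⟨P, φ₁, φ₂, a1, a2, a3, a4.trans Measure.restrict_le_self, a5.trans Measure.restrict_le_self, a6⟩

lemma dom_of_map {Ω : Type} [MeasurableSpace Ω] {P : Measure Ω} {μ : Measure X} {φ : Ω → X} (hφ : Measurable φ)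
    (h : P.map φ ≤ μ) : Dom P μ φ (fun _ => 1) 1 := by
  refine ⟨hφ, measurable_const, zero_le_one, fun f hf => ?_⟩
  simp only [enorm_one, one_pow, one_mul, ENNReal.ofReal_one]
  rw [← lintegral_map hf hφ]
  exact lintegral_mono' h le_rfl

theorem NT [StandardBorelSpace X₁] [StandardBorelSpace X₂] {κ : Set (X₁ × X₂)}
    (hκ : OmegaClosed μ₁ μ₂ κ) {α : Set X₁} {β : Set X₂} (hα : MeasurableSet α) (hβ : MeasurableSet β)
    (hk : ∀ T ∈ NN μ₁ μ₂ κ, Kills T α β) : MargNull μ₁ μ₂ ((α ×ˢ β) ∩ κ) := by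
  obtain ⟨a, b, ha, hb, hab⟩ := hκ
  by_contra hc
  let a' : ℕ → Set X₁ := fun n => Nat.casesOn n αᶜ fun m => Nat.casesOn m univ a
  let b' : ℕ → Set X₂ := fun n => Nat.casesOn n univ fun m => Nat.casesOn m βᶜ b
  have hE : (⋃ n, a' n ×ˢ b' n)ᶜ = (α ×ˢ β) ∩ (⋃ n, a n ×ˢ b n)ᶜ := by
    ext ⟨x, y⟩
    simp only [mem_compl_iff, mem_iUnion, mem_prod, not_exists, mem_inter_iff]
    constructor
    · intro h
      refine ⟨⟨?_, ?_⟩, fun n => h (n + 2)⟩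
      · by_contra hx; exact h 0 ⟨hx, trivial⟩
      · by_contra hx; exact h 1 ⟨trivial, hx⟩
    · rintro ⟨⟨h1, h2⟩, h3⟩ n
      rcases n with _ | _ | n
      · exact fun h => h.1 h1
      · exact fun h => h.2 h2
      · exact h3 n
  have hm : ¬ MargNull μ₁ μ₂ (⋃ n, a' n ×ˢ b' n)ᶜ := by
    intro hm
    rw [hE] at hm
    refine hc ((hm.union hab).mono ?_)
    rintro p ⟨h1, h2⟩
    by_cases hp : p ∈ (⋃ n, a n ×ˢ b n)
    · exact Or.inr (Or.inr ⟨hp, fun h => h h2⟩)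
    · exact Or.inl ⟨h1, hp⟩
  obtain ⟨P, φ₁, φ₂, hP, hφ₁, hφ₂, h1, h2, hae⟩ := nullpi (fun n => by
      rcases n with _ | _ | n
      exacts [hα.compl, MeasurableSet.univ, ha n]) (fun n => by
      rcases n with _ | _ | n
      exacts [MeasurableSet.univ, hβ.compl, hb n]) hm
  rw [hE] at hae
  have d1 := dom_of_map hφ₁ h1
  have d2 := dom_of_map hφ₂ h2
  have hT := NN_mono (μ₁ := μ₁) (μ₂ := μ₂) (κ := (⋃ n, a n ×ˢ b n)ᶜ) (κ' := κ) (hab.mono (by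
    rintro p ⟨h1, h2⟩; exact Or.inl ⟨h2, h1⟩)) (tpi_mem d1 d2 (by
      filter_upwards [hae] with ω hω using Or.inr (Or.inr hω.2)))
  obtain ⟨s₁, m1, p1, l1⟩ := exists_wt μ₁
  obtain ⟨s₂, m2, p2, l2⟩ := exists_wt μ₂
  have M1 : MemLp (fun x => (s₁ x : ℂ)) 2 μ₁ := (memLp_iff (by fun_prop)).2 (l1.trans_lt one_lt_top)
  have M2 : MemLp (fun x => (s₂ x : ℂ)) 2 μ₂ := (memLp_iff (by fun_prop)).2 (l2.trans_lt one_lt_top)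
  have h0 := kills_inner (hk _ hT) (off_chi hα (M1.toLp _)) (off_chi hβ (M2.toLp _))
  simp only [ContinuousLinearMap.comp_apply, ContinuousLinearMap.adjoint_inner_right] at h0
  rw [inner_eq] at h0
  have h3 : ∀ᵐ ω ∂P, wcomp d1 (chi μ₁ α (M1.toLp _)) ω * (starRingEnd ℂ) (wcomp d2 (chi μ₂ β (M2.toLp _)) ω)
      = ((s₁ (φ₁ ω) * s₂ (φ₂ ω) : ℝ) : ℂ) := by
    filter_upwards [hae, wcomp_coe d1 (chi μ₁ α (M1.toLp _)), wcomp_coe d2 (chi μ₂ β (M2.toLp _)),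
      d1.ae (chi_coe hα (M1.toLp _)), d1.ae M1.coeFn_toLp, d2.ae (chi_coe hβ (M2.toLp _)),
      d2.ae M2.coeFn_toLp] with ω w1 w2 w3 w4 w5 w6 w7
    rw [w2, w3, w4.resolve_left one_ne_zero, w6.resolve_left one_ne_zero, indicator_of_mem w1.1.1,
      indicator_of_mem w1.1.2, w5.resolve_left one_ne_zero, w7.resolve_left one_ne_zero]
    simp
  have h4 := (integrable_inner (wcomp d2 (chi μ₂ β (M2.toLp _))) (wcomp d1 (chi μ₁ α (M1.toLp _)))).congr h3
  have h4' : Integrable (fun ω => s₁ (φ₁ ω) * s₂ (φ₂ ω)) P := h4.re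
  rw [integral_congr_ae h3, integral_complex_ofReal, Complex.ofReal_eq_zero,
    integral_eq_zero_iff_of_nonneg (fun ω => (mul_pos (p1 _) (p2 _)).le) h4'] at h0
  apply hP
  rw [← ae_eq_bot]
  rw [← Filter.eventually_false_iff_eq_bot]
  filter_upwards [h0] with ω hω
  exact (mul_pos (p1 _) (p2 _)).ne' hω

lemma mem_refHull {V : Set (Lp ℂ 2 μ₁ →L[ℂ] Lp ℂ 2 μ₂)} (hV : IsWkClosedSubspace V)
    {T : Lp ℂ 2 μ₁ →L[ℂ] Lp ℂ 2 μ₂}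
    (h : ∀ f g, (∀ X ∈ V, ⟪g, X f⟫ = 0) → ⟪g, T f⟫ = 0) : T ∈ RefHull V := by
  intro f
  obtain ⟨⟨M, rfl⟩, -⟩ := hV
  let N : Submodule ℂ (Lp ℂ 2 μ₂) := M.map ((ContinuousLinearMap.apply ℂ (Lp ℂ 2 μ₂) f : (Lp ℂ 2 μ₁ →L[ℂ] Lp ℂ 2 μ₂) →L[ℂ] _) : (Lp ℂ 2 μ₁ →L[ℂ] Lp ℂ 2 μ₂) →ₗ[ℂ] _)
  have : T f ∈ Nᗮᗮ := by
    rw [Submodule.mem_orthogonal]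
    intro g hg
    refine h f g fun X hX => ?_
    exact Submodule.inner_left_of_mem_orthogonal (K := N) ⟨X, hX, rfl⟩ hg
  rw [Submodule.orthogonal_orthogonal_eq_closure] at this
  exact this

lemma refHull_inner {V : Set (Lp ℂ 2 μ₁ →L[ℂ] Lp ℂ 2 μ₂)} {T : Lp ℂ 2 μ₁ →L[ℂ] Lp ℂ 2 μ₂}
    (hT : T ∈ RefHull V) {f : Lp ℂ 2 μ₁} {g : Lp ℂ 2 μ₂} (h : ∀ X ∈ V, ⟪g, X f⟫ = 0) : ⟪g, T f⟫ = 0 := by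
  have hc : IsClosed {y : Lp ℂ 2 μ₂ | ⟪g, y⟫ = 0} := isClosed_eq (by fun_prop) continuous_const
  refine closure_minimal ?_ hc (hT f)
  rintro _ ⟨X, hX, rfl⟩
  exact h X hX

lemma bimod_mulOp {U : Set (Lp ℂ 2 μ₁ →L[ℂ] Lp ℂ 2 μ₂)} (hU : IsMultBimodule μ₁ μ₂ U) :
    ∀ X ∈ U, ∀ u v, BM u → BM v → mulOp μ₂ v ∘L X ∘L mulOp μ₁ u ∈ U :=
  fun X hX u v hu hv => hU.2 X hX _ _ (mulOp_isMult _ hu) (mulOp_isMult _ hv)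

lemma supp_meas {μ : Measure X} (f : Lp ℂ 2 μ) : MeasurableSet {x | f x ≠ 0} :=
  (measurableSet_singleton (0 : ℂ)).compl.preimage (lp_meas f)

lemma off_supp {μ : Measure X} (f : Lp ℂ 2 μ) : Off μ {x | f x ≠ 0} f :=
  Eventually.of_forall fun x hx => by simpa using hx

variable [StandardBorelSpace X₁] [StandardBorelSpace X₂]

theorem NN_sub {κ : Set (X₁ × X₂)} (hκ : OmegaClosed μ₁ μ₂ κ) {U : Set (Lp ℂ 2 μ₁ →L[ℂ] Lp ℂ 2 μ₂)}
    (hU : IsMultBimodule μ₁ μ₂ U) (hm : Mmax μ₁ μ₂ κ ⊆ RefHull U) : NN μ₁ μ₂ κ ⊆ U := by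
  intro T hT
  by_contra hTU
  obtain ⟨ξ, η, hξ, hη, h1, h2⟩ := sep hU.1 hTU
  obtain ⟨α, β, hα, hβ, ⟨p, q, hp, hq, hpq⟩, hk⟩ := l4 hξ hη
  apply h2
  refine hT ξ η hξ hη ?_
  have h3 : ∀ n, MargNull μ₁ μ₂ ((α n ×ˢ β n) ∩ κ) := fun n => NT hκ (hα n) (hβ n) fun S hS =>
    kills_of_inner fun f g hf hg => refHull_inner (hm (NN_sub_Mmax κ hS)) fun X hX =>
      kills_inner (hk X (fun u v hu hv => h1 _ (bimod_mulOp hU X hX u v hu hv)) n) hf hg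
  refine ((MargNull.iUnion h3).union (margNull_iff.2 ⟨p, q, hp, hq, fun x y hx hy hE => ?_⟩ :
    MargNull μ₁ μ₂ {z | ker ξ η z ≠ 0 ∧ ∀ n, z ∉ α n ×ˢ β n})).mono ?_
  · obtain ⟨n, hn⟩ := hpq x y hx hy hE.1
    exact hE.2 n hn
  · rintro z ⟨z1, z2⟩
    by_cases hz : ∃ n, z ∈ α n ×ˢ β n
    · obtain ⟨n, hn⟩ := hz
      exact Or.inl (mem_iUnion.2 ⟨n, hn, z1⟩)
    · exact Or.inr ⟨z2, fun n hn => hz ⟨n, hn⟩⟩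

theorem ref_NN {κ : Set (X₁ × X₂)} (hκ : OmegaClosed μ₁ μ₂ κ) :
    RefHull (NN μ₁ μ₂ κ) = Mmax μ₁ μ₂ κ := by
  apply Subset.antisymm
  · intro T hT α β hα hβ hm
    exact kills_of_inner fun f g hf hg => refHull_inner hT fun X hX =>
      kills_inner (NN_sub_Mmax κ hX α β hα hβ hm) hf hg
  · intro T hT
    refine mem_refHull (NN_bimod κ).1 fun f g h => ?_
    have := NT hκ (supp_meas f) (supp_meas g) fun S hS => kills_supp (bimod_mulOp (NN_bimod κ)) h hS
    exact kills_inner (hT _ _ (supp_meas f) (supp_meas g) this) (off_supp f) (off_supp g)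

theorem synth_iff {κ : Set (X₁ × X₂)} :
    OperatorSynthetic μ₁ μ₂ κ ↔ OmegaClosed μ₁ μ₂ κ ∧ Mmax μ₁ μ₂ κ ⊆ NN μ₁ μ₂ κ := by
  constructor
  · rintro ⟨h1, h2⟩
    refine ⟨h1, ?_⟩
    rw [← h2]
    exact sInter_subset_of_mem ⟨NN_bimod κ, h1, ref_NN h1⟩
  · rintro ⟨h1, h2⟩
    refine ⟨h1, Subset.antisymm ?_ ?_⟩
    · exact Subset.trans (sInter_subset_of_mem (show NN μ₁ μ₂ κ ∈ {U | IsMultBimodule μ₁ μ₂ U ∧ HasSupport μ₁ μ₂ U κ} from ⟨NN_bimod κ, h1, ref_NN h1⟩)) (NN_sub_Mmax κ)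
    · rintro T hT U ⟨hU, hU'⟩
      exact NN_sub h1 hU hU'.2.ge (h2 hT)

end NTsec
end OpSynthAux

namespace OpSynthAux
open Filter Topology ENNReal
section FWsec

lemma nest_aux {H : Type} [NormedAddCommGroup H] [InnerProductSpace ℂ H] [CompleteSpace H]
    {N : Set (Submodule ℂ H)} (hN : IsNest N) {q : Submodule ℂ H} (hq : q ∈ N) {x u z : H} (hx : x ∉ q)
    (hu : ∀ r ∈ N, ¬ r ≤ q → u ∈ r) (hz : ∀ A ∈ nestAlg N, ⟪z, A x⟫ = 0) : ⟪z, u⟫ = 0 := by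
  haveI : CompleteSpace q := (hN.1 q hq).completeSpace_coe
  let v := x - q.starProjection x
  have hv : ∀ a ∈ q, ⟪v, a⟫ = 0 := fun a ha => Submodule.starProjection_inner_eq_zero x a ha
  have hvx : ⟪v, x⟫ ≠ 0 := by
    have e : x = v + q.starProjection x := by simp [v]
    have : ⟪v, x⟫ = ⟪v, v⟫ := by
      conv_lhs => rw [e]
      rw [inner_add_right, hv _ (Submodule.starProjection_apply_mem q x), add_zero]
    rw [this, Ne, inner_self_eq_zero]
    intro h0
    apply hx
    rw [e, h0, zero_add]
    exact Submodule.starProjection_apply_mem q x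
  let A : H →L[ℂ] H := (innerSL ℂ v).smulRight u
  have hA : A ∈ nestAlg N := by
    intro r hr a ha
    by_cases hrq : r ≤ q
    · have : A a = 0 := by simp [A, hv a (hrq ha)]
      rw [this]; exact r.zero_mem
    · have : A a = ⟪v, a⟫ • u := by simp [A]
      rw [this]; exact r.smul_mem _ (hu r hr hrq)
  have := hz A hA
  have e2 : A x = ⟪v, x⟫ • u := by simp [A]
  rw [e2, inner_smul_right] at this
  exact (mul_eq_zero.1 this).resolve_left hvx

lemma nest_total {H : Type} [NormedAddCommGroup H] [InnerProductSpace ℂ H] [CompleteSpace H]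
    {N : Set (Submodule ℂ H)} (hN : IsNest N) (x y : H) :
    (∀ z, (∀ A ∈ nestAlg N, ⟪z, A x⟫ = 0) → ⟪z, y⟫ = 0) ∨
    (∀ z, (∀ A ∈ nestAlg N, ⟪z, A y⟫ = 0) → ⟪z, x⟫ = 0) := by
  let pp : H → Submodule ℂ H := fun x => sInf {q | q ∈ N ∧ x ∈ q}
  have hp : ∀ x, pp x ∈ N := fun x => (hN.2.2 _ fun q hq => hq.1).1
  have hxp : ∀ x, x ∈ pp x := fun x => Submodule.mem_sInf.2 fun q hq => hq.2
  have hle : ∀ x q, q ∈ N → x ∈ q → pp x ≤ q := fun x q h1 h2 => sInf_le ⟨h1, h2⟩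
  have key : ∀ x y, pp y ≤ pp x → ∀ z, (∀ A ∈ nestAlg N, ⟪z, A x⟫ = 0) → ⟪z, y⟫ = 0 := by
    intro x y hyx z hz
    let S : Set (Submodule ℂ H) := {q | q ∈ N ∧ ¬ pp x ≤ q}
    have hSlt : ∀ q ∈ S, q ≤ pp x := fun q hq => by
      rcases hN.2.1.total hq.1 (hp x) with h | h
      · exact h
      · exact absurd h hq.2
    let p' := (sSup S).topologicalClosure
    have hp' : p' ∈ N := (hN.2.2 S fun q hq => hq.1).2
    by_cases hc : pp x ≤ p'
    · have hy : y ∈ p' := hc (hyx (hxp y))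
      have h1 : sSup S ≤ (Submodule.span ℂ {z})ᗮ := by
        refine sSup_le fun q hq => ?_
        intro u hu
        rw [Submodule.mem_orthogonal_singleton_iff_inner_right]
        refine nest_aux hN hq.1 (fun h => hq.2 (hle x q hq.1 h)) (fun r hr hrq => ?_) hz
        rcases hN.2.1.total hq.1 hr with h | h
        · exact h hu
        · exact absurd h hrq
      have h2 := Submodule.topologicalClosure_minimal _ h1 (Submodule.isClosed_orthogonal _) hy
      exact (Submodule.mem_orthogonal_singleton_iff_inner_right).1 h2
    · refine nest_aux hN hp' (fun h => hc (hle x p' hp' h)) (fun r hr hrq => ?_) hz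
      by_contra hyr
      apply hrq
      have : r ∈ S := ⟨hr, fun h => hyr (h (hyx (hxp y)))⟩
      exact (le_sSup this).trans (Submodule.le_topologicalClosure _)
  rcases hN.2.1.total (hp y) (hp x) with h | h
  · exact Or.inl (key x y h)
  · exact Or.inr (key y x h)

variable {X₁ X₂ : Type} [MeasurableSpace X₁] [MeasurableSpace X₂]
  {μ₁ : Measure X₁} {μ₂ : Measure X₂}

lemma kills_adj {T : Lp ℂ 2 μ₁ →L[ℂ] Lp ℂ 2 μ₂} {α : Set X₁} {β : Set X₂} (h : Kills T α β) :
    Kills (ContinuousLinearMap.adjoint T) β α := by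
  intro g f hg hf
  rw [ContinuousLinearMap.adjoint_inner_left]
  exact kills_inner h hf hg

lemma kills_iUnion_left {ι : Type} [Countable ι] {T : Lp ℂ 2 μ₁ →L[ℂ] Lp ℂ 2 μ₂} {α : ι → Set X₁} {β : Set X₂}
    (hα : ∀ i, MeasurableSet (α i)) (h : ∀ i, Kills T (α i) β) : Kills T (⋃ i, α i) β := by
  refine kills_of_inner fun f g hf hg => ?_
  have h1 : ∀ i, ∀ᵐ x ∂μ₁, x ∈ α i → f x = 0 ∨ (ContinuousLinearMap.adjoint T g) x = 0 := by
    intro i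
    have := supp_of_mulOp (f := chi μ₁ (α i) f) (h := ContinuousLinearMap.adjoint T g) ?_
    · filter_upwards [this, chi_coe (hα i) f] with x h1 h2 hx
      rw [h2, indicator_of_mem hx] at h1
      exact h1
    · intro u hu
      rw [ContinuousLinearMap.adjoint_inner_left]
      exact kills_inner (h i) ((off_chi (hα i) f).mul hu) hg
  rw [← ContinuousLinearMap.adjoint_inner_left, inner_eq]
  refine integral_eq_zero_of_ae ?_
  filter_upwards [ae_all_iff.2 h1, hf] with x h1 h2
  by_cases hx : x ∈ ⋃ i, α i
  · obtain ⟨i, hi⟩ := mem_iUnion.1 hx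
    rcases h1 i hi with h | h <;> simp [h]
  · simp [h2 hx]

lemma kills_iUnion {ι ι' : Type} [Countable ι] [Countable ι'] {T : Lp ℂ 2 μ₁ →L[ℂ] Lp ℂ 2 μ₂} {α : ι → Set X₁} {β : ι' → Set X₂}
    (hα : ∀ i, MeasurableSet (α i)) (hβ : ∀ i, MeasurableSet (β i)) (h : ∀ i j, Kills T (α i) (β j)) :
    Kills T (⋃ i, α i) (⋃ j, β j) := by
  refine kills_iUnion_left hα fun i => ?_
  have := kills_adj (kills_iUnion_left hβ fun j => kills_adj (h i j))
  rwa [ContinuousLinearMap.adjoint_adjoint] at this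

/-- Chain type sets. -/
def CS (α : ℕ → Set X₁) (β : ℕ → Set X₂) : Set (X₁ × X₂) := {p | ∀ m, p.1 ∈ α m → p.2 ∈ β m}

def Cmp (α : ℕ → Set X₁) (β : ℕ → Set X₂) : Prop :=
  (∀ n, MeasurableSet (α n)) ∧ (∀ n, MeasurableSet (β n)) ∧
  ∀ m n, (α m ⊆ α n ∧ β m ⊆ β n) ∨ (α n ⊆ α m ∧ β n ⊆ β m)

lemma cs_compl (α : ℕ → Set X₁) (β : ℕ → Set X₂) : (CS α β)ᶜ = ⋃ n, α n ×ˢ (β n)ᶜ := by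
  ext p; simp [CS]

lemma margEquiv_refl (E : Set (X₁ × X₂)) : MargEquiv μ₁ μ₂ E E :=
  margNull_iff.2 ⟨fun _ => True, fun _ => True, by simp, by simp, by simp⟩

lemma cs_closed {α : ℕ → Set X₁} {β : ℕ → Set X₂} (h : Cmp α β) : OmegaClosed μ₁ μ₂ (CS α β) :=
  ⟨α, fun n => (β n)ᶜ, h.1, fun n => (h.2.1 n).compl, by rw [cs_compl]; exact margEquiv_refl _⟩

lemma nest_cs [StandardBorelSpace X₁] [StandardBorelSpace X₂] [SigmaFinite μ₁] [SigmaFinite μ₂]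
    {V : Set (Lp ℂ 2 μ₁ →L[ℂ] Lp ℂ 2 μ₂)} (hV : IsMultBimodule μ₁ μ₂ V)
    (hN : IsNestBimodule V) : ∃ α β, Cmp α β ∧ Mmax μ₁ μ₂ (CS α β) ⊆ RefHull V ∧
      ∀ X ∈ V, ∀ m, Kills X (α m) (β m)ᶜ := by
  obtain ⟨-, N₁, N₂, hN1, hN2, hNV⟩ := hN
  let P : Set (Lp ℂ 2 μ₁ × Lp ℂ 2 μ₂) := {p | ∀ X ∈ V, ⟪p.2, X p.1⟫ = 0}
  haveI : Fact ((2 : ℝ≥0∞) ≠ ∞) := ⟨by norm_num⟩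
  haveI : TopologicalSpace.SeparableSpace (Lp ℂ 2 μ₁) := inferInstance
  haveI : TopologicalSpace.SeparableSpace (Lp ℂ 2 μ₂) := inferInstance
  obtain ⟨D, hDP, hDc, hDd⟩ := TopologicalSpace.IsSeparable.exists_countable_dense_subset
    (s := P) (TopologicalSpace.IsSeparable.of_separableSpace P)
  have hP0 : (0 : Lp ℂ 2 μ₁ × Lp ℂ 2 μ₂) ∈ P := fun X hX => by simp
  have hDne : D.Nonempty := by
    by_contra hh
    rw [not_nonempty_iff_eq_empty] at hh
    have := hDd hP0
    simp [hh] at this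
  obtain ⟨d, rfl⟩ := hDc.exists_eq_range hDne
  have hd : ∀ n, d n ∈ P := fun n => hDP (mem_range_self n)
  let R : ℕ → ℕ → Prop := fun n m => ∀ g, (∀ X ∈ V, ⟪g, X (d m).1⟫ = 0) → ∀ X ∈ V, ⟪g, X (d n).1⟫ = 0
  have key : ∀ n m, (∀ z, (∀ A ∈ nestAlg N₁, ⟪z, A (d m).1⟫ = 0) → ⟪z, (d n).1⟫ = 0) → R n m := by
    intro n m h g hg X hX
    rw [← ContinuousLinearMap.adjoint_inner_left]
    refine h _ fun A hA => ?_
    rw [ContinuousLinearMap.adjoint_inner_left]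
    have := hg _ (hNV X hX A hA 1 (fun p hp x hx => hx))
    simpa using this
  have htot : ∀ n m, R n m ∨ R m n := fun n m => (nest_total hN1 (d m).1 (d n).1).imp (key n m) (key m n)
  have htr : ∀ a b c, R a b → R b c → R a c := fun a b c h1 h2 g hg => h1 g (h2 g hg)
  have hrf : ∀ a, R a a := fun a g h => h
  let α : ℕ → Set X₁ := fun m => ⋃ n : {n // R n m}, {x | (d n).1 x ≠ 0}
  let γ : ℕ → Set X₂ := fun m => ⋃ n : {n // R m n}, {x | (d n).2 x ≠ 0}
  have hα : ∀ m, MeasurableSet (α m) := fun m => MeasurableSet.iUnion fun n => supp_meas _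
  have hγ : ∀ m, MeasurableSet (γ m) := fun m => MeasurableSet.iUnion fun n => supp_meas _
  have hcmp : ∀ m n, R m n → α m ⊆ α n ∧ γ n ⊆ γ m := by
    intro m n h
    refine ⟨iUnion_subset fun k => ?_, iUnion_subset fun k => ?_⟩
    · exact subset_iUnion (fun n : {k // R k n} => {x | (d n).1 x ≠ 0}) ⟨k.1, htr _ _ _ k.2 h⟩
    · exact subset_iUnion (fun n : {k // R m k} => {x | (d n).2 x ≠ 0}) ⟨k.1, htr _ _ _ h k.2⟩
  refine ⟨α, fun m => (γ m)ᶜ, ⟨hα, fun m => (hγ m).compl, fun m n => ?_⟩, ?_, ?_⟩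
  · rcases htot m n with h | h
    · exact Or.inl ⟨(hcmp _ _ h).1, compl_subset_compl.2 (hcmp _ _ h).2⟩
    · exact Or.inr ⟨(hcmp _ _ h).1, compl_subset_compl.2 (hcmp _ _ h).2⟩
  · intro T hT
    refine mem_refHull hV.1 fun f g hfg => ?_
    have hcl : IsClosed {p : Lp ℂ 2 μ₁ × Lp ℂ 2 μ₂ | ⟪p.2, T p.1⟫ = 0} :=
      isClosed_eq (by fun_prop) continuous_const
    refine closure_minimal ?_ hcl (hDd (show (f, g) ∈ P from hfg))
    rintro _ ⟨m, rfl⟩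
    refine kills_inner (hT (α m) (γ m) (hα m) (hγ m) ?_) ((off_supp _).mono ?_) ((off_supp _).mono ?_)
    · refine (margNull_iff.2 ⟨fun _ => True, fun _ => True, by simp, by simp, ?_⟩)
      rintro x y - - ⟨⟨h1, h2⟩, h3⟩
      exact h3 m h1 h2
    · exact subset_iUnion (fun n : {k // R k m} => {x | (d n).1 x ≠ 0}) ⟨m, hrf m⟩
    · exact subset_iUnion (fun n : {k // R m k} => {x | (d n).2 x ≠ 0}) ⟨m, hrf m⟩
  · intro X hX m
    rw [compl_compl]
    refine kills_iUnion (fun n => supp_meas _) (fun n => supp_meas _) fun n k => ?_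
    exact kills_supp (bimod_mulOp hV) (htr _ _ _ n.2 k.2 _ (hd k)) hX

theorem fw_cs [StandardBorelSpace X₁] [StandardBorelSpace X₂] [SigmaFinite μ₁] [SigmaFinite μ₂]
    {κ : Set (X₁ × X₂)} (h : FiniteWidthSet μ₁ μ₂ κ) :
    ∃ (k : ℕ) (α : Fin k → ℕ → Set X₁) (β : Fin k → ℕ → Set X₂), (∀ j, Cmp (α j) (β j)) ∧
      MargNull μ₁ μ₂ (κ \ ⋂ j, CS (α j) (β j)) ∧ MargNull μ₁ μ₂ ((⋂ j, CS (α j) (β j)) \ κ) := by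
  obtain ⟨V, ⟨k, Vs, hVs, rfl⟩, hκ, hR⟩ := h
  choose α β hc hm hk using fun j => nest_cs (hVs j).1 (hVs j).2
  refine ⟨k, α, β, hc, ?_, ?_⟩
  · have : κ \ ⋂ j, CS (α j) (β j) = ⋃ j, ⋃ n, (α j n ×ˢ (β j n)ᶜ) ∩ κ := by
      ext p
      simp only [CS, mem_diff, mem_iInter, mem_setOf_eq, mem_iUnion, mem_inter_iff, mem_prod, mem_compl_iff]
      push Not
      constructor
      · rintro ⟨h1, j, n, h2, h3⟩; exact ⟨j, n, ⟨h2, h3⟩, h1⟩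
      · rintro ⟨j, n, ⟨h2, h3⟩, h1⟩; exact ⟨h1, j, n, h2, h3⟩
    rw [this]
    refine MargNull.iUnion fun j => MargNull.iUnion fun n => NT hκ ((hc j).1 n) ((hc j).2.1 n).compl ?_
    intro T hT
    refine hk j T (NN_sub hκ (hVs j).1 ?_ hT) n
    rw [← hR]
    intro S hS x
    exact closure_mono (image_mono (iInter_subset _ j)) (hS x)
  · obtain ⟨a, b, ha, hb, hab⟩ := hκ
    have hcl : OmegaClosed μ₁ μ₂ (⋂ j, CS (α j) (β j)) := by
      obtain hk0 | hk0 := isEmpty_or_nonempty (Fin k)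
      · refine ⟨fun _ => ∅, fun _ => ∅, by simp, by simp, ?_⟩
        simp [MargEquiv]
        exact margNull_iff.2 ⟨fun _ => True, fun _ => True, by simp, by simp, by simp⟩
      obtain ⟨e, he⟩ := exists_surjective_nat (Fin k × ℕ)
      refine ⟨fun n => α (e n).1 (e n).2, fun n => (β (e n).1 (e n).2)ᶜ, fun n => (hc _).1 _,
        fun n => ((hc _).2.1 _).compl, ?_⟩
      have : (⋂ j, CS (α j) (β j))ᶜ = ⋃ n, α (e n).1 (e n).2 ×ˢ (β (e n).1 (e n).2)ᶜ := by
        rw [he.iUnion_comp (fun q : Fin k × ℕ => α q.1 q.2 ×ˢ (β q.1 q.2)ᶜ), compl_iInter]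
        simp_rw [cs_compl]
        rw [iUnion_prod']
      rw [this]
      exact margEquiv_refl _
    have h1 : ∀ n, MargNull μ₁ μ₂ ((a n ×ˢ b n) ∩ ⋂ j, CS (α j) (β j)) := by
      intro n
      refine NT hcl (ha n) (hb n) fun T hT => ?_
      have hTV : T ∈ ⋂ j, Vs j := by
        refine mem_iInter.2 fun j => NN_sub (cs_closed (hc j)) (hVs j).1 (hm j) (NN_mono ?_ hT)
        rw [diff_eq_empty.2 (iInter_subset _ j)]
        exact margNull_iff.2 ⟨fun _ => True, fun _ => True, by simp, by simp, by simp⟩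
      have hTm : T ∈ Mmax μ₁ μ₂ κ := by
        rw [← hR]
        intro x
        exact subset_closure ⟨T, hTV, rfl⟩
      refine hTm _ _ (ha n) (hb n) (hab.mono ?_)
      rintro p ⟨h1, h2⟩
      exact Or.inr ⟨mem_iUnion.2 ⟨n, h1⟩, fun h => h h2⟩
    refine ((MargNull.iUnion h1).union hab).mono ?_
    rintro p ⟨h1, h2⟩
    by_cases hp : p ∈ ⋃ n, a n ×ˢ b n
    · obtain ⟨n, hn⟩ := mem_iUnion.1 hp
      exact Or.inl (mem_iUnion.2 ⟨n, hn, h1⟩)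
    · exact Or.inr (Or.inl ⟨h2, hp⟩)

end FWsec
end OpSynthAux

namespace OpSynthAux
open Filter Topology ENNReal
section Tens
variable {X Y : Type} [MeasurableSpace X] [MeasurableSpace Y] {μ : Measure X} {ν : Measure Y}
  [SigmaFinite μ] [SigmaFinite ν]

lemma ell_dom (ν : Measure Y) [SigmaFinite ν] (a : Lp ℂ 2 μ) :
    Dom (μ.prod ν) ν Prod.snd (fun p => a p.1) ‖a‖ := by
  refine ⟨measurable_snd, (lp_meas a).comp measurable_fst, norm_nonneg _, fun f hf => ?_⟩
  rw [lintegral_prod_mul (f := fun x => ‖a x‖ₑ ^ 2) (g := f) ((lp_meas a).enorm.pow_const 2).aemeasurable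
    hf.aemeasurable, ← enorm_sq, ENNReal.ofReal_pow (norm_nonneg _), ofReal_norm]

def ell (ν : Measure Y) [SigmaFinite ν] (a : Lp ℂ 2 μ) : Lp ℂ 2 ν →L[ℂ] Lp ℂ 2 (μ.prod ν) :=
  wcomp (ell_dom ν a)

lemma ell_coe (a : Lp ℂ 2 μ) (w : Lp ℂ 2 ν) : ell ν a w =ᵐ[μ.prod ν] fun p => a p.1 * w p.2 :=
  wcomp_coe _ w

open Classical in
def sl (F : Lp ℂ 2 (μ.prod ν)) (y : Y) : Lp ℂ 2 μ :=
  if h : MemLp (fun x => F (x, y)) 2 μ then h.toLp else 0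

lemma sl_meas (F : Lp ℂ 2 (μ.prod ν)) (y : Y) : Measurable fun x => F (x, y) :=
  (lp_meas F).comp measurable_prodMk_right

lemma lint_sl (F : Lp ℂ 2 (μ.prod ν)) : ∫⁻ y, ∫⁻ x, ‖F (x, y)‖ₑ ^ 2 ∂μ ∂ν = ‖F‖ₑ ^ 2 := by
  rw [enorm_sq, lintegral_prod_symm _ ((lp_meas F).enorm.pow_const 2).aemeasurable]

lemma sl_mem (F : Lp ℂ 2 (μ.prod ν)) : ∀ᵐ y ∂ν, MemLp (fun x => F (x, y)) 2 μ := by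
  have h1 : ∫⁻ y, ∫⁻ x, ‖F (x, y)‖ₑ ^ 2 ∂μ ∂ν ≠ ∞ := by
    rw [lint_sl]; simp
  have h2 : Measurable fun y => ∫⁻ x, ‖F (x, y)‖ₑ ^ 2 ∂μ :=
    Measurable.lintegral_prod_left' (f := fun p => ‖F p‖ₑ ^ 2) ((lp_meas F).enorm.pow_const 2)
  filter_upwards [ae_lt_top h2 h1] with y hy
  exact (memLp_iff (sl_meas F y)).2 hy

lemma sl_coe' (F : Lp ℂ 2 (μ.prod ν)) {y : Y} (h : MemLp (fun x => F (x, y)) 2 μ) :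
    sl F y =ᵐ[μ] fun x => F (x, y) := by
  rw [sl, dif_pos h]; exact h.coeFn_toLp

lemma sl_coe (F : Lp ℂ 2 (μ.prod ν)) : ∀ᵐ y ∂ν, sl F y =ᵐ[μ] fun x => F (x, y) := by
  filter_upwards [sl_mem F] with y hy using sl_coe' F hy

lemma sl_norm (F : Lp ℂ 2 (μ.prod ν)) : ∫⁻ y, ‖sl F y‖ₑ ^ 2 ∂ν = ‖F‖ₑ ^ 2 := by
  rw [← lint_sl]
  refine lintegral_congr_ae ?_
  filter_upwards [sl_coe F] with y hy
  rw [enorm_sq]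
  refine lintegral_congr_ae ?_
  filter_upwards [hy] with x hx
  rw [hx]

lemma ell_adj (a : Lp ℂ 2 μ) (F : Lp ℂ 2 (μ.prod ν)) :
    ContinuousLinearMap.adjoint (ell ν a) F =ᵐ[ν] fun y => ⟪a, sl F y⟫ := by
  let k : Y → ℂ := fun y => ∫ x, F (x, y) * (starRingEnd ℂ) (a x) ∂μ
  have hint : StronglyMeasurable (fun p : X × Y => F p * (starRingEnd ℂ) (a p.1)) :=
    ((lp_meas F).mul (Complex.continuous_conj.measurable.comp ((lp_meas a).comp measurable_fst))).stronglyMeasurable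
  have hkm : Measurable k := (hint.integral_prod_left').measurable
  have hk : ∀ᵐ y ∂ν, ⟪a, sl F y⟫ = k y := by
    filter_upwards [sl_coe F] with y hy
    rw [inner_eq]
    refine integral_congr_ae ?_
    filter_upwards [hy] with x hx
    rw [hx]
  have hkL : MemLp k 2 ν := by
    rw [memLp_iff hkm]
    refine lt_of_le_of_lt (b := ∫⁻ y, ‖a‖ₑ ^ 2 * ‖sl F y‖ₑ ^ 2 ∂ν) ?_ ?_
    · refine lintegral_mono_ae ?_
      filter_upwards [hk] with y hy
      rw [← hy, ← mul_pow]
      gcongr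
      rw [← ofReal_norm, ← ofReal_norm, ← ofReal_norm, ← ENNReal.ofReal_mul (norm_nonneg _)]
      exact ENNReal.ofReal_le_ofReal (norm_inner_le_norm _ _)
    · rw [lintegral_const_mul' _ _ (by simp), sl_norm]
      exact ENNReal.mul_lt_top (by simp) (by simp)
  have e : ContinuousLinearMap.adjoint (ell ν a) F = hkL.toLp := by
    refine ext_inner_left ℂ fun w => ?_
    rw [ContinuousLinearMap.adjoint_inner_right, inner_eq, inner_eq]
    have h1 : (fun p => F p * (starRingEnd ℂ) ((ell ν a w) p)) =ᵐ[μ.prod ν]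
        fun p => F p * (starRingEnd ℂ) (a p.1) * (starRingEnd ℂ) (w p.2) := by
      filter_upwards [ell_coe a w] with p hp
      rw [hp, map_mul, mul_assoc]
    have h2 := (integrable_inner (ell ν a w) F).congr h1
    rw [integral_congr_ae h1, integral_prod_symm _ h2]
    refine integral_congr_ae ?_
    filter_upwards [hkL.coeFn_toLp] with y hy
    rw [hy, integral_mul_const]
  rw [e]
  filter_upwards [hk, hkL.coeFn_toLp] with y h1 h2
  rw [h2, h1]

lemma bessel_en {H ι : Type} [NormedAddCommGroup H] [InnerProductSpace ℂ H] {e : ι → H} (he : Orthonormal ℂ e)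
    (x : H) : ∑' i, ‖⟪e i, x⟫‖ₑ ^ 2 ≤ ‖x‖ₑ ^ 2 := by
  have h1 := he.tsum_inner_products_le x
  have h2 := ENNReal.ofReal_le_ofReal h1
  rw [ENNReal.ofReal_tsum_of_nonneg (fun i => by positivity) (he.inner_products_summable x),
    ENNReal.ofReal_pow (norm_nonneg _), ofReal_norm] at h2
  simpa [ENNReal.ofReal_pow, ofReal_norm] using h2

variable {ι : Type} [Countable ι]

lemma bessel {e : ι → Lp ℂ 2 μ} (he : Orthonormal ℂ e) (F : Lp ℂ 2 (μ.prod ν)) :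
    SqB (fun i => ContinuousLinearMap.adjoint (ell ν (e i)) F) ‖F‖ := by
  refine ⟨norm_nonneg _, ?_⟩
  simp_rw [enorm_sq]
  rw [← lintegral_tsum fun i => ((lp_meas _).enorm.pow_const 2).aemeasurable,
    ENNReal.ofReal_pow (norm_nonneg _), ofReal_norm, ← sl_norm]
  refine lintegral_mono_ae ?_
  filter_upwards [ae_all_iff.2 fun i => ell_adj (e i) F] with y hy
  simp_rw [hy]
  exact bessel_en he _

lemma ell_adj_ell (a b : Lp ℂ 2 μ) (w : Lp ℂ 2 ν) :
    ContinuousLinearMap.adjoint (ell ν b) (ell ν a w) = ⟪b, a⟫ • w := by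
  refine ext_inner_left ℂ fun w' => ?_
  rw [ContinuousLinearMap.adjoint_inner_right, inner_smul_right, inner_eq, inner_eq, inner_eq]
  have h1 : (fun p => (ell ν a w) p * (starRingEnd ℂ) ((ell ν b w') p)) =ᵐ[μ.prod ν]
        fun p => (a p.1 * (starRingEnd ℂ) (b p.1)) * (w p.2 * (starRingEnd ℂ) (w' p.2)) := by
    filter_upwards [ell_coe a w, ell_coe b w'] with p hp hp'
    rw [hp, hp', map_mul]; ring
  rw [integral_congr_ae h1, integral_prod_mul (fun x => a x * (starRingEnd ℂ) (b x)) (fun y => w y * (starRingEnd ℂ) (w' y))]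

lemma ell_norm (a : Lp ℂ 2 μ) : ‖ell ν a‖ ≤ ‖a‖ := wcomp_norm _

variable {Y' : Type} [MeasurableSpace Y'] {ν' : Measure Y'} [SigmaFinite ν']

lemma exists_amp {e : ι → Lp ℂ 2 μ} (he : Orthonormal ℂ e) (R : Lp ℂ 2 ν →L[ℂ] Lp ℂ 2 ν') :
    ∃ T : Lp ℂ 2 (μ.prod ν) →L[ℂ] Lp ℂ 2 (μ.prod ν'), ‖T‖ ≤ ‖R‖ ∧ ∀ g f, ⟪g, T f⟫ =
      ∑' i, ⟪ContinuousLinearMap.adjoint (ell ν' (e i)) g, R (ContinuousLinearMap.adjoint (ell ν (e i)) f)⟫ := by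
  have hs : ∀ (g : Lp ℂ 2 (μ.prod ν')) (f : Lp ℂ 2 (μ.prod ν)), Summable fun i =>
      ⟪ContinuousLinearMap.adjoint (ell ν' (e i)) g, R (ContinuousLinearMap.adjoint (ell ν (e i)) f)⟫ :=
    fun g f => (bessel he f).sqs.summable_inner (bessel he g).sqs R
  refine exists_op _ ‖R‖ (norm_nonneg _) ?_ ?_ ?_ ?_ ?_
  · intro g f f'
    simp only [map_add, inner_add_right]
    exact (hs g f).tsum_add (hs g f')
  · intro g c f
    simp only [map_smul, inner_smul_right]
    exact tsum_mul_left
  · intro g g' f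
    simp only [map_add, inner_add_left]
    exact (hs g f).tsum_add (hs g' f)
  · intro c g f
    simp only [map_smul, inner_smul_left]
    exact tsum_mul_left
  · intro g f
    exact (bessel he f).cs (bessel he g) R

def amp {e : ι → Lp ℂ 2 μ} (he : Orthonormal ℂ e) (R : Lp ℂ 2 ν →L[ℂ] Lp ℂ 2 ν') :
    Lp ℂ 2 (μ.prod ν) →L[ℂ] Lp ℂ 2 (μ.prod ν') := (exists_amp he R).choose

lemma amp_norm {e : ι → Lp ℂ 2 μ} (he : Orthonormal ℂ e) (R : Lp ℂ 2 ν →L[ℂ] Lp ℂ 2 ν') : ‖amp he R‖ ≤ ‖R‖ :=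
  (exists_amp he R).choose_spec.1

lemma amp_inner {e : ι → Lp ℂ 2 μ} (he : Orthonormal ℂ e) (R : Lp ℂ 2 ν →L[ℂ] Lp ℂ 2 ν') (g : Lp ℂ 2 (μ.prod ν'))
    (f : Lp ℂ 2 (μ.prod ν)) : ⟪g, amp he R f⟫ =
      ∑' i, ⟪ContinuousLinearMap.adjoint (ell ν' (e i)) g, R (ContinuousLinearMap.adjoint (ell ν (e i)) f)⟫ :=
  (exists_amp he R).choose_spec.2 g f

lemma amp_ell (e : HilbertBasis ι ℂ (Lp ℂ 2 μ)) (R : Lp ℂ 2 ν →L[ℂ] Lp ℂ 2 ν') (a b : Lp ℂ 2 μ)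
    (w : Lp ℂ 2 ν) (w' : Lp ℂ 2 ν') :
    ⟪ell ν' b w', amp e.orthonormal R (ell ν a w)⟫ = ⟪b, a⟫ * ⟪w', R w⟫ := by
  rw [amp_inner]
  simp only [ell_adj_ell, map_smul, inner_smul_left, inner_smul_right]
  rw [← e.tsum_inner_mul_inner, ← tsum_mul_right]
  refine tsum_congr fun i => ?_
  rw [inner_conj_symm]; ring

end Tens
end OpSynthAux

namespace OpSynthAux
open Filter Topology ENNReal
section Disint
open ProbabilityTheory
variable {Z E X X₂ : Type} [MeasurableSpace Z] [MeasurableSpace E] [MeasurableSpace X] [MeasurableSpace X₂]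

structure Fib (m : Measure Z) (K : Kernel Z E) (μ : Measure X) (F : X → Z) (r : X → ℂ) (φ : E → X) (w : E → ℂ) : Prop where
  mF : Measurable F
  mr : Measurable r
  mφ : Measurable φ
  mw : Measurable w
  hl : ∀ f : Z × X → ℝ≥0∞, Measurable f →
    ∫⁻ p, ‖w p.2‖ₑ ^ 2 * f (p.1, φ p.2) ∂(m ⊗ₘ K) = ∫⁻ x, f (F x, x) ∂μ
  hi : ∀ f : Z × X → ℂ, Measurable f → Integrable (fun x => r x * f (F x, x)) μ →
    Integrable (fun p : Z × E => w p.2 * f (p.1, φ p.2)) (m ⊗ₘ K) ∧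
    ∫ p, w p.2 * f (p.1, φ p.2) ∂(m ⊗ₘ K) = ∫ x, r x * f (F x, x) ∂μ
  dom : Dom μ m F r 1
  rr : ∀ x, (starRingEnd ℂ) (r x) = r x
  ww : MemLp r 2 μ

variable {m : Measure Z} [IsFiniteMeasure m] {K : Kernel Z E} [IsMarkovKernel K] {μ : Measure X} {μ₂ : Measure X₂}
  {F : X → Z} {r : X → ℂ} {φ : E → X} {w : E → ℂ}
  {F₂ : X₂ → Z} {r₂ : X₂ → ℂ} {φ₂ : E → X₂} {w₂ : E → ℂ}

lemma Fib.int (h : Fib m K μ F r φ w) (a : Lp ℂ 2 μ) : Integrable (fun x => r x * a x) μ := by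
  exact MemLp.integrable_mul (p := 2) (q := 2) h.ww (Lp.memLp a)

lemma Fib.adj (h : Fib m K μ F r φ w) (a : Lp ℂ 2 μ) :
    ContinuousLinearMap.adjoint (wcomp h.dom) a =ᵐ[m] fun z => ∫ e, w e * a (φ e) ∂(K z) := by
  have hint := (h.hi (fun p => a p.2) ((lp_meas a).comp measurable_snd) (h.int a)).1
  have hint2 : Integrable (fun z => ∫ e, w e * a (φ e) ∂(K z)) m := by
    have h3 := ((Measure.integrable_compProd_iff (μ := m) (κ := K) (f := fun p : Z × E => w p.2 * a (φ p.2)) hint.1).1 hint).2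
    refine h3.mono ?_ (Eventually.of_forall fun z => ?_)
    · exact (((h.mw.mul ((lp_meas a).comp h.mφ)).comp measurable_snd).stronglyMeasurable.integral_kernel_prod_right' (κ := K)).aestronglyMeasurable
    · exact (norm_integral_le_integral_norm _).trans (le_abs_self _)
  have hint1 : Integrable (ContinuousLinearMap.adjoint (wcomp h.dom) a) m :=
    (Lp.memLp _).integrable (by norm_num)
  refine Integrable.ae_eq_of_forall_setIntegral_eq _ _ hint1 hint2 fun I hI _ => ?_
  rw [← L2.inner_indicatorConstLp_one (𝕜 := ℂ) hI (measure_ne_top m I),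
    ContinuousLinearMap.adjoint_inner_right, inner_eq]
  have e1 : ∫ x, a x * (starRingEnd ℂ) (wcomp h.dom (indicatorConstLp 2 hI (measure_ne_top m I) 1) x) ∂μ
      = ∫ x, r x * (I.indicator 1 (F x) * a x) ∂μ := by
    refine integral_congr_ae ?_
    have h1 := h.dom.ae (indicatorConstLp_coeFn (p := 2) (hs := hI) (hμs := measure_ne_top m I) (c := (1:ℂ)))
    filter_upwards [wcomp_coe h.dom (indicatorConstLp 2 hI (measure_ne_top m I) 1), h1] with x hx hx1
    rw [hx]
    rcases hx1 with h0 | h0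
    · simp [h0]
    · rw [h0, map_mul, h.rr]
      by_cases hh : F x ∈ I <;> simp [hh]; ring
  have hm : Measurable fun p : Z × X => I.indicator (1 : Z → ℂ) p.1 * a p.2 :=
    ((measurable_one.indicator hI).comp measurable_fst).mul ((lp_meas a).comp measurable_snd)
  have h2 := h.hi _ hm (by
    refine (h.int a).mono ((h.mr.mul (hm.comp (h.mF.prodMk measurable_id))).aestronglyMeasurable) ?_
    refine Eventually.of_forall fun x => ?_
    by_cases hh : F x ∈ I <;> simp [hh]; positivity)
  rw [e1, ← h2.2, Measure.integral_compProd h2.1, ← integral_indicator hI]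
  refine integral_congr_ae (Eventually.of_forall fun z => ?_)
  by_cases hh : z ∈ I <;> simp [hh]

lemma Fib.dom1 (h : Fib m K μ F r φ w) :
    Dom (m ⊗ₘ (K ×ₖ K)) μ (fun p => φ p.2.1) (fun p => w p.2.1) 1 := by
  refine ⟨h.mφ.comp (measurable_fst.comp measurable_snd), h.mw.comp (measurable_fst.comp measurable_snd),
    zero_le_one, fun f hf => ?_⟩
  have hg : Measurable fun e => ‖w e‖ₑ ^ 2 * f (φ e) := (h.mw.enorm.pow_const 2).mul (hf.comp h.mφ)
  have h1 := h.hl (fun p => f p.2) (hf.comp measurable_snd)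
  simp only at h1
  have e1 := Measure.lintegral_compProd (μ := m) (κ := K ×ₖ K) (f := fun p => ‖w p.2.1‖ₑ ^ 2 * f (φ p.2.1)) (hg.comp (measurable_fst.comp measurable_snd))
  have e2 := Measure.lintegral_compProd (μ := m) (κ := K) (f := fun p => ‖w p.2‖ₑ ^ 2 * f (φ p.2)) (hg.comp measurable_snd)
  rw [← h1, e1, e2]
  simp only [one_pow, ofReal_one, one_mul]
  refine le_of_eq (lintegral_congr fun z => ?_)
  have e3 := Kernel.lintegral_prod K K z (hg.comp measurable_fst)
  refine e3.trans ?_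
  simp

lemma Fib.dom2 (h : Fib m K μ F r φ w) :
    Dom (m ⊗ₘ (K ×ₖ K)) μ (fun p => φ p.2.2) (fun p => w p.2.2) 1 := by
  refine ⟨h.mφ.comp (measurable_snd.comp measurable_snd), h.mw.comp (measurable_snd.comp measurable_snd),
    zero_le_one, fun f hf => ?_⟩
  have hg : Measurable fun e => ‖w e‖ₑ ^ 2 * f (φ e) := (h.mw.enorm.pow_const 2).mul (hf.comp h.mφ)
  have h1 := h.hl (fun p => f p.2) (hf.comp measurable_snd)
  simp only at h1
  have e1 := Measure.lintegral_compProd (μ := m) (κ := K ×ₖ K) (f := fun p => ‖w p.2.2‖ₑ ^ 2 * f (φ p.2.2)) (hg.comp (measurable_snd.comp measurable_snd))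
  have e2 := Measure.lintegral_compProd (μ := m) (κ := K) (f := fun p => ‖w p.2‖ₑ ^ 2 * f (φ p.2)) (hg.comp measurable_snd)
  rw [← h1, e1, e2]
  simp only [one_pow, ofReal_one, one_mul]
  refine le_of_eq (lintegral_congr fun z => ?_)
  have e3 := Kernel.lintegral_prod K K z (hg.comp measurable_snd)
  refine e3.trans ?_
  simp

lemma Fib.ae (h : Fib m K μ F r φ w) (hZ : MeasurableEq Z) :
    ∀ᵐ p ∂(m ⊗ₘ K), w p.2 = 0 ∨ F (φ p.2) = p.1 := by
  have hm : MeasurableSet {p : Z × X | F p.2 ≠ p.1} :=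
    (measurableSet_eq_fun (h.mF.comp measurable_snd) measurable_fst).compl
  have h1 := h.hl ({p : Z × X | F p.2 ≠ p.1}.indicator 1) (measurable_one.indicator hm)
  have h2 : ∫⁻ x, ({p : Z × X | F p.2 ≠ p.1}.indicator 1 (F x, x) : ℝ≥0∞) ∂μ = 0 := by simp
  rw [h2, lintegral_eq_zero_iff] at h1
  · filter_upwards [h1] with p hp
    by_contra hc
    push Not at hc
    simp [hc.1, hc.2] at hp
  · exact ((h.mw.comp measurable_snd).enorm.pow_const 2).mul ((measurable_one.indicator hm).comp
      (measurable_fst.prodMk (h.mφ.comp measurable_snd)))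

lemma Fib.comp (h : Fib m K μ F r φ w) (h' : Fib m K μ₂ F₂ r₂ φ₂ w₂) :
    (wcomp h'.dom).comp (ContinuousLinearMap.adjoint (wcomp h.dom)) =
      (ContinuousLinearMap.adjoint (wcomp h'.dom2)).comp (wcomp h.dom1) := by
  ext1 a
  refine ext_inner_left ℂ fun b => ?_
  simp only [ContinuousLinearMap.comp_apply]
  rw [ContinuousLinearMap.adjoint_inner_right, ← ContinuousLinearMap.adjoint_inner_left, inner_eq, inner_eq]
  have hi := integrable_inner (wcomp h'.dom2 b) (wcomp h.dom1 a)
  have e0 : (fun p => wcomp h.dom1 a p * (starRingEnd ℂ) (wcomp h'.dom2 b p)) =ᵐ[m ⊗ₘ (K ×ₖ K)]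
      fun p => (w p.2.1 * a (φ p.2.1)) * (starRingEnd ℂ) (w₂ p.2.2 * b (φ₂ p.2.2)) := by
    filter_upwards [wcomp_coe h.dom1 a, wcomp_coe h'.dom2 b] with p h1 h2
    rw [h1, h2]
  rw [integral_congr_ae e0, Measure.integral_compProd (hi.congr e0)]
  refine integral_congr_ae ?_
  filter_upwards [h.adj a, h'.adj b] with z h1 h2
  rw [h1, h2, Kernel.prod_apply]
  rw [integral_prod_mul (fun e => w e * a (φ e)) (fun e => (starRingEnd ℂ) (w₂ e * b (φ₂ e))), integral_conj]

lemma Fib.nn [SigmaFinite μ] [SigmaFinite μ₂] (h : Fib m K μ F r φ w) (h' : Fib m K μ₂ F₂ r₂ φ₂ w₂) (hZ : MeasurableEq Z) :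
    (wcomp h'.dom).comp (ContinuousLinearMap.adjoint (wcomp h.dom)) ∈ NN μ μ₂ {p | F p.1 = F₂ p.2} := by
  rw [h.comp h']
  refine tpi_mem _ _ ?_
  have a1 := h.ae hZ
  have a2 := h'.ae hZ
  have a1' : ∀ᵐ p ∂(m ⊗ₘ (K ×ₖ K)), w p.2.1 = 0 ∨ F (φ p.2.1) = p.1 := by
    rw [Measure.ae_compProd_iff] 
    · have := (Measure.ae_compProd_iff ?_).1 a1
      · filter_upwards [this] with z hz
        rw [Kernel.prod_apply]
        exact Measure.quasiMeasurePreserving_fst.ae hz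
      · exact (measurableSet_eq_fun (h.mw.comp measurable_snd) measurable_const).union
          (measurableSet_eq_fun (h.mF.comp (h.mφ.comp measurable_snd)) measurable_fst)
    · exact (measurableSet_eq_fun (h.mw.comp (measurable_fst.comp measurable_snd)) measurable_const).union
          (measurableSet_eq_fun (h.mF.comp (h.mφ.comp (measurable_fst.comp measurable_snd))) measurable_fst)
  have a2' : ∀ᵐ p ∂(m ⊗ₘ (K ×ₖ K)), w₂ p.2.2 = 0 ∨ F₂ (φ₂ p.2.2) = p.1 := by
    rw [Measure.ae_compProd_iff] 
    · have := (Measure.ae_compProd_iff ?_).1 a2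
      · filter_upwards [this] with z hz
        rw [Kernel.prod_apply]
        exact Measure.quasiMeasurePreserving_snd.ae hz
      · exact (measurableSet_eq_fun (h'.mw.comp measurable_snd) measurable_const).union
          (measurableSet_eq_fun (h'.mF.comp (h'.mφ.comp measurable_snd)) measurable_fst)
    · exact (measurableSet_eq_fun (h'.mw.comp (measurable_snd.comp measurable_snd)) measurable_const).union
          (measurableSet_eq_fun (h'.mF.comp (h'.mφ.comp (measurable_snd.comp measurable_snd))) measurable_fst)
  filter_upwards [a1', a2'] with p h1 h2
  rcases h1 with h1 | h1
  · exact Or.inl h1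
  rcases h2 with h2 | h2
  · exact Or.inr (Or.inl h2)
  · exact Or.inr (Or.inr (h1.trans h2.symm))
end Disint
end OpSynthAux

namespace OpSynthAux
open Filter Topology ENNReal
section Disint2
open ProbabilityTheory
variable {Z E X X₁ X₂ : Type} [MeasurableSpace Z] [MeasurableSpace E] [MeasurableSpace X] [MeasurableSpace X₁] [MeasurableSpace X₂]

def dens (s : X → ℝ) (x : X) : NNReal := ‖(s x : ℂ)‖₊ ^ 2

lemma dens_meas {s : X → ℝ} (hs : Measurable s) : Measurable (dens s) := by
  unfold dens; fun_prop

lemma dens_coe (s : X → ℝ) (x : X) : (dens s x : ℝ≥0∞) = ‖(s x : ℂ)‖ₑ ^ 2 := by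
  simp [dens, enorm_eq_nnnorm]

lemma fib_aux {m : Measure Z} {K : Kernel Z E} {μ : Measure X} {F : X → Z} {s : X → ℝ} {φ : E → X} {w : E → ℂ}
    {j : X → E} {σ' : Measure (Z × E)} (hF : Measurable F) (hs : Measurable s) (hpos : ∀ x, 0 < s x)
    (hfin : ∫⁻ x, ‖(s x : ℂ)‖ₑ ^ 2 ∂μ ≤ 1) (hφ : Measurable φ) (hw : Measurable w) (hj : Measurable j)
    (e1 : ∀ x, φ (j x) = x) (e2 : ∀ x, w (j x) = ((s x : ℂ))⁻¹) (e3 : ∀ᵐ p ∂σ', w p.2 = 0)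
    (hσ : m ⊗ₘ K = (μ.withDensity fun x => (dens s x : ℝ≥0∞)).map (fun x => (F x, j x)) + σ')
    (hm : m = (m ⊗ₘ K).fst) :
    Fib m K μ F (fun x => (s x : ℂ)) φ w := by
  have hFj : Measurable fun x => (F x, j x) := hF.prodMk hj
  have hd : Measurable fun x => (dens s x : ℝ≥0∞) := (dens_meas hs).coe_nnreal_ennreal
  have hne : ∀ x, (s x : ℂ) ≠ 0 := fun x => by exact_mod_cast (hpos x).ne'
  have hsC : Measurable fun x => (s x : ℂ) := Complex.measurable_ofReal.comp hs
  refine ⟨hF, hsC, hφ, hw, fun f hf => ?_, fun f hf hfi => ?_, ⟨hF, hsC, zero_le_one, fun f hf => ?_⟩,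
    fun x => Complex.conj_ofReal _, (memLp_iff hsC).2 (hfin.trans_lt one_lt_top)⟩
  · have hg : Measurable fun p : Z × E => ‖w p.2‖ₑ ^ 2 * f (p.1, φ p.2) := by fun_prop
    have e0 := lintegral_withDensity_eq_lintegral_mul μ hd (g := fun x => ‖w (j x)‖ₑ ^ 2 * f (F x, φ (j x))) (hg.comp hFj)
    rw [hσ, lintegral_add_measure, lintegral_map hg hFj]
    simp only
    rw [e0]
    have : ∫⁻ p, ‖w p.2‖ₑ ^ 2 * f (p.1, φ p.2) ∂σ' = 0 := by
      rw [lintegral_eq_zero_iff hg]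
      filter_upwards [e3] with p hp
      simp [hp]
    rw [this, add_zero]
    refine lintegral_congr fun x => ?_
    simp only [Pi.mul_apply, Function.comp, dens_coe, e1, e2]
    rw [← mul_assoc, ← mul_pow, ← enorm_mul, mul_inv_cancel₀ (hne x)]
    simp
  · have hg : Measurable fun p : Z × E => w p.2 * f (p.1, φ p.2) := by fun_prop
    have e4 : ∀ x, dens s x • (w (j x) * f (F x, φ (j x))) = (s x : ℂ) * f (F x, x) := fun x => by
      rw [e1, e2]
      have : ((dens s x : ℝ) : ℂ) = (s x : ℂ) ^ 2 := by
        simp [dens]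
      rw [NNReal.smul_def, Complex.real_smul, this]
      field_simp [hne x]
    have e5 : (fun p : Z × E => w p.2 * f (p.1, φ p.2)) =ᵐ[σ'] 0 := by
      filter_upwards [e3] with p hp
      simp [hp]
    have i2 : Integrable (fun p : Z × E => w p.2 * f (p.1, φ p.2)) σ' := (integrable_zero _ _ _).congr e5.symm
    have i1 : Integrable (fun p : Z × E => w p.2 * f (p.1, φ p.2))
        ((μ.withDensity fun x => (dens s x : ℝ≥0∞)).map (fun x => (F x, j x))) := by
      rw [integrable_map_measure hg.aestronglyMeasurable hFj.aemeasurable,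
        integrable_withDensity_iff_integrable_smul (dens_meas hs)]
      simpa only [Function.comp, e4] using hfi
    rw [hσ]
    refine ⟨i1.add_measure i2, ?_⟩
    rw [integral_add_measure i1 i2, integral_map hFj.aemeasurable hg.aestronglyMeasurable,
      integral_withDensity_eq_integral_smul (dens_meas hs), integral_congr_ae e5]
    simp only [e4, Pi.zero_apply, integral_zero, add_zero]
  · have : ∫⁻ z, f z ∂m = ∫⁻ p, f p.1 ∂(m ⊗ₘ K) := by
      conv_lhs => rw [hm]
      rw [Measure.fst, lintegral_map hf measurable_fst]
    rw [this, hσ, lintegral_add_measure, lintegral_map (f := fun p : Z × E => f p.1) (hf.comp measurable_fst) hFj]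
    have hfF : Measurable fun x => f (F x) := hf.comp hF
    rw [lintegral_withDensity_eq_lintegral_mul _ hd hfF]
    simp only [one_pow, ofReal_one, one_mul, Pi.mul_apply, dens_coe]
    exact le_self_add

lemma exists_fib [StandardBorelSpace X₁] [StandardBorelSpace X₂] [Nonempty X₁] [Nonempty X₂]
    (μ₁ : Measure X₁) (μ₂ : Measure X₂) [SigmaFinite μ₁] [SigmaFinite μ₂] {F : X₁ → Z} {G : X₂ → Z}
    (hF : Measurable F) (hG : Measurable G) :
    ∃ (m : Measure Z) (_ : IsFiniteMeasure m) (K : Kernel Z (Bool × X₁ × X₂)) (_ : IsMarkovKernel K)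
      (s₁ : X₁ → ℝ) (s₂ : X₂ → ℝ) (φ₁ : _) (φ₂ : _) (w₁ : _) (w₂ : _), 
      (∀ x, 0 < s₁ x) ∧ (∀ x, 0 < s₂ x) ∧
      Fib m K μ₁ F (fun x => (s₁ x : ℂ)) φ₁ w₁ ∧ Fib m K μ₂ G (fun x => (s₂ x : ℂ)) φ₂ w₂ := by
  obtain ⟨s₁, hs₁, hp₁, hf₁⟩ := exists_wt μ₁
  obtain ⟨s₂, hs₂, hp₂, hf₂⟩ := exists_wt μ₂
  obtain ⟨d₁⟩ := ‹Nonempty X₁›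
  obtain ⟨d₂⟩ := ‹Nonempty X₂›
  haveI : Nonempty (Bool × X₁ × X₂) := ⟨(true, d₁, d₂)⟩
  set j₁ : X₁ → Bool × X₁ × X₂ := fun x => (true, x, d₂) with hj₁
  set j₂ : X₂ → Bool × X₁ × X₂ := fun x => (false, d₁, x) with hj₂
  have mj₁ : Measurable j₁ := by fun_prop
  have mj₂ : Measurable j₂ := by fun_prop
  set σ₁ := (μ₁.withDensity fun x => (dens s₁ x : ℝ≥0∞)).map (fun x => (F x, j₁ x)) with hσ₁
  set σ₂ := (μ₂.withDensity fun x => (dens s₂ x : ℝ≥0∞)).map (fun x => (G x, j₂ x)) with hσ₂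
  haveI : IsFiniteMeasure (μ₁.withDensity fun x => (dens s₁ x : ℝ≥0∞)) :=
    isFiniteMeasure_withDensity (by simp only [dens_coe]; exact (hf₁.trans_lt one_lt_top).ne)
  haveI : IsFiniteMeasure (μ₂.withDensity fun x => (dens s₂ x : ℝ≥0∞)) :=
    isFiniteMeasure_withDensity (by simp only [dens_coe]; exact (hf₂.trans_lt one_lt_top).ne)
  haveI : IsFiniteMeasure σ₁ := by rw [hσ₁]; infer_instance
  haveI : IsFiniteMeasure σ₂ := by rw [hσ₂]; infer_instance
  have hdis : (σ₁ + σ₂).fst ⊗ₘ (σ₁ + σ₂).condKernel = σ₁ + σ₂ := Measure.disintegrate _ _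
  have hB : MeasurableSet {e : Bool × X₁ × X₂ | e.1 = true} := measurable_fst (measurableSet_singleton true)
  refine ⟨(σ₁ + σ₂).fst, inferInstance, (σ₁ + σ₂).condKernel, inferInstance, s₁, s₂, fun e => e.2.1, fun e => e.2.2,
    {e : Bool × X₁ × X₂ | e.1 = true}.indicator fun e => ((s₁ e.2.1 : ℂ))⁻¹,
    {e : Bool × X₁ × X₂ | e.1 = true}ᶜ.indicator fun e => ((s₂ e.2.2 : ℂ))⁻¹, hp₁, hp₂, ?_, ?_⟩
  · refine fib_aux (j := j₁) (σ' := σ₂) hF hs₁ hp₁ hf₁ (by fun_prop)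
      (Measurable.indicator (by fun_prop) hB) mj₁ (fun x => rfl) (fun x => by simp [hj₁]) ?_ hdis (by rw [hdis])
    rw [hσ₂, ae_map_iff (hG.prodMk mj₂).aemeasurable]
    · exact Eventually.of_forall fun x => by simp [hj₂]
    · exact measurableSet_eq_fun ((Measurable.indicator (by fun_prop) hB).comp measurable_snd) measurable_const
  · refine fib_aux (j := j₂) (σ' := σ₁) hG hs₂ hp₂ hf₂ (by fun_prop)
      (Measurable.indicator (by fun_prop) hB.compl) mj₂ (fun x => rfl) (fun x => by simp [hj₂]) ?_ (by rw [hdis, add_comm]) (by rw [hdis])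
    rw [hσ₁, ae_map_iff (hF.prodMk mj₁).aemeasurable]
    · exact Eventually.of_forall fun x => by simp [hj₁]
    · exact measurableSet_eq_fun ((Measurable.indicator (by fun_prop) hB.compl).comp measurable_snd) measurable_const
end Disint2
end OpSynthAux

namespace OpSynthAux
open Filter Topology ENNReal
section Amp
variable {Z X X₁ X₂ Y Y₁ Y₂ : Type} [MeasurableSpace Z] [MeasurableSpace X] [MeasurableSpace X₁] [MeasurableSpace X₂]
  [MeasurableSpace Y] [MeasurableSpace Y₁] [MeasurableSpace Y₂]

/-- the flipped product of two sets -/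
def pr (D : Set (X₁ × X₂)) (L : Set (Y₁ × Y₂)) : Set ((X₁ × Y₁) × (X₂ × Y₂)) :=
  {p | (p.1.1, p.2.1) ∈ D ∧ (p.1.2, p.2.2) ∈ L}

lemma wcomp_mulOp {P : Measure X} {μ : Measure Z} {φ : X → Z} {w : X → ℂ} {C : ℝ} (h : Dom P μ φ w C)
    {u : Z → ℂ} (hu : BM u) (hu' : BM fun x => u (φ x)) (a : Lp ℂ 2 μ) :
    wcomp h (mulOp μ u a) = mulOp P (fun x => u (φ x)) (wcomp h a) := by
  refine Lp.ext ?_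
  filter_upwards [wcomp_coe h (mulOp μ u a), wcomp_coe h a, h.ae (mulOp_coe hu a), mulOp_coe hu' (wcomp h a)]
    with x h1 h2 h3 h4
  rw [h1, h4, h2]
  rcases h3 with h3 | h3
  · simp [h3]
  · rw [h3]; ring

lemma BM.comp {u : Z → ℂ} (hu : BM u) {φ : X → Z} (hφ : Measurable φ) : BM fun x => u (φ x) :=
  ⟨hu.1.comp hφ, hu.2.imp fun C hC x => hC _⟩

lemma adj_mulOp {P : Measure X} {μ : Measure Z} {φ : X → Z} {w : X → ℂ} {C : ℝ} (h : Dom P μ φ w C)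
    {u : Z → ℂ} (hu : BM u) (f : Lp ℂ 2 P) :
    ContinuousLinearMap.adjoint (wcomp h) (mulOp P (fun x => u (φ x)) f) =
      mulOp μ u (ContinuousLinearMap.adjoint (wcomp h) f) := by
  refine ext_inner_left ℂ fun g => ?_
  rw [ContinuousLinearMap.adjoint_inner_right, inner_mulOp (hu.comp h.1), inner_mulOp hu,
    ContinuousLinearMap.adjoint_inner_right, wcomp_mulOp h hu.conj (hu.conj.comp h.1)]

lemma hat {μ : Measure X} {m : Measure Z} {F : X → Z} {r : X → ℂ} (h : Dom μ m F r 1) (ν : Measure Y)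
    [SigmaFinite μ] [SigmaFinite m] [SigmaFinite ν] :
    Dom (μ.prod ν) (m.prod ν) (fun p => (F p.1, p.2)) (fun p => r p.1) 1 := by
  have hF := h.1
  have hr := h.2.1
  refine ⟨by fun_prop, by fun_prop, zero_le_one, fun f hf => ?_⟩
  rw [lintegral_prod_symm _ (by fun_prop), lintegral_prod_symm _ hf.aemeasurable]
  simp only [one_pow, ofReal_one, one_mul]
  refine lintegral_mono fun y => ?_
  have := h.2.2.2 (fun z => f (z, y)) (by fun_prop)
  simpa using this

variable {m : Measure Z} {μ : Measure X} {ν : Measure Y} [SigmaFinite m] [SigmaFinite μ] [SigmaFinite ν]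

lemma hat_ell {F : X → Z} {r : X → ℂ} (h : Dom μ m F r 1) (a : Lp ℂ 2 m) (w : Lp ℂ 2 ν) :
    wcomp (hat h ν) (ell ν a w) = ell ν (wcomp h a) w := by
  refine Lp.ext ?_
  filter_upwards [wcomp_coe (hat h ν) (ell ν a w), (hat h ν).ae (ell_coe a w), ell_coe (wcomp h a) w,
    Measure.quasiMeasurePreserving_fst.ae (wcomp_coe h a)] with p h1 h2 h3 h4
  rw [h1, h3, h4]
  rcases h2 with h2 | h2
  · simp [h2]
  · rw [h2]; ring

lemma adj_hat {F : X → Z} {r : X → ℂ} (h : Dom μ m F r 1) (a : Lp ℂ 2 m) (f : Lp ℂ 2 (μ.prod ν)) :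
    ContinuousLinearMap.adjoint (ell ν a) (ContinuousLinearMap.adjoint (wcomp (hat h ν)) f) =
    ContinuousLinearMap.adjoint (ell ν (wcomp h a)) f := by
  refine ext_inner_left ℂ fun w => ?_
  rw [ContinuousLinearMap.adjoint_inner_right, ContinuousLinearMap.adjoint_inner_right,
    ContinuousLinearMap.adjoint_inner_right, hat_ell]

lemma sl_sqs {ι : Type} [Countable ι] {F : ι → Lp ℂ 2 (μ.prod ν)} (h : SqS F) : ∀ᵐ y ∂ν, SqS fun i => sl (F i) y := by
  have hm : ∀ i, AEMeasurable (fun y => ‖sl (F i) y‖ₑ ^ 2) ν := fun i => by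
    refine AEMeasurable.congr (f := fun y => ∫⁻ x, ‖F i (x, y)‖ₑ ^ 2 ∂μ) ?_ ?_
    · exact (Measurable.lintegral_prod_left' (f := fun p => ‖F i p‖ₑ ^ 2) ((lp_meas (F i)).enorm.pow_const 2)).aemeasurable
    · filter_upwards [sl_coe (F i)] with y hy
      rw [enorm_sq]
      refine lintegral_congr_ae ?_
      filter_upwards [hy] with x hx
      rw [hx]
  have h1 : ∫⁻ y, ∑' i, ‖sl (F i) y‖ₑ ^ 2 ∂ν < ∞ := by
    rw [lintegral_tsum hm]
    simp_rw [sl_norm]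
    have := h.tsum_ofReal_lt_top
    simpa [ENNReal.ofReal_pow, ofReal_norm] using this
  filter_upwards [ae_lt_top' (AEMeasurable.tsum hm) h1.ne] with x hx
  have h2 := ENNReal.summable_toReal hx.ne
  simpa [SqS] using h2

variable {ι : Type} [Countable ι]

lemma amp_sqs {e : ι → Lp ℂ 2 m} (he : Orthonormal ℂ e) {F : ℕ → Lp ℂ 2 (m.prod ν)} (h : SqS F) :
    SqS fun j : ℕ × ι => ContinuousLinearMap.adjoint (ell ν (e j.2)) (F j.1) := by
  have h1 : ∑' j : ℕ × ι, ‖ContinuousLinearMap.adjoint (ell ν (e j.2)) (F j.1)‖ₑ ^ 2 < ∞ := by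
    rw [ENNReal.tsum_prod (f := fun n i => ‖ContinuousLinearMap.adjoint (ell ν (e i)) (F n)‖ₑ ^ 2)]
    refine lt_of_le_of_lt (ENNReal.tsum_le_tsum fun n => (bessel he (F n)).2) ?_
    exact h.tsum_ofReal_lt_top
  have h2 := ENNReal.summable_toReal h1.ne
  simpa [SqS] using h2

variable {μ₁ : Measure X₁} {μ₂ : Measure X₂} {ν₁ : Measure Y₁} {ν₂ : Measure Y₂} [SigmaFinite μ₁] [SigmaFinite μ₂]
  [SigmaFinite ν₁] [SigmaFinite ν₂]

lemma amp_zero {F : X₁ → Z} {r : X₁ → ℂ} {G : X₂ → Z} {r' : X₂ → ℂ} (h : Dom μ₁ m F r 1) (h' : Dom μ₂ m G r' 1)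
    (e : HilbertBasis ι ℂ (Lp ℂ 2 m)) {D : Set (X₁ × X₂)} {L : Set (Y₁ × Y₂)}
    (hD : (wcomp h').comp (ContinuousLinearMap.adjoint (wcomp h)) ∈ NN μ₁ μ₂ D)
    {R : Lp ℂ 2 ν₁ →L[ℂ] Lp ℂ 2 ν₂} (hR : R ∈ NN ν₁ ν₂ L)
    {ξ : ℕ → Lp ℂ 2 (μ₁.prod ν₁)} {η : ℕ → Lp ℂ 2 (μ₂.prod ν₂)} (hξ : SqS ξ) (hη : SqS η)
    (hv : Van (pr D L) ξ η) :
    ∑' n, ⟪ContinuousLinearMap.adjoint (wcomp (hat h' ν₂)) (η n),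
      amp e.orthonormal R (ContinuousLinearMap.adjoint (wcomp (hat h ν₁)) (ξ n))⟫ = 0 := by
  set a : ℕ × ι → Lp ℂ 2 ν₁ := fun j => ContinuousLinearMap.adjoint (ell ν₁ (e j.2))
    (ContinuousLinearMap.adjoint (wcomp (hat h ν₁)) (ξ j.1)) with ha
  set b : ℕ × ι → Lp ℂ 2 ν₂ := fun j => ContinuousLinearMap.adjoint (ell ν₂ (e j.2))
    (ContinuousLinearMap.adjoint (wcomp (hat h' ν₂)) (η j.1)) with hb
  have sa : SqS a := amp_sqs e.orthonormal (F := fun n => ContinuousLinearMap.adjoint (wcomp (hat h ν₁)) (ξ n)) (hξ.map (ContinuousLinearMap.adjoint (wcomp (hat h ν₁))))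
  have sb : SqS b := amp_sqs e.orthonormal (F := fun n => ContinuousLinearMap.adjoint (wcomp (hat h' ν₂)) (η n)) (hη.map (ContinuousLinearMap.adjoint (wcomp (hat h' ν₂))))
  have key : ∑' j, ⟪b j, R (a j)⟫ = 0 := by
    refine NN_gen sa sb ?_ hR
    obtain ⟨p, q, hp, hq, hpq⟩ := van_iff.1 hv
    have hp' : ∀ᵐ y ∂ν₁, ∀ᵐ x ∂μ₁, p (x, y) :=
      Measure.ae_ae_of_ae_prod ((Measure.measurePreserving_swap (μ := ν₁) (ν := μ₁)).quasiMeasurePreserving.ae hp)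
    have hq' : ∀ᵐ y ∂ν₂, ∀ᵐ x ∂μ₂, q (x, y) :=
      Measure.ae_ae_of_ae_prod ((Measure.measurePreserving_swap (μ := ν₂) (ν := μ₂)).quasiMeasurePreserving.ae hq)
    have A5 : ∀ᵐ y ∂ν₁, ∀ j : ℕ × ι, a j y = ⟪wcomp h (e j.2), sl (ξ j.1) y⟫ := by
      refine ae_all_iff.2 fun j => ?_
      have := ell_adj (wcomp h (e j.2)) (ξ j.1)
      rw [← adj_hat] at this
      exact this
    have B5 : ∀ᵐ y ∂ν₂, ∀ j : ℕ × ι, b j y = ⟪wcomp h' (e j.2), sl (η j.1) y⟫ := by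
      refine ae_all_iff.2 fun j => ?_
      have := ell_adj (wcomp h' (e j.2)) (η j.1)
      rw [← adj_hat] at this
      exact this
    have A4 : ∀ᵐ y ∂ν₁, ∀ n, sl (ξ n) y =ᵐ[μ₁] fun x => ξ n (x, y) := ae_all_iff.2 fun n => sl_coe (ξ n)
    have B4 : ∀ᵐ y ∂ν₂, ∀ n, sl (η n) y =ᵐ[μ₂] fun x => η n (x, y) := ae_all_iff.2 fun n => sl_coe (η n)
    have A1 := sqs_pt sa
    have B1 := sqs_pt sb
    have A2 := sl_sqs hξ
    have B2 := sl_sqs hη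
    clear_value a b
    refine van_iff.2 ⟨_, _, (A1.and A2).and (hp'.and (A4.and A5)), (B1.and B2).and (hq'.and (B4.and B5)), ?_⟩
    rintro y y' ⟨⟨a1, a2⟩, a3, a4, a5⟩ ⟨⟨b1, b2⟩, b3, b4, b5⟩ hL
    have ea : ∀ n i, a (n, i) y = ⟪e i, ContinuousLinearMap.adjoint (wcomp h) (sl (ξ n) y)⟫ := fun n i => by
      rw [ContinuousLinearMap.adjoint_inner_right, ← a5 (n, i)]
    have eb : ∀ n i, (starRingEnd ℂ) (b (n, i) y') = ⟪ContinuousLinearMap.adjoint (wcomp h') (sl (η n) y'), e i⟫ := fun n i => by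
      rw [ContinuousLinearMap.adjoint_inner_left, ← inner_conj_symm, ← b5 (n, i)]
    have hs : Summable fun j => a j y * (starRingEnd ℂ) (b j y') := by
      refine Summable.of_norm ?_
      simpa [mul_comm] using a1.summable_mul b1
    have e0 : ker a b (y, y') = ∑' n, ∑' i, a (n, i) y * (starRingEnd ℂ) (b (n, i) y') := hs.tsum_prod
    rw [e0]
    have e1 : ∀ n, ∑' i, a (n, i) y * (starRingEnd ℂ) (b (n, i) y') =
        ⟪sl (η n) y', ((wcomp h').comp (ContinuousLinearMap.adjoint (wcomp h))) (sl (ξ n) y)⟫ := fun n => by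
      simp_rw [ea, eb, mul_comm (inner ℂ (e _) _)]
      rw [e.tsum_inner_mul_inner, ContinuousLinearMap.adjoint_inner_left]
      rfl
    simp_rw [e1]
    refine hD _ _ a2 b2 (van_iff.2 ⟨_, _, a3.and (ae_all_iff.2 a4), b3.and (ae_all_iff.2 b4), fun x x' hx hx' hxx => ?_⟩)
    have := hpq (x, y) (x', y') hx.1 hx'.1 ⟨hxx, hL⟩
    simp only [ker] at this ⊢
    rw [← this]
    refine tsum_congr fun n => ?_
    rw [hx.2 n, hx'.2 n]
  have hs : Summable fun j => ⟪b j, R (a j)⟫ := sa.summable_inner sb R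
  rw [← key, hs.tsum_prod]
  exact tsum_congr fun n => amp_inner _ _ _ _
end Amp
end OpSynthAux

namespace OpSynthAux
open Filter Topology ENNReal
section Blk
variable {X X₁ X₂ : Type} [MeasurableSpace X] [MeasurableSpace X₁] [MeasurableSpace X₂]

lemma diag_zero {μ : Measure X} {H : Type} [NormedAddCommGroup H] [InnerProductSpace ℂ H] [CompleteSpace H]
    (W : H →L[ℂ] Lp ℂ 2 μ) (h : H) (hh : ∀ᵐ x ∂μ, W h x ≠ 0) {ξ η : ℕ → Lp ℂ 2 μ} (hξ : SqS ξ) (hη : SqS η)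
    (hA : Ann ξ η (W.comp (ContinuousLinearMap.adjoint W))) : ∑' n, ⟪η n, ξ n⟫ = 0 := by
  obtain ⟨α, β, mα, mβ, ⟨p, q, hp, hq, hpq⟩, hk⟩ := l4 hξ hη
  have hn : ∀ n, ∀ᵐ x ∂μ, x ∉ α n ∩ β n := fun n => by
    have mA := (mα n).inter (mβ n)
    have h1 := kills_inner (hk _ hA n) ((off_chi mA (W h)).mono inter_subset_left)
      ((off_chi mA (W h)).mono inter_subset_right)
    rw [ContinuousLinearMap.comp_apply, ← ContinuousLinearMap.adjoint_inner_left, inner_self_eq_zero] at h1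
    have h2 : ⟪h, ContinuousLinearMap.adjoint W (chi μ (α n ∩ β n) (W h))⟫ = 0 := by rw [h1, inner_zero_right]
    rw [ContinuousLinearMap.adjoint_inner_right, ← chi_idem mA, chi_inner mA, inner_self_eq_zero] at h2
    have h3 := chi_coe mA (W h)
    rw [h2] at h3
    filter_upwards [h3, hh, Lp.coeFn_zero ℂ 2 μ] with x e1 e2 e3 hx
    rw [e3, indicator_of_mem hx] at e1
    exact e2 e1.symm
  rw [tsum_inner_eq hξ hη]
  refine integral_eq_zero_of_ae ?_
  filter_upwards [ae_all_iff.2 hn, hp, hq] with x h1 h2 h3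
  by_contra hc
  obtain ⟨n, hn1, hn2⟩ := hpq x x h2 h3 hc
  exact h1 n ⟨hn1, hn2⟩

lemma norm_le_of_inner {H K : Type} [NormedAddCommGroup H] [InnerProductSpace ℂ H] [NormedAddCommGroup K]
    [InnerProductSpace ℂ K] (T : H →L[ℂ] K) {C : ℝ} (hC : 0 ≤ C) (h : ∀ g f, ‖⟪g, T f⟫‖ ≤ C * (‖g‖ * ‖f‖)) : ‖T‖ ≤ C := by
  refine T.opNorm_le_bound hC fun f => ?_
  have h1 := h (T f) f
  rw [inner_self_eq_norm_sq_to_K] at h1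
  simp at h1
  by_cases h0 : ‖T f‖ = 0
  · rw [h0]; positivity
  · have : 0 < ‖T f‖ := lt_of_le_of_ne (norm_nonneg _) (Ne.symm h0)
    nlinarith

lemma chi_sqb {μ : Measure X} {ι : Type} [Countable ι] {A : ι → Set X} (hA : ∀ i, MeasurableSet (A i))
    (hd : ∀ i j, i ≠ j → Disjoint (A i) (A j)) (f : Lp ℂ 2 μ) : SqB (fun i => chi μ (A i) f) ‖f‖ := by
  refine ⟨norm_nonneg _, ?_⟩
  simp_rw [enorm_sq]
  rw [← lintegral_tsum fun i => ((lp_meas _).enorm.pow_const 2).aemeasurable,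
    ENNReal.ofReal_pow (norm_nonneg _), ofReal_norm, enorm_sq]
  refine lintegral_mono_ae ?_
  filter_upwards [ae_all_iff.2 fun i => chi_coe (hA i) f] with x hx
  simp_rw [hx]
  by_cases h : ∃ i, x ∈ A i
  · obtain ⟨i, hi⟩ := h
    rw [tsum_eq_single i]
    · simp [hi]
    · intro j hj
      have : x ∉ A j := fun h => (Set.disjoint_left.1 (hd j i hj) h hi)
      simp [this]
  · push Not at h
    simp [h]

lemma block_norm {μ₁ : Measure X₁} {μ₂ : Measure X₂} {ι : Type} [Fintype ι] {A : ι → Set X₁} {B : ι → Set X₂}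
    (hA : ∀ i, MeasurableSet (A i)) (hdA : ∀ i j, i ≠ j → Disjoint (A i) (A j))
    (hB : ∀ i, MeasurableSet (B i)) (hdB : ∀ i j, i ≠ j → Disjoint (B i) (B j))
    (T : ι → Lp ℂ 2 μ₁ →L[ℂ] Lp ℂ 2 μ₂) {C : ℝ} (hC : 0 ≤ C) (hT : ∀ i, ‖T i‖ ≤ C) :
    ‖∑ i, chi μ₂ (B i) ∘L T i ∘L chi μ₁ (A i)‖ ≤ C := by
  haveI : Countable ι := Finite.to_countable
  refine norm_le_of_inner _ hC fun g f => ?_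
  have h1 := chi_sqb hA hdA f
  have h2 := chi_sqb hB hdB g
  have h3 : SqB (fun i => T i (chi μ₁ (A i) f)) (C * ‖f‖) := by
    refine ⟨by positivity, ?_⟩
    rw [mul_pow, ENNReal.ofReal_mul (by positivity)]
    refine le_trans ?_ (mul_le_mul_right h1.2 _)
    rw [← ENNReal.tsum_mul_left]
    refine ENNReal.tsum_le_tsum fun i => ?_
    rw [ENNReal.ofReal_pow hC, ← mul_pow]
    gcongr
    rw [← ofReal_norm, ← ofReal_norm, ← ENNReal.ofReal_mul hC]
    exact ENNReal.ofReal_le_ofReal ((T i).le_of_opNorm_le (hT i) _)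
  have h4 := SqB.cs h3 h2 (ContinuousLinearMap.id ℂ _)
  rw [ContinuousLinearMap.sum_apply, inner_sum]
  simp only [ContinuousLinearMap.comp_apply, ContinuousLinearMap.id_apply, chi_inner (hB _), tsum_fintype] at h4 ⊢
  refine h4.trans ?_
  have : ‖ContinuousLinearMap.id ℂ (Lp ℂ 2 μ₂)‖ ≤ 1 := ContinuousLinearMap.norm_id_le
  calc _ ≤ 1 * (‖g‖ * (C * ‖f‖)) := by gcongr
    _ = _ := by ring

lemma exists_hb (H : Type) [NormedAddCommGroup H] [InnerProductSpace ℂ H] [CompleteSpace H]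
    [TopologicalSpace.SeparableSpace H] : ∃ (ι : Type) (_ : Countable ι), Nonempty (HilbertBasis ι ℂ H) := by
  obtain ⟨w, b, hb⟩ := exists_hilbertBasis ℂ H
  refine ⟨w, ?_, ⟨b⟩⟩
  refine Pairwise.countable_of_isOpen_disjoint (s := fun i : w => Metric.ball (b i) (1/2)) ?_
    (fun i => Metric.isOpen_ball) (fun i => ⟨b i, by simp⟩)
  intro i j hij
  refine Metric.ball_disjoint_ball ?_
  have h1 : ‖b i - b j‖ ^ 2 = 2 := by
    rw [@norm_sub_sq ℂ, b.orthonormal.2 hij, b.orthonormal.1, b.orthonormal.1]; norm_num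
  rw [dist_eq_norm]
  nlinarith [norm_nonneg (b i - b j)]
end Blk
end OpSynthAux

namespace OpSynthAux
open Filter Topology ENNReal
section Tot
variable {Z X Y : Type} [MeasurableSpace Z] [MeasurableSpace X] [MeasurableSpace Y]

abbrev Ca := ℕ → Bool

def Cyl (k : ℕ) (I : Set Ca) : Prop := MeasurableSet I ∧ ∀ z z' : Ca, (∀ i < k, z i = z' i) → z ∈ I → z' ∈ I

lemma cyl_pi : IsPiSystem {I | ∃ k, Cyl k I} := by
  rintro I ⟨k, h1, h2⟩ J ⟨l, h3, h4⟩ -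
  exact ⟨max k l, h1.inter h3, fun z z' h hz => ⟨h2 z z' (fun i hi => h i (lt_max_of_lt_left hi)) hz.1,
    h4 z z' (fun i hi => h i (lt_max_of_lt_right hi)) hz.2⟩⟩

lemma cyl_gen : MeasurableSpace.generateFrom {I | ∃ k, Cyl k I} = (inferInstance : MeasurableSpace Ca) := by
  refine le_antisymm (MeasurableSpace.generateFrom_le fun I hI => hI.choose_spec.1) ?_
  refine iSup_le fun i => ?_
  rintro _ ⟨B, hB, rfl⟩
  refine MeasurableSpace.measurableSet_generateFrom ⟨i + 1, measurable_pi_apply i hB, fun z z' h hz => ?_⟩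
  simpa only [mem_preimage, ← h i (Nat.lt_succ_self i)] using hz

lemma cyl_univ : Cyl 0 univ := ⟨MeasurableSet.univ, fun _ _ _ _ => trivial⟩

def one (m : Measure Z) [IsFiniteMeasure m] : Lp ℂ 2 m := (memLp_const (1:ℂ)).toLp
lemma one_coe (m : Measure Z) [IsFiniteMeasure m] : one m =ᵐ[m] fun _ => 1 := (memLp_const (1:ℂ)).coeFn_toLp

lemma int_pi {m : Measure Ca} {ν : Measure Y} [IsFiniteMeasure m] [SigmaFinite ν] {f : Ca × Y → ℂ}
    (hf : Integrable f (m.prod ν)) (h : ∀ I B, (∃ k, Cyl k I) → MeasurableSet B → ∫ p in I ×ˢ B, f p ∂(m.prod ν) = 0) :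
    f =ᵐ[m.prod ν] 0 := by
  suffices hh : ∀ s, MeasurableSet s → ∫ p in s, f p ∂(m.prod ν) = 0 from
    hf.ae_eq_zero_of_forall_setIntegral_eq_zero fun s hs _ => hh s hs
  intro s hs
  have hgen := generateFrom_eq_prod (C := {I | ∃ k, Cyl k I}) (D := {B : Set Y | MeasurableSet B}) cyl_gen
    MeasurableSpace.generateFrom_measurableSet ⟨fun _ => univ, fun _ => ⟨0, cyl_univ⟩, iUnion_const _⟩
    isCountablySpanning_measurableSet
  induction s, hs using MeasurableSpace.induction_on_inter hgen.symm (cyl_pi.prod MeasurableSpace.isPiSystem_measurableSet) with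
  | empty => simp
  | basic t ht =>
    obtain ⟨I, hI, B, hB, rfl⟩ := ht
    exact h I B hI hB
  | compl t ht ih =>
    have h0 := h univ univ ⟨0, cyl_univ⟩ MeasurableSet.univ
    have h1 := integral_add_compl ht hf
    rw [ih, zero_add] at h1
    rw [h1]
    simpa using h0
  | iUnion t hd ht ih =>
    rw [integral_iUnion ht hd hf.integrableOn]
    simp [ih]

lemma ell_chi {m : Measure Z} {ν : Measure Y} [SigmaFinite m] [SigmaFinite ν] {I : Set Z} (hI : MeasurableSet I)
    (a : Lp ℂ 2 m) (w : Lp ℂ 2 ν) : ell ν (chi m I a) w = chi (m.prod ν) (I ×ˢ univ) (ell ν a w) := by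
  refine Lp.ext ?_
  filter_upwards [ell_coe (chi m I a) w, ell_coe a w, chi_coe (hI.prod MeasurableSet.univ) (ell ν a w),
    Measure.quasiMeasurePreserving_fst.ae (chi_coe hI a)] with p h1 h2 h3 h4
  rw [h1, h3, h4]
  by_cases hp : p.1 ∈ I
  · rw [indicator_of_mem hp, indicator_of_mem (by simpa using hp), h2]
  · rw [indicator_of_notMem hp, indicator_of_notMem (by simpa using hp), zero_mul]

lemma exists_s (ν : Measure Y) [SigmaFinite ν] : ∃ s : Lp ℂ 2 ν, ∀ᵐ y ∂ν, s y ≠ 0 := by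
  obtain ⟨s, hs, hp, hi⟩ := exists_wt ν
  have hm : MemLp (fun y => (s y : ℂ)) 2 ν := (memLp_iff (by fun_prop)).2 (lt_of_le_of_lt hi one_lt_top)
  refine ⟨hm.toLp, ?_⟩
  filter_upwards [hm.coeFn_toLp] with y hy
  rw [hy]
  exact_mod_cast (hp y).ne'

def TA (m : Measure Ca) [IsFiniteMeasure m] (ν : Measure Y) [SigmaFinite ν] : Set (Lp ℂ 2 (m.prod ν)) :=
  {f | ∃ k I w, Cyl k I ∧ f = ell ν (chi m I (one m)) w}

lemma TA_total (m : Measure Ca) [IsFiniteMeasure m] (ν : Measure Y) [SigmaFinite ν] :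
    (Submodule.span ℂ (TA m ν)).topologicalClosure = ⊤ := by
  rw [Submodule.topologicalClosure_eq_top_iff, Submodule.eq_bot_iff]
  intro F hF
  obtain ⟨s, hs⟩ := exists_s ν
  have h0 : ∀ I B, (∃ k, Cyl k I) → MeasurableSet B →
      ∫ p in I ×ˢ B, F p * (starRingEnd ℂ) (ell ν (one m) s p) ∂(m.prod ν) = 0 := by
    rintro I B ⟨k, hI⟩ hB
    have h1 : ⟪ell ν (chi m I (one m)) (chi ν B s), F⟫ = 0 :=
      (Submodule.mem_orthogonal _ _).1 hF _ (Submodule.subset_span ⟨k, I, _, hI, rfl⟩)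
    rw [inner_eq] at h1
    rw [← h1, ← integral_indicator (hI.1.prod hB)]
    refine integral_congr_ae ?_
    filter_upwards [ell_coe (chi m I (one m)) (chi ν B s), ell_coe (one m) s, 
      Measure.quasiMeasurePreserving_fst.ae (chi_coe hI.1 (one m)),
      Measure.quasiMeasurePreserving_snd.ae (chi_coe hB s)] with p h1 h2 h3 h4
    rw [h1, h3, h4]
    by_cases hp : p.1 ∈ I <;> by_cases hq : p.2 ∈ B <;> simp [hp, hq, h2, indicator]
  have h2 := int_pi (integrable_inner (ell ν (one m) s) F) h0
  refine Lp.ext ?_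
  filter_upwards [h2, ell_coe (one m) s, Measure.quasiMeasurePreserving_fst.ae (one_coe m),
      Measure.quasiMeasurePreserving_snd.ae hs, Lp.coeFn_zero ℂ 2 (m.prod ν)] with p h1 h2 h3 h4 h5
  rw [h5]
  rw [h2, h3] at h1
  simpa [h4] using h1
end Tot
end OpSynthAux

namespace OpSynthAux
open Filter Topology ENNReal
section Cell
variable {Z X X₁ X₂ Y₁ Y₂ : Type} [MeasurableSpace Z] [MeasurableSpace X] [MeasurableSpace X₁] [MeasurableSpace X₂]
  [MeasurableSpace Y₁] [MeasurableSpace Y₂]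

lemma chi_sum {μ : Measure X} {ι : Type} [Fintype ι] {A : ι → Set X} (hA : ∀ i, MeasurableSet (A i))
    (hd : ∀ i j, i ≠ j → Disjoint (A i) (A j)) (hc : ∀ x, ∃ i, x ∈ A i) (f : Lp ℂ 2 μ) :
    ∑ i, chi μ (A i) f = f := by
  haveI : Countable ι := Finite.to_countable
  refine Lp.ext ?_
  filter_upwards [Lp.coeFn_finsetSum Finset.univ fun i => chi μ (A i) f,
    ae_all_iff.2 fun i => chi_coe (hA i) f] with x h1 h2
  rw [h1, Finset.sum_apply]
  obtain ⟨i, hi⟩ := hc x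
  rw [Finset.sum_eq_single i]
  · rw [h2, indicator_of_mem hi]
  · intro j _ hj
    rw [h2, indicator_of_notMem]
    exact fun h => (Set.disjoint_left.1 (hd j i hj) h hi)
  · simp

lemma wcomp_chi {P : Measure X} {μ : Measure Z} {φ : X → Z} {w : X → ℂ} {C : ℝ} (h : Dom P μ φ w C)
    {I : Set Z} (hI : MeasurableSet I) (a : Lp ℂ 2 μ) :
    wcomp h (chi μ I a) = chi P (φ ⁻¹' I) (wcomp h a) :=
  wcomp_mulOp h (BM.ind hI) ((BM.ind hI).comp h.1) a

lemma adj_chi {P : Measure X} {μ : Measure Z} {φ : X → Z} {w : X → ℂ} {C : ℝ} (h : Dom P μ φ w C)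
    {I : Set Z} (hI : MeasurableSet I) (f : Lp ℂ 2 P) :
    chi μ I (ContinuousLinearMap.adjoint (wcomp h) f) = 
    ContinuousLinearMap.adjoint (wcomp h) (chi P (φ ⁻¹' I) f) :=
  (adj_mulOp h (BM.ind hI) f).symm

lemma chi_chi_zero {μ : Measure X} {A B : Set X} (hA : MeasurableSet A) (hB : MeasurableSet B)
    (hd : Disjoint A B) (f : Lp ℂ 2 μ) : chi μ A (chi μ B f) = 0 := by
  refine Lp.ext ?_
  filter_upwards [chi_coe hA (chi μ B f), chi_coe hB f, Lp.coeFn_zero ℂ 2 μ] with x h1 h2 h3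
  rw [h1, h3]
  by_cases h : x ∈ A
  · rw [indicator_of_mem h, h2, indicator_of_notMem (Set.disjoint_left.1 hd h)]; rfl
  · rw [indicator_of_notMem h]; rfl

lemma chi_chi_sub {μ : Measure X} {A B : Set X} (hA : MeasurableSet A) (hB : MeasurableSet B)
    (hd : A ⊆ B) (f : Lp ℂ 2 μ) : chi μ A (chi μ B f) = chi μ A f := by
  refine Lp.ext ?_
  filter_upwards [chi_coe hA (chi μ B f), chi_coe hB f, chi_coe hA f] with x h1 h2 h3
  rw [h1, h3]
  by_cases h : x ∈ A
  · rw [indicator_of_mem h, h2, indicator_of_mem (hd h), indicator_of_mem h]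
  · rw [indicator_of_notMem h, indicator_of_notMem h]

def Kc {k : ℕ} (c : Fin k → Bool) : Set Ca := {z | ∀ i : Fin k, z i = c i}

lemma Kc_meas {k : ℕ} (c : Fin k → Bool) : MeasurableSet (Kc c) := by
  have : Kc c = ⋂ i : Fin k, (fun z : Ca => z i) ⁻¹' {c i} := by ext z; simp [Kc]
  rw [this]
  exact MeasurableSet.iInter fun i => measurable_pi_apply _ (measurableSet_singleton _)

lemma Kc_disj {k : ℕ} (c d : Fin k → Bool) (h : c ≠ d) : Disjoint (Kc c) (Kc d) := by
  rw [Set.disjoint_left]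
  intro z h1 h2
  exact h (funext fun i => (h1 i).symm.trans (h2 i))

lemma Kc_cyl {k l : ℕ} (hkl : l ≤ k) (c : Fin k → Bool) {I : Set Ca} (hI : Cyl l I) :
    Kc c ⊆ I ∨ Disjoint (Kc c) I := by
  by_cases h : ∃ z, z ∈ Kc c ∧ z ∈ I
  · left
    obtain ⟨z, h1, h2⟩ := h
    exact fun z' hz' => hI.2 z z' (fun i hi => (h1 ⟨i, hi.trans_le hkl⟩).trans (hz' ⟨i, hi.trans_le hkl⟩).symm) h2
  · right
    rw [Set.disjoint_left]
    exact fun z h1 h2 => h ⟨z, h1, h2⟩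

variable {μ₁ : Measure X₁} {μ₂ : Measure X₂} {ν₁ : Measure Y₁} {ν₂ : Measure Y₂} [SigmaFinite μ₁] [SigmaFinite μ₂]
  [SigmaFinite ν₁] [SigmaFinite ν₂]

lemma null_pr_right {E : Set (Y₁ × Y₂)} (h : MargNull ν₁ ν₂ E) :
    MargNull (μ₁.prod ν₁) (μ₂.prod ν₂) (pr univ E) := by
  obtain ⟨p, q, hp, hq, hpq⟩ := margNull_iff.1 h
  exact margNull_iff.2 ⟨fun x => p x.2, fun y => q y.2, Measure.quasiMeasurePreserving_snd.ae hp,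
    Measure.quasiMeasurePreserving_snd.ae hq, fun x y h1 h2 h3 => hpq _ _ h1 h2 h3.2⟩

lemma null_pr_left {E : Set (X₁ × X₂)} (h : MargNull μ₁ μ₂ E) :
    MargNull (μ₁.prod ν₁) (μ₂.prod ν₂) (pr E univ) := by
  obtain ⟨p, q, hp, hq, hpq⟩ := margNull_iff.1 h
  exact margNull_iff.2 ⟨fun x => p x.1, fun y => q y.1, Measure.quasiMeasurePreserving_fst.ae hp,
    Measure.quasiMeasurePreserving_fst.ae hq, fun x y h1 h2 h3 => hpq _ _ h1 h2 h3.1⟩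

lemma off_ell {μ : Measure X₁} {ν : Measure Y₁} [SigmaFinite μ] [SigmaFinite ν] {α : Set Y₁} (a : Lp ℂ 2 μ)
    {f : Lp ℂ 2 ν} (hf : Off ν α f) : Off (μ.prod ν) (univ ×ˢ α) (ell ν a f) := by
  filter_upwards [ell_coe a f, Measure.quasiMeasurePreserving_snd.ae hf] with p h1 h2 h3
  rw [h1, h2 (fun h => h3 ⟨trivial, h⟩), mul_zero]

lemma slice_Mmax {L : Set (Y₁ × Y₂)} {S : Lp ℂ 2 (μ₁.prod ν₁) →L[ℂ] Lp ℂ 2 (μ₂.prod ν₂)}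
    (hS : S ∈ Mmax (μ₁.prod ν₁) (μ₂.prod ν₂) (pr univ L)) (a : Lp ℂ 2 μ₁) (b : Lp ℂ 2 μ₂) (t : ℂ) :
    t • (ContinuousLinearMap.adjoint (ell ν₂ b) ∘L S ∘L ell ν₁ a) ∈ Mmax ν₁ ν₂ L := by
  intro α β hα hβ hm
  refine kills_of_inner fun f g hf hg => ?_
  have h1 : Kills S (univ ×ˢ α) (univ ×ˢ β) := hS _ _ (MeasurableSet.univ.prod hα) (MeasurableSet.univ.prod hβ)
    ((null_pr_right hm).mono (by rintro p ⟨⟨h1, h2⟩, h3⟩; exact ⟨trivial, ⟨h1.2, h2.2⟩, h3.2⟩))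
  simp only [ContinuousLinearMap.smul_apply, ContinuousLinearMap.comp_apply, inner_smul_right]
  rw [ContinuousLinearMap.adjoint_inner_right, kills_inner h1 (off_ell a hf) (off_ell b hg), mul_zero]

def Sc (m : Measure Ca) [IsFiniteMeasure m] {F : X₁ → Ca} {r : X₁ → ℂ} {G : X₂ → Ca} {r' : X₂ → ℂ} (h : Dom μ₁ m F r 1) (h' : Dom μ₂ m G r' 1)
    (S : Lp ℂ 2 (μ₁.prod ν₁) →L[ℂ] Lp ℂ 2 (μ₂.prod ν₂)) (K : Set Ca) : Lp ℂ 2 ν₁ →L[ℂ] Lp ℂ 2 ν₂ :=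
  (((‖chi m K (one m)‖ ^ 2)⁻¹ : ℝ) : ℂ) • (ContinuousLinearMap.adjoint (ell ν₂ (wcomp h' (chi m K (one m)))) ∘L S ∘L
    ell ν₁ (wcomp h (chi m K (one m))))

variable {m : Measure Ca} [IsFiniteMeasure m] {F : X₁ → Ca} {r : X₁ → ℂ} {G : X₂ → Ca} {r' : X₂ → ℂ}

lemma wc_le {P : Measure X} {μ : Measure Z} {φ : X → Z} {w : X → ℂ} (h : Dom P μ φ w 1) (a : Lp ℂ 2 μ) :
    ‖wcomp h a‖ ≤ ‖a‖ := by
  have := (wcomp h).le_of_opNorm_le (wcomp_norm h) a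
  simpa using this

lemma Sc_norm (h : Dom μ₁ m F r 1) (h' : Dom μ₂ m G r' 1)
    (S : Lp ℂ 2 (μ₁.prod ν₁) →L[ℂ] Lp ℂ 2 (μ₂.prod ν₂)) (K : Set Ca) : ‖Sc m h h' S K‖ ≤ ‖S‖ := by
  rw [Sc, norm_smul]
  set x := chi m K (one m)
  have h1 : ‖ContinuousLinearMap.adjoint (ell ν₂ (wcomp h' x)) ∘L S ∘L ell ν₁ (wcomp h x)‖ ≤ ‖x‖ * (‖S‖ * ‖x‖) := by
    refine (ContinuousLinearMap.opNorm_comp_le _ _).trans ?_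
    refine mul_le_mul ?_ ?_ (norm_nonneg _) (norm_nonneg _)
    · rw [LinearIsometryEquiv.norm_map]
      exact (ell_norm _).trans (wc_le h' x)
    · refine (ContinuousLinearMap.opNorm_comp_le _ _).trans ?_
      gcongr
      exact (ell_norm _).trans (wc_le h x)
  by_cases h0 : ‖x‖ = 0
  · simp [h0]
  · have h2 : 0 < ‖x‖ := lt_of_le_of_ne (norm_nonneg _) (Ne.symm h0)
    rw [Complex.norm_real, Real.norm_eq_abs, abs_of_nonneg (by positivity), inv_mul_le_iff₀ (by positivity)]
    nlinarith

variable {ι : Type} [Countable ι]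

def Rk (h : Dom μ₁ m F r 1) (h' : Dom μ₂ m G r' 1) (e : HilbertBasis ι ℂ (Lp ℂ 2 m))
    (S : Lp ℂ 2 (μ₁.prod ν₁) →L[ℂ] Lp ℂ 2 (μ₂.prod ν₂)) (k : ℕ) : Lp ℂ 2 (m.prod ν₁) →L[ℂ] Lp ℂ 2 (m.prod ν₂) :=
  ∑ c : Fin k → Bool, chi (m.prod ν₂) (Kc c ×ˢ univ) ∘L amp e.orthonormal (Sc m h h' S (Kc c)) ∘L
    chi (m.prod ν₁) (Kc c ×ˢ univ)

lemma Rk_norm (h : Dom μ₁ m F r 1) (h' : Dom μ₂ m G r' 1) (e : HilbertBasis ι ℂ (Lp ℂ 2 m))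
    (S : Lp ℂ 2 (μ₁.prod ν₁) →L[ℂ] Lp ℂ 2 (μ₂.prod ν₂)) (k : ℕ) : ‖Rk h h' e S k‖ ≤ ‖S‖ :=
  block_norm (fun c => (Kc_meas c).prod MeasurableSet.univ)
    (fun c d hcd => Set.disjoint_prod.2 (Or.inl (Kc_disj c d hcd)))
    (fun c => (Kc_meas c).prod MeasurableSet.univ)
    (fun c d hcd => Set.disjoint_prod.2 (Or.inl (Kc_disj c d hcd))) _ (norm_nonneg _)
    fun c => (amp_norm _ _).trans (Sc_norm h h' S _)

lemma Sc_ell (h : Dom μ₁ m F r 1) (h' : Dom μ₂ m G r' 1) (e : HilbertBasis ι ℂ (Lp ℂ 2 m))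
    (S : Lp ℂ 2 (μ₁.prod ν₁) →L[ℂ] Lp ℂ 2 (μ₂.prod ν₂)) (K : Set Ca) (w : Lp ℂ 2 ν₁) (w' : Lp ℂ 2 ν₂) :
    ⟪ell ν₂ (chi m K (one m)) w', amp e.orthonormal (Sc m h h' S K) (ell ν₁ (chi m K (one m)) w)⟫ =
    ⟪wcomp (hat h' ν₂) (ell ν₂ (chi m K (one m)) w'), S (wcomp (hat h ν₁) (ell ν₁ (chi m K (one m)) w))⟫ := by
  rw [amp_ell, hat_ell h', hat_ell h, Sc]
  set x := chi m K (one m)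
  simp only [ContinuousLinearMap.smul_apply, ContinuousLinearMap.comp_apply, inner_smul_right]
  rw [ContinuousLinearMap.adjoint_inner_right, inner_self_eq_norm_sq_to_K, ← mul_assoc]
  by_cases h0 : ‖x‖ = 0
  · have h1 : wcomp h x = 0 := by rw [norm_eq_zero.1 h0, map_zero]
    have h2 : ‖ell ν₁ (wcomp h x)‖ ≤ 0 := by simpa [h1] using ell_norm (ν := ν₁) (wcomp h x)
    rw [norm_le_zero_iff.1 h2]
    simp
  · have : ((‖x‖ : ℂ) ^ 2) * (((‖x‖ ^ 2)⁻¹ : ℝ) : ℂ) = 1 := by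
      push_cast
      exact mul_inv_cancel₀ (pow_ne_zero 2 (by exact_mod_cast h0))
    have h3 := congrArg (· * ⟪ell ν₂ (wcomp h' x) w', S (ell ν₁ (wcomp h x) w)⟫) this
    simpa using h3

lemma Rk_exact (h : Dom μ₁ m F r 1) (h' : Dom μ₂ m G r' 1) (e : HilbertBasis ι ℂ (Lp ℂ 2 m))
    {S : Lp ℂ 2 (μ₁.prod ν₁) →L[ℂ] Lp ℂ 2 (μ₂.prod ν₂)}
    (hk : ∀ (i : ℕ) (b : Bool), Kills S ({x | F x i = b} ×ˢ univ) ({y | G y i = !b} ×ˢ univ))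
    {k l l' : ℕ} (hl : l ≤ k) (hl' : l' ≤ k) {I J : Set Ca} (hI : Cyl l I) (hJ : Cyl l' J) (w : Lp ℂ 2 ν₁) (w' : Lp ℂ 2 ν₂) :
    ⟪ell ν₂ (chi m J (one m)) w', Rk h h' e S k (ell ν₁ (chi m I (one m)) w)⟫ =
    ⟪wcomp (hat h' ν₂) (ell ν₂ (chi m J (one m)) w'), S (wcomp (hat h ν₁) (ell ν₁ (chi m I (one m)) w))⟫ := by
  have mK : ∀ c : Fin k → Bool, MeasurableSet (Kc c ×ˢ (univ : Set Y₁)) := fun c => (Kc_meas c).prod MeasurableSet.univ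
  have mK' : ∀ c : Fin k → Bool, MeasurableSet (Kc c ×ˢ (univ : Set Y₂)) := fun c => (Kc_meas c).prod MeasurableSet.univ
  have hcov : ∀ z : Ca, ∃ c : Fin k → Bool, z ∈ Kc c := fun z => ⟨fun i => z i, fun i => rfl⟩
  set f := ell ν₁ (chi m I (one m)) w with hf
  set g := ell ν₂ (chi m J (one m)) w' with hg
  have hcf : ∑ c : Fin k → Bool, chi (m.prod ν₁) (Kc c ×ˢ univ) f = f := chi_sum mK
    (fun c d hcd => Set.disjoint_prod.2 (Or.inl (Kc_disj c d hcd))) (fun p => (hcov p.1).imp fun c hc => ⟨hc, trivial⟩) f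
  have hcg : ∑ c : Fin k → Bool, chi (m.prod ν₂) (Kc c ×ˢ univ) g = g := chi_sum mK'
    (fun c d hcd => Set.disjoint_prod.2 (Or.inl (Kc_disj c d hcd))) (fun p => (hcov p.1).imp fun c hc => ⟨hc, trivial⟩) g
  have hoff : ∀ c d : Fin k → Bool, c ≠ d → ⟪wcomp (hat h' ν₂) (chi (m.prod ν₂) (Kc d ×ˢ univ) g),
      S (wcomp (hat h ν₁) (chi (m.prod ν₁) (Kc c ×ˢ univ) f))⟫ = 0 := by
    intro c d hcd
    obtain ⟨i, hi⟩ := Function.ne_iff.1 hcd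
    rw [wcomp_chi _ (mK c), wcomp_chi _ (mK' d)]
    refine kills_inner (hk i (c i)) ((off_chi ((hat h ν₁).1 (mK c)) _).mono ?_)
      ((off_chi ((hat h' ν₂).1 (mK' d)) _).mono ?_)
    · rintro p ⟨hp, -⟩
      exact ⟨hp i, trivial⟩
    · rintro p ⟨hp, -⟩
      refine ⟨(hp i).trans ?_, trivial⟩
      cases h1 : c i <;> cases h2 : d i <;> simp_all
  conv_rhs => rw [← hcf, ← hcg]
  simp only [map_sum, sum_inner, inner_sum]
  rw [Rk, ContinuousLinearMap.sum_apply, inner_sum]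
  refine Finset.sum_congr rfl fun c _ => ?_
  rw [Finset.sum_eq_single c (fun d _ hd => hoff c d hd.symm) (by simp)]
  simp only [ContinuousLinearMap.comp_apply]
  rw [chi_inner (mK' c)]
  have h1 : chi (m.prod ν₁) (Kc c ×ˢ univ) f = ell ν₁ (chi m (Kc c) (one m)) w ∨ chi (m.prod ν₁) (Kc c ×ˢ univ) f = 0 := by
    rcases Kc_cyl hl c hI with h1 | h1
    · left
      rw [hf, ell_chi hI.1, chi_chi_sub (mK c) (hI.1.prod MeasurableSet.univ) (Set.prod_mono_left h1), ell_chi (Kc_meas c)]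
    · right
      rw [hf, ell_chi hI.1, chi_chi_zero (mK c) (hI.1.prod MeasurableSet.univ) (Set.disjoint_prod.2 (Or.inl h1))]
  have h2 : chi (m.prod ν₂) (Kc c ×ˢ univ) g = ell ν₂ (chi m (Kc c) (one m)) w' ∨ chi (m.prod ν₂) (Kc c ×ˢ univ) g = 0 := by
    rcases Kc_cyl hl' c hJ with h1 | h1
    · left
      rw [hg, ell_chi hJ.1, chi_chi_sub (mK' c) (hJ.1.prod MeasurableSet.univ) (Set.prod_mono_left h1), ell_chi (Kc_meas c)]
    · right
      rw [hg, ell_chi hJ.1, chi_chi_zero (mK' c) (hJ.1.prod MeasurableSet.univ) (Set.disjoint_prod.2 (Or.inl h1))]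
  rcases h1 with h1 | h1
  · rcases h2 with h2 | h2
    · rw [h1, h2, Sc_ell]
    · rw [h2, map_zero, inner_zero_left, inner_zero_left]
  · rw [h1]; simp

lemma cell_zero (h : Dom μ₁ m F r 1) (h' : Dom μ₂ m G r' 1) {D : Set (X₁ × X₂)} {L : Set (Y₁ × Y₂)}
    (hD : (wcomp h').comp (ContinuousLinearMap.adjoint (wcomp h)) ∈ NN μ₁ μ₂ D)
    (hL : Mmax ν₁ ν₂ L ⊆ NN ν₁ ν₂ L) {S : Lp ℂ 2 (μ₁.prod ν₁) →L[ℂ] Lp ℂ 2 (μ₂.prod ν₂)}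
    (hS : S ∈ Mmax (μ₁.prod ν₁) (μ₂.prod ν₂) (pr univ L))
    (hk : ∀ (i : ℕ) (b : Bool), Kills S ({x | F x i = b} ×ˢ univ) ({y | G y i = !b} ×ˢ univ))
    {ξ : ℕ → Lp ℂ 2 (μ₁.prod ν₁)} {η : ℕ → Lp ℂ 2 (μ₂.prod ν₂)} (hξ : SqS ξ) (hη : SqS η)
    (hv : Van (pr D L) ξ η) :
    ∑' n, ⟪wcomp (hat h' ν₂) (ContinuousLinearMap.adjoint (wcomp (hat h' ν₂)) (η n)),
      S (wcomp (hat h ν₁) (ContinuousLinearMap.adjoint (wcomp (hat h ν₁)) (ξ n)))⟫ = 0 := by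
  haveI : Fact ((2:ℝ≥0∞) ≠ ∞) := ⟨by norm_num⟩
  obtain ⟨ι, _, ⟨e⟩⟩ := exists_hb (Lp ℂ 2 m)
  set W := wcomp (hat h ν₁) with hW
  set W' := wcomp (hat h' ν₂) with hW'
  set Q : Lp ℂ 2 (m.prod ν₁) →L[ℂ] Lp ℂ 2 (m.prod ν₂) := ContinuousLinearMap.adjoint W' ∘L S ∘L W with hQ
  have hlim : ∀ g f, Tendsto (fun k => ⟪g, Rk h h' e S k f⟫) atTop (𝓝 ⟪g, Q f⟫) := fun g f =>
    tendsto_of_total _ Q ‖S‖ (Rk_norm h h' e S) (TA m ν₁) (TA m ν₂) (TA_total m ν₁) (TA_total m ν₂) (by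
      rintro _ ⟨l, I, w, hI, rfl⟩ _ ⟨l', J, w', hJ, rfl⟩
      refine tendsto_const_nhds.congr' ?_
      filter_upwards [eventually_ge_atTop (max l l')] with k hk'
      rw [Rk_exact h h' e hk ((le_max_left _ _).trans hk') ((le_max_right _ _).trans hk') hI hJ, hQ]
      simp only [ContinuousLinearMap.comp_apply]
      rw [ContinuousLinearMap.adjoint_inner_right]) f g
  have h1 := tendsto_omega _ Q ‖S‖ (Rk_norm h h' e S) hlim (hξ.map (ContinuousLinearMap.adjoint W))
    (hη.map (ContinuousLinearMap.adjoint W'))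
  have h2 : ∀ k, ∑' n, ⟪ContinuousLinearMap.adjoint W' (η n), Rk h h' e S k (ContinuousLinearMap.adjoint W (ξ n))⟫ = 0 := by
    intro k
    have mK : ∀ c : Fin k → Bool, MeasurableSet (Kc c ×ˢ (univ : Set Y₁)) := fun c => (Kc_meas c).prod MeasurableSet.univ
    have mK' : ∀ c : Fin k → Bool, MeasurableSet (Kc c ×ˢ (univ : Set Y₂)) := fun c => (Kc_meas c).prod MeasurableSet.univ
    simp only [Rk, ContinuousLinearMap.sum_apply, inner_sum]
    rw [Summable.tsum_finsetSum fun c _ => (hξ.map (ContinuousLinearMap.adjoint W)).summable_inner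
      (hη.map (ContinuousLinearMap.adjoint W')) (chi (m.prod ν₂) (Kc c ×ˢ univ) ∘L amp e.orthonormal (Sc m h h' S (Kc c)) ∘L
    chi (m.prod ν₁) (Kc c ×ˢ univ))]
    refine Finset.sum_eq_zero fun c _ => ?_
    have mA := (hat h ν₁).1 (mK c)
    have mB := (hat h' ν₂).1 (mK' c)
    have h3 := amp_zero h h' e hD (hL (slice_Mmax hS (wcomp h (chi m (Kc c) (one m))) (wcomp h' (chi m (Kc c) (one m)))
      (((‖chi m (Kc c) (one m)‖ ^ 2)⁻¹ : ℝ) : ℂ))) (hξ.map (chi _ _)) (hη.map (chi _ _))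
      (van_mulOp (BM.ind mA) (BM.ind mB) (hv.subset fun p hp => hp.1))
    rw [← h3]
    refine tsum_congr fun n => ?_
    simp only [ContinuousLinearMap.comp_apply]
    rw [chi_inner (mK' c), adj_chi _ (mK c), adj_chi _ (mK' c)]
    rfl
  simp only [h2] at h1
  have h4 := tendsto_nhds_unique h1 tendsto_const_nhds
  rw [← h4]
  refine tsum_congr fun n => ?_
  simp only [hQ, ContinuousLinearMap.comp_apply]
  rw [ContinuousLinearMap.adjoint_inner_right]
end Cell
end OpSynthAux

namespace OpSynthAux
open Filter Topology ENNReal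
section DL
variable {X X₁ X₂ Y Y₁ Y₂ : Type} [MeasurableSpace X] [MeasurableSpace X₁] [MeasurableSpace X₂]
  [MeasurableSpace Y] [MeasurableSpace Y₁] [MeasurableSpace Y₂]
variable {μ₁ : Measure X₁} {μ₂ : Measure X₂} {ν₁ : Measure Y₁} {ν₂ : Measure Y₂} [SigmaFinite μ₁] [SigmaFinite μ₂]
  [SigmaFinite ν₁] [SigmaFinite ν₂]

lemma hat_ne {m : Measure Ca} [IsFiniteMeasure m] {F : X → Ca} {μ : Measure X} {ν : Measure Y} [SigmaFinite μ] [SigmaFinite ν]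
    {s : X → ℝ} (hs : ∀ x, 0 < s x) (h : Dom μ m F (fun x => (s x : ℂ)) 1) :
    ∃ f : Lp ℂ 2 (m.prod ν), ∀ᵐ p ∂(μ.prod ν), wcomp (hat h ν) f p ≠ 0 := by
  obtain ⟨t, ht⟩ := exists_s ν
  refine ⟨ell ν (one m) t, ?_⟩
  rw [hat_ell h]
  filter_upwards [ell_coe (wcomp h (one m)) t, Measure.quasiMeasurePreserving_fst.ae (wcomp_coe h (one m)),
    Measure.quasiMeasurePreserving_fst.ae (h.ae (one_coe m)), Measure.quasiMeasurePreserving_snd.ae ht] with p h1 h2 h3 h4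
  have h5 : (s p.1 : ℂ) ≠ 0 := by exact_mod_cast (hs p.1).ne'
  rw [h1, h2, h3.resolve_left h5]
  simpa [h4] using h5

lemma tsum_conj_zero {H : Type} [NormedAddCommGroup H] [InnerProductSpace ℂ H] {a b : ℕ → H}
    (h : ∑' n, ⟪a n, b n⟫ = 0) : ∑' n, ⟪b n, a n⟫ = 0 := by
  have := congrArg (starRingEnd ℂ) h
  rw [Complex.conj_tsum, map_zero] at this
  simpa only [inner_conj_symm] using this

lemma dlemma [StandardBorelSpace X₁] [StandardBorelSpace X₂] [Nonempty X₁] [Nonempty X₂] {F : X₁ → Ca} {G : X₂ → Ca}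
    (hF : Measurable F) (hG : Measurable G) {L : Set (Y₁ × Y₂)}
    (hL : Mmax ν₁ ν₂ L ⊆ NN ν₁ ν₂ L) {S : Lp ℂ 2 (μ₁.prod ν₁) →L[ℂ] Lp ℂ 2 (μ₂.prod ν₂)}
    (hS : S ∈ Mmax (μ₁.prod ν₁) (μ₂.prod ν₂) (pr univ L))
    (hk : ∀ (i : ℕ) (b : Bool), Kills S ({x | F x i = b} ×ˢ univ) ({y | G y i = !b} ×ˢ univ))
    {ξ : ℕ → Lp ℂ 2 (μ₁.prod ν₁)} {η : ℕ → Lp ℂ 2 (μ₂.prod ν₂)} (hξ : SqS ξ) (hη : SqS η)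
    (hv : Van (pr {p | F p.1 = G p.2} L) ξ η) : ∑' n, ⟪η n, S (ξ n)⟫ = 0 := by
  obtain ⟨m, _, K, _, s₁, s₂, φ₁, φ₂, w₁, w₂, hs₁, hs₂, f1, f2⟩ := exists_fib μ₁ μ₂ hF hG
  have hnn := Fib.nn f1 f2 inferInstance
  have h := f1.dom
  have h' := f2.dom
  obtain ⟨p₁, hp₁⟩ := hat_ne (ν := ν₁) hs₁ h
  obtain ⟨p₂, hp₂⟩ := hat_ne (ν := ν₂) hs₂ h'
  have key : ∀ a b u v, BM a → BM b → BM u → BM v →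
      ∑' n, ⟪wcomp (hat h' ν₂) (ContinuousLinearMap.adjoint (wcomp (hat h' ν₂)) (mulOp _ b (η n))),
      mulOp _ v (S (mulOp _ u (wcomp (hat h ν₁) (ContinuousLinearMap.adjoint (wcomp (hat h ν₁)) (mulOp _ a (ξ n))))))⟫ = 0 := by
    intro a b u v ha hb hu hvv
    exact cell_zero h h' hnn hL (Mmax_mulOp hS hu hvv) (fun i b => (hk i b).mulOp hu hvv)
      (hξ.map (mulOp _ a)) (hη.map (mulOp _ b)) (van_mulOp ha hb (hv.subset fun p hp => hp.1))
  set W := wcomp (hat h ν₁)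
  set W' := wcomp (hat h' ν₂)
  have key2 : ∀ b v, BM b → BM v → ∑' n, ⟪W' (ContinuousLinearMap.adjoint W' (mulOp _ b (η n))),
      mulOp _ v (S (ξ n))⟫ = 0 := by
    intro b v hb hvv
    set V : Lp ℂ 2 (μ₂.prod ν₂) →L[ℂ] Lp ℂ 2 (μ₁.prod ν₁) :=
      ContinuousLinearMap.adjoint (mulOp _ v ∘L S) ∘L W' ∘L ContinuousLinearMap.adjoint W' ∘L mulOp _ b with hV
    have hi : ∀ n f, ⟪V (η n), f⟫ = ⟪W' (ContinuousLinearMap.adjoint W' (mulOp _ b (η n))), mulOp _ v (S f)⟫ := by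
      intro n f
      simp only [hV, ContinuousLinearMap.comp_apply]
      rw [ContinuousLinearMap.adjoint_inner_left]
      rfl
    have h1 := diag_zero W p₁ hp₁ hξ (hη.map V) (by
      intro u u' hu hu'
      simp only [hi, ContinuousLinearMap.comp_apply]
      exact key u b u' v hu hb hu' hvv)
    simpa only [hi] using h1
  refine tsum_conj_zero ?_
  refine diag_zero W' p₂ hp₂ hη (hξ.map S) ?_
  intro u v hu hvv
  simp only [ContinuousLinearMap.comp_apply, inner_mulOp hvv]
  exact tsum_conj_zero (key2 u _ hu hvv.conj)
end DL
end OpSynthAux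

namespace OpSynthAux
open Filter Topology ENNReal
section Main
variable {X X₁ X₂ Y Y₁ Y₂ : Type} [MeasurableSpace X] [MeasurableSpace X₁] [MeasurableSpace X₂]
  [MeasurableSpace Y] [MeasurableSpace Y₁] [MeasurableSpace Y₂]

section Gen
variable {μ₁ : Measure X₁} {μ₂ : Measure X₂}

lemma Kills.sum {ι : Type} [Fintype ι] {T : ι → Lp ℂ 2 μ₁ →L[ℂ] Lp ℂ 2 μ₂} {α : Set X₁} {β : Set X₂}
    (h : ∀ i, Kills (T i) α β) : Kills (∑ i, T i) α β := kills_of_inner fun f g hf hg => by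
  rw [ContinuousLinearMap.sum_apply, inner_sum]
  exact Finset.sum_eq_zero fun i _ => kills_inner (h i) hf hg

lemma Kills.lim {T : ℕ → Lp ℂ 2 μ₁ →L[ℂ] Lp ℂ 2 μ₂} {S : Lp ℂ 2 μ₁ →L[ℂ] Lp ℂ 2 μ₂} {α : Set X₁} {β : Set X₂}
    (h : ∀ᶠ n in (hyperfilter ℕ : Filter ℕ), Kills (T n) α β)
    (hS : ∀ g f, Tendsto (fun n => ⟪g, T n f⟫) (hyperfilter ℕ : Filter ℕ) (𝓝 ⟪g, S f⟫)) : Kills S α β :=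
  kills_of_inner fun f g hf hg => by
    refine tendsto_nhds_unique (hS g f) (tendsto_const_nhds.congr' ?_)
    filter_upwards [h] with n hn
    exact (kills_inner hn hf hg).symm

lemma null_empty : MargNull μ₁ μ₂ (∅ : Set (X₁ × X₂)) :=
  margNull_iff.2 ⟨fun _ => True, fun _ => True, by simp, by simp, by simp⟩

lemma Mmax_kills {κ : Set (X₁ × X₂)} {T : Lp ℂ 2 μ₁ →L[ℂ] Lp ℂ 2 μ₂} (h : T ∈ Mmax μ₁ μ₂ κ) {α : Set X₁} {β : Set X₂}
    (hα : MeasurableSet α) (hβ : MeasurableSet β) (hd : ∀ x ∈ α, ∀ y ∈ β, (x, y) ∉ κ) : Kills T α β :=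
  h α β hα hβ (null_empty.mono fun p hp => (hd _ hp.1.1 _ hp.1.2 hp.2).elim)

lemma omega_split {ι : Type} [Fintype ι] {A : ι → Set X₁} {B : ι → Set X₂}
    (hA : ∀ i, MeasurableSet (A i)) (hdA : ∀ i j, i ≠ j → Disjoint (A i) (A j)) (hcA : ∀ x, ∃ i, x ∈ A i)
    (hB : ∀ i, MeasurableSet (B i)) (hdB : ∀ i j, i ≠ j → Disjoint (B i) (B j)) (hcB : ∀ x, ∃ i, x ∈ B i)
    (T : Lp ℂ 2 μ₁ →L[ℂ] Lp ℂ 2 μ₂) {ξ : ℕ → Lp ℂ 2 μ₁} {η : ℕ → Lp ℂ 2 μ₂} (hξ : SqS ξ) (hη : SqS η)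
    (h0 : ∀ i j, i ≠ j → ∑' n, ⟪chi μ₂ (B j) (η n), T (chi μ₁ (A i) (ξ n))⟫ = 0) :
    ∑' n, ⟪η n, (∑ i, chi μ₂ (B i) ∘L T ∘L chi μ₁ (A i)) (ξ n)⟫ = ∑' n, ⟪η n, T (ξ n)⟫ := by
  have hs : ∀ i j, Summable fun n => ⟪chi μ₂ (B j) (η n), T (chi μ₁ (A i) (ξ n))⟫ := fun i j =>
    (hξ.map (chi μ₁ (A i))).summable_inner (hη.map (chi μ₂ (B j))) T
  have e1 : ∀ n, ⟪η n, T (ξ n)⟫ = ∑ i, ∑ j, ⟪chi μ₂ (B j) (η n), T (chi μ₁ (A i) (ξ n))⟫ := by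
    intro n
    conv_lhs => rw [← chi_sum hA hdA hcA (ξ n), ← chi_sum hB hdB hcB (η n)]
    simp only [map_sum, sum_inner, inner_sum]
  have e2 : ∀ n, ⟪η n, (∑ i, chi μ₂ (B i) ∘L T ∘L chi μ₁ (A i)) (ξ n)⟫ =
      ∑ i, ⟪chi μ₂ (B i) (η n), T (chi μ₁ (A i) (ξ n))⟫ := by
    intro n
    rw [ContinuousLinearMap.sum_apply, inner_sum]
    exact Finset.sum_congr rfl fun i _ => chi_inner (hB i) _ _
  simp only [e1, e2]
  rw [Summable.tsum_finsetSum fun i _ => hs i i, Summable.tsum_finsetSum fun i _ => summable_sum fun j _ => hs i j]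
  refine Finset.sum_congr rfl fun i _ => ?_
  rw [Summable.tsum_finsetSum fun j _ => hs i j, Finset.sum_eq_single i (fun j _ hj => h0 i j hj.symm) (by simp)]
end Gen

section Cnt
open Classical in
def cnt (α : ℕ → Set X) (n : ℕ) (x : X) : ℕ := ((Finset.range n).filter fun m => x ∉ α m).card

lemma cnt_meas {α : ℕ → Set X} (h : ∀ n, MeasurableSet (α n)) (n : ℕ) : Measurable (cnt α n) := by
  classical
  have : cnt α n = fun x => ∑ m ∈ Finset.range n, if x ∉ α m then 1 else 0 := by
    funext x
    rw [cnt, Finset.card_filter]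
  rw [this]
  exact Finset.measurable_sum _ fun m _ => Measurable.ite (h m).compl measurable_const measurable_const

lemma cnt_le (α : ℕ → Set X) (n : ℕ) (x : X) : cnt α n x < n + 1 := by
  classical
  have := Finset.card_filter_le (Finset.range n) fun m => x ∉ α m
  rw [Finset.card_range] at this
  rw [cnt]
  convert Nat.lt_succ_of_le this

lemma cnt_cmp {α : ℕ → Set X₁} {β : ℕ → Set X₂} (h : Cmp α β) (n : ℕ) (x : X₁) (y : X₂) :
    (∀ m < n, x ∉ α m → y ∉ β m) ∨ (∀ m < n, y ∉ β m → x ∉ α m) := by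
  by_contra hc
  push Not at hc
  obtain ⟨⟨m, hm, h1, h2⟩, l, hl, h3, h4⟩ := hc
  rcases h.2.2 m l with h5 | h5
  · exact h3 (h5.2 h2)
  · exact h1 (h5.1 h4)

lemma cnt_eq {α : ℕ → Set X₁} {β : ℕ → Set X₂} (h : Cmp α β) {n : ℕ} {x : X₁} {y : X₂} (he : cnt α n x = cnt β n y)
    {m : ℕ} (hm : m < n) : x ∈ α m ↔ y ∈ β m := by
  classical
  rw [cnt, cnt] at he
  have key : ((Finset.range n).filter fun m => x ∉ α m) = (Finset.range n).filter fun m => y ∉ β m := by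
    rcases cnt_cmp h n x y with h1 | h1
    · refine Finset.eq_of_subset_of_card_le (fun l hl => ?_) (by convert he.ge)
      simp only [Finset.mem_filter, Finset.mem_range] at hl ⊢
      exact ⟨hl.1, h1 l hl.1 hl.2⟩
    · symm
      refine Finset.eq_of_subset_of_card_le (fun l hl => ?_) (by convert he.le)
      simp only [Finset.mem_filter, Finset.mem_range] at hl ⊢
      exact ⟨hl.1, h1 l hl.1 hl.2⟩
  have := Finset.ext_iff.1 key m
  simp only [Finset.mem_filter, Finset.mem_range, hm, true_and] at this
  exact not_iff_not.1 this

lemma cnt_lt {α : ℕ → Set X₁} {β : ℕ → Set X₂} {n : ℕ} {x : X₁} {y : X₂} (he : cnt α n x < cnt β n y) :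
    (x, y) ∉ CS α β := by
  classical
  intro hc
  rw [cnt, cnt] at he
  refine absurd he (not_lt.2 ?_)
  refine Finset.card_le_card fun l hl => ?_
  simp only [Finset.mem_filter, Finset.mem_range] at hl ⊢
  exact ⟨hl.1, fun h => hl.2 (hc l h)⟩

lemma cnt_gt {α : ℕ → Set X₁} {β : ℕ → Set X₂} (h : Cmp α β) {n : ℕ} {x : X₁} {y : X₂} (he : cnt β n y < cnt α n x) :
    (x, y) ∈ CS α β := by
  classical
  have : ∃ l, x ∉ α l ∧ y ∈ β l := by
    by_contra hc
    push Not at hc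
    rw [cnt, cnt] at he
    refine absurd he (not_lt.2 ?_)
    refine Finset.card_le_card fun l hl => ?_
    simp only [Finset.mem_filter, Finset.mem_range] at hl ⊢
    exact ⟨hl.1, hc l hl.2⟩
  obtain ⟨l, h1, h2⟩ := this
  intro m hm
  rcases h.2.2 l m with h5 | h5
  · exact h5.2 h2
  · exact (h1 (h5.1 hm)).elim

open Classical in
def mrg (F : X → Ca) (α : ℕ → Set X) (x : X) : Ca := fun i =>
  if i % 2 = 0 then F x (i / 2) else decide (x ∈ α (i / 2))

lemma mrg_meas {F : X → Ca} {α : ℕ → Set X} (hF : Measurable F) (h : ∀ n, MeasurableSet (α n)) : Measurable (mrg F α) := by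
  classical
  refine measurable_pi_lambda _ fun i => ?_
  unfold mrg
  by_cases hi : i % 2 = 0
  · simp only [hi, if_true]
    exact (measurable_pi_apply _).comp hF
  · simp only [hi, if_false]
    refine measurable_to_bool ?_
    have : (fun x => decide (x ∈ α (i / 2))) ⁻¹' {true} = α (i / 2) := by ext x; simp
    rw [this]
    exact h _

lemma mrg_eq {F : X₁ → Ca} {G : X₂ → Ca} {α : ℕ → Set X₁} {β : ℕ → Set X₂} {x : X₁} {y : X₂}
    (h : mrg F α x = mrg G β y) : F x = G y ∧ (x, y) ∈ CS α β := by
  constructor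
  · funext i
    have := congrFun h (2 * i)
    simpa [mrg] using this
  · intro m hm
    have := congrFun h (2 * m + 1)
    have e : (2 * m + 1) / 2 = m := by omega
    have e' : (2 * m + 1) % 2 = 1 := by omega
    simpa [mrg, e, e', hm] using this
end Cnt

variable {μ₁ : Measure X₁} {μ₂ : Measure X₂} {ν₁ : Measure Y₁} {ν₂ : Measure Y₂} [SigmaFinite μ₁] [SigmaFinite μ₂]
  [SigmaFinite ν₁] [SigmaFinite ν₂]

lemma main_ind [StandardBorelSpace X₁] [StandardBorelSpace X₂] [Nonempty X₁] [Nonempty X₂]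
    {κ : Set (X₁ × X₂)} {L : Set (Y₁ × Y₂)} (hL : Mmax ν₁ ν₂ L ⊆ NN ν₁ ν₂ L)
    (hκL : Mmax (μ₁.prod ν₁) (μ₂.prod ν₂) (pr κ L) ⊆ NN (μ₁.prod ν₁) (μ₂.prod ν₂) (pr κ L)) (k : ℕ) :
    ∀ (α : Fin k → ℕ → Set X₁) (β : Fin k → ℕ → Set X₂), (∀ j, Cmp (α j) (β j)) →
    ∀ (F : X₁ → Ca) (G : X₂ → Ca), Measurable F → Measurable G →
    ∀ T ∈ Mmax (μ₁.prod ν₁) (μ₂.prod ν₂) (pr (κ ∪ {p | ∀ j, p ∈ CS (α j) (β j)}) L),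
    (∀ (i : ℕ) (b : Bool), Kills T ({x | F x i = b} ×ˢ univ) ({y | G y i = !b} ×ˢ univ)) →
    ∀ (ξ : ℕ → Lp ℂ 2 (μ₁.prod ν₁)) (η : ℕ → Lp ℂ 2 (μ₂.prod ν₂)), SqS ξ → SqS η →
    Van (pr (κ ∪ {p | (∀ j, p ∈ CS (α j) (β j)) ∧ F p.1 = G p.2}) L) ξ η → ∑' n, ⟪η n, T (ξ n)⟫ = 0 := by
  classical
  induction k with
  | zero =>
    intro α β hc F G hF hG T hT hk ξ η hξ hη hv
    refine dlemma hF hG hL (S := T) ?_ hk hξ hη (hv.subset ?_)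
    · refine Mmax_mono ?_ hT
      exact null_empty.mono (by rintro p ⟨h1, h2⟩; exact h2 ⟨trivial, h1.2⟩)
    · rintro p ⟨h1, h2⟩
      exact ⟨Or.inr ⟨fun j => j.elim0, h1⟩, h2⟩
  | succ k ih =>
    intro α β hc F G hF hG T hT hk ξ η hξ hη hv
    have IH := ih (fun j => α j.succ) (fun j => β j.succ) (fun j => hc j.succ)
    set a := α 0
    set b := β 0
    have hab : Cmp a b := hc 0
    have hall : ∀ p, (∀ j, p ∈ CS (α j) (β j)) ↔ p ∈ CS a b ∧ ∀ j : Fin k, p ∈ CS (α j.succ) (β j.succ) := fun p =>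
      Fin.forall_fin_succ
    have hT' : T ∈ Mmax (μ₁.prod ν₁) (μ₂.prod ν₂) (pr (κ ∪ {p | ∀ j : Fin k, p ∈ CS (α j.succ) (β j.succ)}) L) := by
      refine Mmax_mono ?_ hT
      refine null_empty.mono ?_
      rintro p ⟨⟨h1, h3⟩, h2⟩
      exact h2 ⟨h1.imp id fun h j => h j.succ, h3⟩
    set A : ∀ n : ℕ, Fin (n + 1) → Set (X₁ × Y₁) := fun n i => {x | cnt a n x.1 = i} with hA
    set B : ∀ n : ℕ, Fin (n + 1) → Set (X₂ × Y₂) := fun n i => {x | cnt b n x.1 = i} with hB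
    have mA : ∀ n i, MeasurableSet (A n i) := fun n i =>
      measurableSet_eq_fun ((cnt_meas hab.1 n).comp measurable_fst) measurable_const
    have mB : ∀ n i, MeasurableSet (B n i) := fun n i =>
      measurableSet_eq_fun ((cnt_meas hab.2.1 n).comp measurable_fst) measurable_const
    have dA : ∀ n i j, i ≠ j → Disjoint (A n i) (A n j) := fun n i j hij =>
      Set.disjoint_left.2 fun x h1 h2 => hij (Fin.ext (h1.symm.trans h2))
    have dB : ∀ n i j, i ≠ j → Disjoint (B n i) (B n j) := fun n i j hij =>
      Set.disjoint_left.2 fun x h1 h2 => hij (Fin.ext (h1.symm.trans h2))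
    have cA : ∀ n x, ∃ i, x ∈ A n i := fun n x => ⟨⟨cnt a n x.1, cnt_le _ _ _⟩, rfl⟩
    have cB : ∀ n x, ∃ i, x ∈ B n i := fun n x => ⟨⟨cnt b n x.1, cnt_le _ _ _⟩, rfl⟩
    set R : ℕ → Lp ℂ 2 (μ₁.prod ν₁) →L[ℂ] Lp ℂ 2 (μ₂.prod ν₂) := fun n =>
      ∑ i, chi (μ₂.prod ν₂) (B n i) ∘L T ∘L chi (μ₁.prod ν₁) (A n i) with hR
    have hRn : ∀ n, ‖R n‖ ≤ ‖T‖ := fun n =>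
      block_norm (mA n) (dA n) (mB n) (dB n) (fun _ => T) (norm_nonneg _) fun _ => le_rfl
    have hRo : ∀ n, ∑' l, ⟪η l, R n (ξ l)⟫ = ∑' l, ⟪η l, T (ξ l)⟫ := by
      intro n
      refine omega_split (mA n) (dA n) (cA n) (mB n) (dB n) (cB n) T hξ hη fun i j hij => ?_
      rcases lt_or_gt_of_ne (fun h => hij (Fin.ext h) : (i : ℕ) ≠ j) with hlt | hgt
      · have h1 := hκL (Mmax_rect hT (mA n i) (mB n j) (κ' := pr κ L) (by
          rintro p ⟨⟨h1, h2⟩, h3, h4⟩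
          refine ⟨h1.resolve_right fun h5 => ?_, h2⟩
          refine cnt_lt (n := n) ?_ ((hall _).1 h5).1
          rw [show cnt a n p.1.1 = i from h3, show cnt b n p.2.1 = j from h4]
          exact hlt)) ξ η hξ hη (hv.subset fun p hp => ⟨Or.inl hp.1, hp.2⟩)
        rw [← h1]
        refine tsum_congr fun l => ?_
        simp only [ContinuousLinearMap.comp_apply]
        rw [chi_inner (mB n j)]
      · refine IH F G hF hG T hT' hk _ _ (hξ.map (chi _ _)) (hη.map (chi _ _))
          (van_mulOp (BM.ind (mA n i)) (BM.ind (mB n j)) (hv.subset ?_))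
        rintro p ⟨⟨h1, h2⟩, h3, h4⟩
        refine ⟨h1.imp id fun h5 => ⟨(hall _).2 ⟨cnt_gt hab (n := n) ?_, h5.1⟩, h5.2⟩, h2⟩
        have h3' : p.1 ∈ A n i := by by_contra hc; exact h3 (indicator_of_notMem hc _)
        have h4' : p.2 ∈ B n j := by by_contra hc; exact h4 (indicator_of_notMem hc _)
        rw [show cnt a n p.1.1 = i from h3', show cnt b n p.2.1 = j from h4']
        exact hgt
    obtain ⟨S, hS⟩ := ultralim R ‖T‖ hRn
    have hω := tendsto_omega R S ‖T‖ hRn hS hξ hη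
    simp only [hRo] at hω
    have hω' : ∑' l, ⟪η l, T (ξ l)⟫ = ∑' l, ⟪η l, S (ξ l)⟫ := tendsto_nhds_unique tendsto_const_nhds hω
    rw [hω']
    have hRm : ∀ n m, m < n → ∀ bb : Bool, Kills (R n) ({x | decide (x ∈ a m) = bb} ×ˢ univ) ({y | decide (y ∈ b m) = !bb} ×ˢ univ) := by
      intro n m hm bb
      refine Kills.sum fun i => ?_
      refine Mmax_kills (κ := {p | cnt a n p.1.1 = cnt b n p.2.1}) (Mmax_rect hT (mA n i) (mB n i) ?_) ?_ ?_ ?_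
      · rintro p ⟨-, h1, h2⟩
        exact Eq.trans h1 (Eq.symm h2)
      · refine MeasurableSet.prod ?_ MeasurableSet.univ
        have := hab.1 m
        cases bb
        · convert this.compl using 1; ext x; simp
        · convert this using 1; ext x; simp
      · refine MeasurableSet.prod ?_ MeasurableSet.univ
        have := hab.2.1 m
        cases bb
        · convert this using 1; ext x; simp
        · convert this.compl using 1; ext x; simp
      · rintro x ⟨hx, -⟩ y ⟨hy, -⟩ hxy
        have h1 := cnt_eq hab hxy hm
        have hx' : decide (x.1 ∈ a m) = bb := hx
        have hy' : decide (y.1 ∈ b m) = !bb := hy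
        simp only [h1] at hx'
        rw [hx'] at hy'
        cases bb <;> simp at hy'
    refine IH (mrg F a) (mrg G b) (mrg_meas hF hab.1) (mrg_meas hG hab.2.1) S ?_ ?_ ξ η hξ hη (hv.subset ?_)
    · intro α' β' h1 h2 h3
      exact Kills.lim (Eventually.of_forall fun n => Kills.sum fun i =>
        Kills.mulOp (hT' α' β' h1 h2 h3) (BM.ind (mA n i)) (BM.ind (mB n i))) hS
    · intro i bb
      by_cases hi : i % 2 = 0
      · simp only [mrg, hi, if_true]
        exact Kills.lim (Eventually.of_forall fun n => Kills.sum fun j =>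
          (hk (i / 2) bb).mulOp (BM.ind (mA n j)) (BM.ind (mB n j))) hS
      · simp only [mrg, hi, if_false]
        refine Kills.lim ?_ hS
        have : ∀ᶠ n in (hyperfilter ℕ : Filter ℕ), i / 2 < n := Nat.hyperfilter_le_atTop (eventually_gt_atTop _)
        filter_upwards [this] with n hn
        convert hRm n (i / 2) hn bb
    · rintro p ⟨h1, h2⟩
      refine ⟨h1.imp id fun h3 => ?_, h2⟩
      obtain ⟨h4, h5⟩ := mrg_eq h3.2
      exact ⟨(hall _).2 ⟨h5, h3.1⟩, h4⟩
end Main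
end OpSynthAux

namespace OpSynthAux
open Filter Topology ENNReal
section Fin
variable {X X₁ X₂ Y Y₁ Y₂ : Type} [MeasurableSpace X] [MeasurableSpace X₁] [MeasurableSpace X₂]
  [MeasurableSpace Y] [MeasurableSpace Y₁] [MeasurableSpace Y₂]
variable {μ₁ : Measure X₁} {μ₂ : Measure X₂} {ν₁ : Measure Y₁} {ν₂ : Measure Y₂}

lemma oo_mk {ι : Type} [Encodable ι] {E : Set (X₁ × X₂)} {A : ι → Set X₁} {B : ι → Set X₂}
    (hA : ∀ i, MeasurableSet (A i)) (hB : ∀ i, MeasurableSet (B i)) (h : MargEquiv μ₁ μ₂ E (⋃ i, A i ×ˢ B i)) :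
    OmegaOpen μ₁ μ₂ E := by
  refine ⟨fun n => ⋃ i, ⋃ (_ : Encodable.encode i = n), A i, fun n => ⋃ i, ⋃ (_ : Encodable.encode i = n), B i,
    fun n => MeasurableSet.iUnion fun i => MeasurableSet.iUnion fun _ => hA i,
    fun n => MeasurableSet.iUnion fun i => MeasurableSet.iUnion fun _ => hB i, ?_⟩
  convert h using 1
  ext p
  simp only [mem_iUnion, mem_prod]
  constructor
  · rintro ⟨n, ⟨i, h1, h2⟩, j, h3, h4⟩
    obtain rfl := Encodable.encode_injective (h1.trans h3.symm)
    exact ⟨i, h2, h4⟩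
  · rintro ⟨i, h1, h2⟩
    exact ⟨_, ⟨i, rfl, h1⟩, i, rfl, h2⟩

lemma oo_union {E E' : Set (X₁ × X₂)} (h : OmegaOpen μ₁ μ₂ E) (h' : OmegaOpen μ₁ μ₂ E') : OmegaOpen μ₁ μ₂ (E ∪ E') := by
  obtain ⟨α, β, hα, hβ, hE⟩ := h
  obtain ⟨α', β', hα', hβ', hE'⟩ := h'
  refine oo_mk (ι := ℕ ⊕ ℕ) (A := Sum.elim α α') (B := Sum.elim β β') (by rintro (n | n); exacts [hα n, hα' n])
    (by rintro (n | n); exacts [hβ n, hβ' n]) ((MargNull.union hE hE').mono ?_)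
  have e : (⋃ i, Sum.elim α α' i ×ˢ Sum.elim β β' i) = (⋃ n, α n ×ˢ β n) ∪ ⋃ n, α' n ×ˢ β' n := by
    ext p; simp [Sum.exists]
  rw [e]
  rintro p hp
  simp only [mem_union, mem_diff] at hp ⊢
  tauto

lemma oo_inter {E E' : Set (X₁ × X₂)} (h : OmegaOpen μ₁ μ₂ E) (h' : OmegaOpen μ₁ μ₂ E') : OmegaOpen μ₁ μ₂ (E ∩ E') := by
  obtain ⟨α, β, hα, hβ, hE⟩ := h
  obtain ⟨α', β', hα', hβ', hE'⟩ := h'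
  refine oo_mk (ι := ℕ × ℕ) (A := fun i => α i.1 ∩ α' i.2) (B := fun i => β i.1 ∩ β' i.2)
    (fun i => (hα _).inter (hα' _)) (fun i => (hβ _).inter (hβ' _)) ((MargNull.union hE hE').mono ?_)
  have e : (⋃ i : ℕ × ℕ, (α i.1 ∩ α' i.2) ×ˢ (β i.1 ∩ β' i.2)) = (⋃ n, α n ×ˢ β n) ∩ ⋃ n, α' n ×ˢ β' n := by
    ext p
    simp only [mem_iUnion, mem_prod, mem_inter_iff, Prod.exists]
    constructor
    · rintro ⟨i, j, ⟨h1, h2⟩, h3, h4⟩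
      exact ⟨⟨i, h1, h3⟩, j, h2, h4⟩
    · rintro ⟨⟨i, h1, h3⟩, j, h2, h4⟩
      exact ⟨i, j, ⟨h1, h2⟩, h3, h4⟩
  rw [e]
  rintro p hp
  simp only [mem_union, mem_diff, mem_inter_iff] at hp ⊢
  tauto

variable [SigmaFinite μ₁] [SigmaFinite μ₂] [SigmaFinite ν₁] [SigmaFinite ν₂]

lemma oo_left {E : Set (X₁ × X₂)} (h : OmegaOpen μ₁ μ₂ E) :
    OmegaOpen (μ₁.prod ν₁) (μ₂.prod ν₂) (pr E univ) := by
  obtain ⟨α, β, hα, hβ, hE⟩ := h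
  refine ⟨fun n => α n ×ˢ univ, fun n => β n ×ˢ univ, fun n => (hα n).prod MeasurableSet.univ,
    fun n => (hβ n).prod MeasurableSet.univ, (null_pr_left hE).mono ?_⟩
  rintro p hp
  simp [pr] at hp ⊢
  exact hp

lemma oo_right {E : Set (Y₁ × Y₂)} (h : OmegaOpen ν₁ ν₂ E) :
    OmegaOpen (μ₁.prod ν₁) (μ₂.prod ν₂) (pr univ E) := by
  obtain ⟨α, β, hα, hβ, hE⟩ := h
  refine ⟨fun n => univ ×ˢ α n, fun n => univ ×ˢ β n, fun n => MeasurableSet.univ.prod (hα n),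
    fun n => MeasurableSet.univ.prod (hβ n), (null_pr_right hE).mono ?_⟩
  rintro p hp
  simp [pr] at hp ⊢
  exact hp

lemma flip_pr (D : Set (X₁ × X₂)) (L : Set (Y₁ × Y₂)) : flipProd '' (D ×ˢ L) = pr D L := by
  ext p
  constructor
  · rintro ⟨q, ⟨h1, h2⟩, rfl⟩
    exact ⟨h1, h2⟩
  · rintro ⟨h1, h2⟩
    exact ⟨((p.1.1, p.2.1), (p.1.2, p.2.2)), ⟨h1, h2⟩, rfl⟩

lemma final [StandardBorelSpace X₁] [StandardBorelSpace X₂] [StandardBorelSpace Y₁] [StandardBorelSpace Y₂]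
    {κ κ' : Set (X₁ × X₂)} {lam : Set (Y₁ × Y₂)}
    (hκ : OperatorSynthetic μ₁ μ₂ κ) (hlam : OperatorSynthetic ν₁ ν₂ lam)
    (hκ' : FiniteWidthSet μ₁ μ₂ κ')
    (h : OperatorSynthetic (μ₁.prod ν₁) (μ₂.prod ν₂) (pr κ lam)) :
    OperatorSynthetic (μ₁.prod ν₁) (μ₂.prod ν₂) (pr (κ ∪ κ') lam) := by
  obtain ⟨hκc, -⟩ := hκ
  obtain ⟨hlc, hL⟩ := synth_iff.1 hlam
  obtain ⟨-, hKL⟩ := synth_iff.1 h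
  obtain ⟨k, α, β, hc, hn1, hn2⟩ := fw_cs hκ'
  rw [synth_iff]
  have e : (⋂ j, CS (α j) (β j)) = {p | ∀ j, p ∈ CS (α j) (β j)} := by ext p; simp
  rw [e] at hn1 hn2
  constructor
  · have h1 : OmegaOpen μ₁ μ₂ κ'ᶜ := by
      refine oo_mk (ι := Fin k × ℕ) (A := fun i => α i.1 i.2) (B := fun i => (β i.1 i.2)ᶜ) (fun i => (hc i.1).1 i.2)
        (fun i => ((hc i.1).2.1 i.2).compl) ((MargNull.union hn1 hn2).mono ?_)
      have e2 : (⋃ i : Fin k × ℕ, α i.1 i.2 ×ˢ (β i.1 i.2)ᶜ) = {p | ∀ j, p ∈ CS (α j) (β j)}ᶜ := by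
        ext p; simp [CS]
      rw [e2]
      rintro p hp
      simp only [mem_union, mem_diff, mem_compl_iff, not_not] at hp ⊢
      tauto
    have h2 : (pr (κ ∪ κ') lam)ᶜ = pr (κᶜ ∩ κ'ᶜ) univ ∪ pr univ lamᶜ := by
      ext p
      simp only [pr, mem_union, mem_compl_iff, mem_setOf_eq, mem_inter_iff, mem_univ, and_true, true_and]
      tauto
    rw [OmegaClosed, h2]
    exact oo_union (oo_left (oo_inter hκc h1)) (oo_right hlc)
  · intro T hT ξ η hξ hη hv
    by_cases hne : Nonempty X₁ ∧ Nonempty X₂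
    · haveI := hne.1
      haveI := hne.2
      have hT' : T ∈ Mmax (μ₁.prod ν₁) (μ₂.prod ν₂) (pr (κ ∪ {p | ∀ j, p ∈ CS (α j) (β j)}) lam) := by
        refine Mmax_mono ((null_pr_left hn1).mono ?_) hT
        rintro p ⟨⟨h1, h2⟩, h3⟩
        refine ⟨⟨h1.resolve_left fun h => h3 ⟨Or.inl h, h2⟩, fun h => h3 ⟨Or.inr h, h2⟩⟩, trivial⟩
      have hv' : Van (pr (κ ∪ {p | ∀ j, p ∈ CS (α j) (β j)}) lam) ξ η := by
        refine hv.mono ((null_pr_left hn2).mono ?_)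
        rintro p ⟨⟨h1, h2⟩, h3⟩
        refine ⟨⟨h1.resolve_left fun h => h3 ⟨Or.inl h, h2⟩, fun h => h3 ⟨Or.inr h, h2⟩⟩, trivial⟩
      refine main_ind hL hKL k α β hc (fun _ _ => false) (fun _ _ => false) measurable_const measurable_const T hT' ?_ ξ η
        hξ hη (hv'.subset ?_)
      · intro i b
        refine Mmax_kills hT (MeasurableSet.prod (MeasurableSet.const _) MeasurableSet.univ)
          (MeasurableSet.prod (MeasurableSet.const _) MeasurableSet.univ) ?_
        rintro x ⟨hx, -⟩ y ⟨hy, -⟩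
        cases b <;> simp at hx hy
      · rintro p ⟨h1, h2⟩
        exact ⟨h1.imp id fun h => h.1, h2⟩
    · have h0 : (∀ n, ξ n = 0) ∨ ∀ n, η n = 0 := by
        by_cases h1 : Nonempty X₁
        · right
          intro n
          exact Lp.ext (Eventually.of_forall fun p => (hne ⟨h1, ⟨p.1⟩⟩).elim)
        · left
          intro n
          exact Lp.ext (Eventually.of_forall fun p => (h1 ⟨p.1⟩).elim)
      rcases h0 with h0 | h0 <;> simp [h0]
end Fin
end OpSynthAux

/-- Corollary `c_morear`. -/
theorem statement15
    (X₁ X₂ Y₁ Y₂ : Type)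
    [MeasurableSpace X₁] [StandardBorelSpace X₁]
    [MeasurableSpace X₂] [StandardBorelSpace X₂]
    [MeasurableSpace Y₁] [StandardBorelSpace Y₁]
    [MeasurableSpace Y₂] [StandardBorelSpace Y₂]
    (μ₁ : Measure X₁) (μ₂ : Measure X₂) (ν₁ : Measure Y₁) (ν₂ : Measure Y₂)
    [SigmaFinite μ₁] [SigmaFinite μ₂] [SigmaFinite ν₁] [SigmaFinite ν₂]
    (κ κ' : Set (X₁ × X₂)) (lam : Set (Y₁ × Y₂))
    (hκ : OperatorSynthetic μ₁ μ₂ κ) (hlam : OperatorSynthetic ν₁ ν₂ lam)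
    (hκ' : FiniteWidthSet μ₁ μ₂ κ')
    (h : OperatorSynthetic (μ₁.prod ν₁) (μ₂.prod ν₂) (flipProd '' (κ ×ˢ lam))) :
    OperatorSynthetic (μ₁.prod ν₁) (μ₂.prod ν₂)
      (flipProd '' ((κ ∪ κ') ×ˢ lam)) := by
  rw [OpSynthAux.flip_pr] at h ⊢
  exact OpSynthAux.final hκ hlam hκ' h
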